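/- There are constants c₁, c₂ > 0 and C > 0 such that the following holds. Let γ ∈ (0,1) and Δ ≥ γ^{-C}, let d be sufficiently large (depending on γ), let μ(γ,d) be the probability that two independent uniform points u,v on S^{d−1} satisfy ¼‖u−v‖² ≥ 1−γ, and let n be such that n·μ(γ,d) = Δ. Let V be a set of n independent uniform random points on S^{d−1}, and let G_γ[V] be the graph on V connecting u,v whenever ¼‖u−v‖² ≥ 1−γ (with the uniform distribution over its edges). Then 1 − c₂·√γ ≤ E[sdp₃(G_γ[V])] ≤ 1 − c₁·√γ. -/

import Mathlib

open Finset MeasureTheory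

/-- Feasible solutions of the Goemans–Williamson Max-Cut relaxation strengthened by the
`ℓ₂²` triangle inequalities. -/
def Sdp3Feasible {V : Type} [Fintype V] (X : Matrix V V ℝ) : Prop :=
  X.PosSemidef ∧ (∀ i, X i i = 1) ∧
    (∀ i j k, X i j + X j k - X i k ≤ 1) ∧ (∀ i j k, -1 ≤ X i j + X j k + X i k)

/-- The value `sdp₃(G) = max E_{(u,v)∼E} ¼(X_{uu}+X_{vv}−2X_{uv})` of the
triangle-inequality strengthened Max-Cut SDP for a graph with (ordered, symmetrized)
edge distribution `p`. -/
noncomputable def sdp3 {V : Type} [Fintype V] (p : V → V → ℝ) : ℝ :=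
  sSup ((fun X : Matrix V V ℝ =>
    ∑ i, ∑ j, p i j * ((X i i + X j j - 2 * X i j) / 4)) '' {X | Sdp3Feasible X})

/-- The unit sphere `S^{d-1} ⊆ ℝ^d`. -/
abbrev Sph (d : ℕ) := Metric.sphere (0 : EuclideanSpace ℝ (Fin d)) 1

/-- The uniform probability measure on the unit sphere `S^{d-1}` (normalized surface
measure). -/
noncomputable def sphereUniform (d : ℕ) : Measure (Sph d) :=
  (((volume : Measure (EuclideanSpace ℝ (Fin d))).toSphere Set.univ)⁻¹) •
    (volume : Measure (EuclideanSpace ℝ (Fin d))).toSphere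

/-- `μ(γ,d)`: the probability that two independent uniform points `u, v` of `S^{d-1}`
satisfy `¼‖u − v‖² ≥ 1 − γ`. -/
noncomputable def sphereMu (d : ℕ) (γ : ℝ) : ℝ :=
  (((sphereUniform d).prod (sphereUniform d))
    {p | 1 - γ ≤ ‖(p.1 : EuclideanSpace ℝ (Fin d)) -
      (p.2 : EuclideanSpace ℝ (Fin d))‖ ^ 2 / 4}).toReal

/-- The (ordered, symmetrized) uniform edge distribution of the random geometric graph
`G_γ[V]` on the points `x 0, …, x (n-1)` of the sphere: `u, v` are adjacent whenever
`¼‖u − v‖² ≥ 1 − γ`. -/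
noncomputable def geomEdgeDist (d n : ℕ) (γ : ℝ) (x : Fin n → Sph d) :
    Fin n → Fin n → ℝ := fun i j =>
  (if i ≠ j ∧ 1 - γ ≤ ‖(x i : EuclideanSpace ℝ (Fin d)) -
      (x j : EuclideanSpace ℝ (Fin d))‖ ^ 2 / 4 then 1 else 0) /
    (∑ i' : Fin n, ∑ j' : Fin n,
      if i' ≠ j' ∧ 1 - γ ≤ ‖(x i' : EuclideanSpace ℝ (Fin d)) -
          (x j' : EuclideanSpace ℝ (Fin d))‖ ^ 2 / 4 then (1 : ℝ) else 0)

open scoped RealInnerProductSpace Pointwise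

/-- The map induced on the unit sphere by a linear isometry. -/
noncomputable def sphRot {d : ℕ} (g : EuclideanSpace ℝ (Fin d) ≃ₗᵢ[ℝ] EuclideanSpace ℝ (Fin d))
    (y : Sph d) : Sph d := ⟨g y, by simp⟩

@[simp]
lemma coe_sphRot {d : ℕ} (g : EuclideanSpace ℝ (Fin d) ≃ₗᵢ[ℝ] EuclideanSpace ℝ (Fin d))
    (y : Sph d) : (sphRot g y : EuclideanSpace ℝ (Fin d)) = g y := rfl

lemma continuous_sphRot {d : ℕ} (g : EuclideanSpace ℝ (Fin d) ≃ₗᵢ[ℝ] EuclideanSpace ℝ (Fin d)) :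
    Continuous (sphRot g) :=
  (g.continuous.comp continuous_subtype_val).subtype_mk _

lemma isProbabilityMeasure_sphereUniform {d : ℕ} (hd : d ≠ 0) :
    IsProbabilityMeasure (sphereUniform d) := by
  have : NeZero d := ⟨hd⟩
  constructor
  rw [sphereUniform, Measure.smul_apply, smul_eq_mul]
  refine ENNReal.inv_mul_cancel ?_ (measure_ne_top _ _)
  have := Measure.toSphere_ne_zero (volume : Measure (EuclideanSpace ℝ (Fin d)))
  exact Measure.measure_univ_ne_zero.mpr this

instance {d : ℕ} [NeZero d] : IsProbabilityMeasure (sphereUniform d) :=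
  isProbabilityMeasure_sphereUniform (NeZero.ne d)

lemma measurePreserving_sphRot {d : ℕ}
    (g : EuclideanSpace ℝ (Fin d) ≃ₗᵢ[ℝ] EuclideanSpace ℝ (Fin d)) :
    MeasurePreserving (sphRot g) (sphereUniform d) (sphereUniform d) := by
  have hm : Measurable (sphRot g) := (continuous_sphRot g).measurable
  have key : MeasurePreserving (sphRot g)
      (volume : Measure (EuclideanSpace ℝ (Fin d))).toSphere
      (volume : Measure (EuclideanSpace ℝ (Fin d))).toSphere := by
    refine ⟨hm, ?_⟩
    ext s hs
    rw [Measure.map_apply hm hs, Measure.toSphere_apply' _ (hm hs), Measure.toSphere_apply' _ hs]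
    congr 1
    have hpre := (LinearIsometryEquiv.measurePreserving g).measure_preimage_equiv
      (f := g.toHomeomorph.toMeasurableEquiv)
      (Set.Ioo (0 : ℝ) 1 • ((Subtype.val : Sph d → EuclideanSpace ℝ (Fin d)) '' s))
    rw [← hpre]
    congr 1
    ext v
    simp only [Set.mem_smul, Set.mem_image, Set.mem_preimage]
    constructor
    · rintro ⟨r, hr, _, ⟨y, hy, rfl⟩, rfl⟩
      exact ⟨r, hr, _, ⟨sphRot g y, hy, rfl⟩, by simp⟩
    · rintro ⟨r, hr, _, ⟨y, hy, rfl⟩, hv⟩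
      refine ⟨r, hr, _, ⟨sphRot g.symm y, ?_, rfl⟩, ?_⟩
      · have : sphRot g (sphRot g.symm y) = y := by ext1; simp
        simpa [this] using hy
      · apply g.injective
        simpa using hv
  exact key.smul_measure _

/-- Any two pairs of unit vectors with the same inner product are related by an isometry. -/
lemma exists_isometry_pair {d : ℕ} (p q p' q' : Sph d)
    (h : ⟪(p : EuclideanSpace ℝ (Fin d)), q⟫ = ⟪(p' : EuclideanSpace ℝ (Fin d)), q'⟫) :
    ∃ g : EuclideanSpace ℝ (Fin d) ≃ₗᵢ[ℝ] EuclideanSpace ℝ (Fin d),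
      sphRot g p = p' ∧ sphRot g q = q' := by
  have n1 : ∀ u : Sph d, ‖(u : EuclideanSpace ℝ (Fin d))‖ = 1 := fun u => by simp
  obtain ⟨g₁, hg₁⟩ : ∃ g₁ : EuclideanSpace ℝ (Fin d) ≃ₗᵢ[ℝ] EuclideanSpace ℝ (Fin d),
      g₁ p = p' := ⟨_, Submodule.reflection_sub (v := (p : EuclideanSpace ℝ (Fin d))) (w := p')
          (by rw [n1, n1])⟩
  have h2 := Submodule.reflection_sub (v := g₁ q) (w := (q' : EuclideanSpace ℝ (Fin d)))
    (by rw [LinearIsometryEquiv.norm_map, n1, n1])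
  have h3 : (ℝ ∙ (g₁ q - (q' : EuclideanSpace ℝ (Fin d))))ᗮ.reflection p' =
      (p' : EuclideanSpace ℝ (Fin d)) := by
    rw [Submodule.reflection_eq_self_iff, Submodule.mem_orthogonal_singleton_iff_inner_left,
      inner_sub_right, ← h, ← hg₁, LinearIsometryEquiv.inner_map_map, sub_self]
  exact ⟨g₁.trans (ℝ ∙ (g₁ q - (q' : EuclideanSpace ℝ (Fin d))))ᗮ.reflection,
    by ext1; simp [hg₁, h3], by ext1; simp [h2]⟩

/-- The adjacency function of the geometric graph. -/
noncomputable def sphAdj {d : ℕ} (γ : ℝ) (y z : Sph d) : ℝ :=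
  if 1 - γ ≤ ‖(y : EuclideanSpace ℝ (Fin d)) - z‖ ^ 2 / 4 then 1 else 0

lemma sphAdj_comm {d : ℕ} (γ : ℝ) (y z : Sph d) : sphAdj γ y z = sphAdj γ z y := by
  rw [sphAdj, sphAdj, norm_sub_rev]

lemma sphAdj_nonneg {d : ℕ} (γ : ℝ) (y z : Sph d) : 0 ≤ sphAdj γ y z := by
  unfold sphAdj; split_ifs <;> norm_num

lemma sphAdj_le_one {d : ℕ} (γ : ℝ) (y z : Sph d) : sphAdj γ y z ≤ 1 := by
  unfold sphAdj; split_ifs <;> norm_num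

lemma sphAdj_sq {d : ℕ} (γ : ℝ) (y z : Sph d) : sphAdj γ y z ^ 2 = sphAdj γ y z := by
  unfold sphAdj; split_ifs <;> norm_num

lemma measurableSet_sphAdj {d : ℕ} (γ : ℝ) :
    MeasurableSet {p : Sph d × Sph d | 1 - γ ≤ ‖(p.1 : EuclideanSpace ℝ (Fin d)) -
      (p.2 : EuclideanSpace ℝ (Fin d))‖ ^ 2 / 4} :=
  (isClosed_le continuous_const (by fun_prop)).measurableSet

lemma measurable_sphAdj {d : ℕ} (γ : ℝ) :
    Measurable (fun p : Sph d × Sph d => sphAdj γ p.1 p.2) :=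
  Measurable.ite (measurableSet_sphAdj γ) measurable_const measurable_const

@[fun_prop]
lemma measurable_sphAdj_comp {α : Type*} [MeasurableSpace α] {d : ℕ} (γ : ℝ) (f g : α → Sph d)
    (hf : Measurable f) (hg : Measurable g) : Measurable (fun a => sphAdj γ (f a) (g a)) := by
  have := (measurable_sphAdj γ).comp (hf.prodMk hg)
  exact this

/-- Evaluation of integrals that depend only on the position relative to a given point. -/
lemma integral_zonal {d : ℕ} (f : ℝ → ℝ) (y y' : Sph d) :
    ∫ z, f ⟪(y : EuclideanSpace ℝ (Fin d)), z⟫ ∂(sphereUniform d) =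
      ∫ z, f ⟪(y' : EuclideanSpace ℝ (Fin d)), z⟫ ∂(sphereUniform d) := by
  obtain ⟨g, hg, -⟩ := exists_isometry_pair y y y' y' (by simp)
  have hg' : g y = y' := congrArg Subtype.val hg
  have hemb : MeasurableEmbedding (sphRot g) := by
    refine (Topology.IsClosedEmbedding.measurableEmbedding ?_)
    refine (continuous_sphRot g).isClosedEmbedding ?_
    intro a b hab
    exact Subtype.ext (g.injective (congrArg Subtype.val hab))
  rw [← (measurePreserving_sphRot g).integral_comp hemb
    (fun z => f ⟪(y' : EuclideanSpace ℝ (Fin d)), z⟫)]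
  simp [← hg']

lemma sphAdj_eq_inner {d : ℕ} (γ : ℝ) (y z : Sph d) :
    sphAdj γ y z = if ⟪(y : EuclideanSpace ℝ (Fin d)), z⟫ ≤ 2 * γ - 1 then 1 else 0 := by
  unfold sphAdj
  congr 1
  rw [norm_sub_sq_real]
  simp only [norm_eq_of_mem_sphere, eq_iff_iff]
  constructor <;> intro h <;> linarith

lemma integral_sphAdj {d : ℕ} [NeZero d] (γ : ℝ) (y : Sph d) :
    ∫ z, sphAdj γ y z ∂(sphereUniform d) = sphereMu d γ := by
  have h1 : sphereMu d γ = ∫ p, sphAdj γ p.1 p.2 ∂((sphereUniform d).prod (sphereUniform d)) := by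
    have : (fun p : Sph d × Sph d => sphAdj γ p.1 p.2) = Set.indicator
        {p : Sph d × Sph d | 1 - γ ≤ ‖(p.1 : EuclideanSpace ℝ (Fin d)) -
      (p.2 : EuclideanSpace ℝ (Fin d))‖ ^ 2 / 4} 1 := by
      ext p
      simp [sphAdj, Set.indicator_apply]
    rw [this, integral_indicator_one (measurableSet_sphAdj γ)]
    rfl
  have hInt : Integrable (fun p : Sph d × Sph d => sphAdj γ p.1 p.2)
      ((sphereUniform d).prod (sphereUniform d)) :=
    Integrable.of_bound (measurable_sphAdj γ).aestronglyMeasurable 1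
      (.of_forall fun p => by
        rw [Real.norm_eq_abs, abs_of_nonneg (sphAdj_nonneg _ _ _)]; exact sphAdj_le_one _ _ _)
  rw [h1, integral_prod _ hInt]
  have : ∀ y', ∫ z, sphAdj γ y' z ∂(sphereUniform d) = ∫ z, sphAdj γ y z ∂(sphereUniform d) := by
    intro y'
    simp only [sphAdj_eq_inner]
    exact integral_zonal (fun t => if t ≤ 2 * γ - 1 then 1 else 0) y' y
  simp [this]

lemma exists_orthonormal_triple {d : ℕ} (hd : 3 ≤ d) :
    ∃ u v w : EuclideanSpace ℝ (Fin d), ⟪u, u⟫ = 1 ∧ ⟪v, v⟫ = 1 ∧ ⟪w, w⟫ = 1 ∧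
      ⟪u, v⟫ = 0 ∧ ⟪u, w⟫ = 0 ∧ ⟪v, w⟫ = 0 := by
  let b : Fin 3 → EuclideanSpace ℝ (Fin d) := fun i =>
    EuclideanSpace.basisFun (Fin d) ℝ (Fin.castLE hd i)
  have hb : Orthonormal ℝ b :=
    (EuclideanSpace.basisFun (Fin d) ℝ).orthonormal.comp _ (Fin.castLE_injective hd)
  have h := orthonormal_iff_ite.mp hb
  exact ⟨b 0, b 1, b 2, by simpa using h 0 0, by simpa using h 1 1, by simpa using h 2 2,
    by simpa using h 0 1, by simpa using h 0 2, by simpa using h 1 2⟩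

/-- A set of unit vectors of `ℝ^d` bounded by a zonal condition. -/
noncomputable def capMeasure (d : ℕ) (t : ℝ) (y : Sph d) : ℝ :=
  ∫ z, (if ⟪(y : EuclideanSpace ℝ (Fin d)), z⟫ ≤ t then (1 : ℝ) else 0) ∂(sphereUniform d)

lemma capMeasure_eq {d : ℕ} (t : ℝ) (y y' : Sph d) : capMeasure d t y = capMeasure d t y' :=
  integral_zonal (fun s => if s ≤ t then 1 else 0) y y'

lemma measurable_ite_inner_le {d : ℕ} (t : ℝ) :
    Measurable (fun p : Sph d × Sph d =>
      if ⟪(p.1 : EuclideanSpace ℝ (Fin d)), p.2⟫ ≤ t then (1 : ℝ) else 0) :=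
  Measurable.ite (isClosed_le (by fun_prop) continuous_const).measurableSet
    measurable_const measurable_const

lemma integrable_of_mem_Icc {α : Type*} [MeasurableSpace α] {m : Measure α} [IsFiniteMeasure m]
    {f : α → ℝ} (hf : Measurable f) {A B : ℝ} (h : ∀ x, A ≤ f x ∧ f x ≤ B) : Integrable f m :=
  Integrable.of_bound hf.aestronglyMeasurable (max |A| |B|) (.of_forall fun x => by
    rw [Real.norm_eq_abs]; exact abs_le_max_abs_abs (h x).1 (h x).2)

lemma integrable_ite_inner_le {d : ℕ} [NeZero d] (t : ℝ) (y : Sph d) :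
    Integrable (fun z : Sph d => if ⟪(y : EuclideanSpace ℝ (Fin d)), z⟫ ≤ t then (1 : ℝ) else 0)
      (sphereUniform d) := by
  refine integrable_of_mem_Icc (A := 0) (B := 1) ?_ (fun z => ?_)
  · exact (measurable_ite_inner_le t).comp measurable_prodMk_left
  · split_ifs <;> norm_num

/-- The inner cap of a third of the radius has at most half of the measure. -/
lemma two_mul_capMeasure_le {d : ℕ} (hd : 3 ≤ d) {γ : ℝ} (h0 : 0 < γ) (h1 : γ ≤ 1 / 2) (y : Sph d) :
    2 * capMeasure d (2 * γ / 9 - 1) y ≤ capMeasure d (2 * γ - 1) y := by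
  have : NeZero d := ⟨by omega⟩
  obtain ⟨u, v, -, huu, hvv, -, huv, -, -⟩ := exists_orthonormal_triple hd
  have hvu : ⟪v, u⟫ = 0 := by rw [real_inner_comm, huv]
  set c : ℝ := 1 - 8 * γ / 9 with hc
  set s : ℝ := Real.sqrt (1 - c ^ 2) with hs
  have hs2 : s ^ 2 = 1 - c ^ 2 := Real.sq_sqrt (by rw [hc]; nlinarith)
  have hmem : ∀ x : EuclideanSpace ℝ (Fin d), ⟪x, x⟫ = 1 → x ∈ Metric.sphere
      (0 : EuclideanSpace ℝ (Fin d)) 1 := by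
    intro x hx
    rw [mem_sphere_zero_iff_norm, norm_eq_sqrt_real_inner, hx, Real.sqrt_one]
  let y₀ : Sph d := ⟨u, hmem u huu⟩
  let y₁ : Sph d := ⟨c • u + s • v, hmem _ (by
    simp only [inner_add_left, inner_add_right, inner_smul_left, inner_smul_right, huu, hvv,
        huv, hvu]
    simp; nlinarith)⟩
  let y₂ : Sph d := ⟨c • u - s • v, hmem _ (by
    simp only [inner_sub_left, inner_sub_right, inner_smul_left, inner_smul_right, huu, hvv,
        huv, hvu]
    simp; nlinarith)⟩
  set ρ : ℝ := 2 * Real.sqrt γ / 3 with hρ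
  have hρ0 : 0 < ρ := by positivity
  have hρ2 : ρ ^ 2 = 4 * γ / 9 := by
    rw [hρ, div_pow, mul_pow, Real.sq_sqrt h0.le]; ring
  have hdist : ∀ (x z : Sph d), ‖(x : EuclideanSpace ℝ (Fin d)) + z‖ ^ 2 =
      2 + 2 * ⟪(x : EuclideanSpace ℝ (Fin d)), z⟫ := by
    intro x z
    rw [norm_add_sq_real]
    simp only [norm_eq_of_mem_sphere]; ring
  have hcap : ∀ (x z : Sph d), ⟪(x : EuclideanSpace ℝ (Fin d)), z⟫ ≤ 2 * γ / 9 - 1 →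
      ‖(x : EuclideanSpace ℝ (Fin d)) + z‖ ≤ ρ := by
    intro x z h
    refine abs_le_of_sq_le_sq' ?_ hρ0.le |>.2
    rw [hdist, hρ2]; linarith
  have hcap' : ∀ (x z : Sph d), ‖(x : EuclideanSpace ℝ (Fin d)) + z‖ ≤ 3 * ρ →
      ⟪(x : EuclideanSpace ℝ (Fin d)), z⟫ ≤ 2 * γ - 1 := by
    intro x z h
    have := pow_le_pow_left₀ (norm_nonneg _) h 2
    rw [hdist, mul_pow, hρ2] at this; linarith
  have hsub : ∀ w : EuclideanSpace ℝ (Fin d), ⟪w, w⟫ ≤ 4 * ρ ^ 2 → ‖w‖ ≤ 2 * ρ := by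
    intro w hw
    rw [real_inner_self_eq_norm_sq] at hw
    refine abs_le_of_sq_le_sq' ?_ (by positivity) |>.2
    linarith
  have d1 : ‖(y₀ : EuclideanSpace ℝ (Fin d)) - y₁‖ ≤ 2 * ρ := hsub _ (by
    simp only [y₀, y₁, inner_add_left, inner_add_right, inner_sub_left, inner_sub_right,
      inner_smul_left, inner_smul_right, huu, hvv, huv, hvu]
    simp; nlinarith)
  have d2 : ‖(y₀ : EuclideanSpace ℝ (Fin d)) - y₂‖ ≤ 2 * ρ := hsub _ (by
    simp only [y₀, y₂, inner_sub_left, inner_sub_right,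
      inner_smul_left, inner_smul_right, huu, hvv, huv, hvu]
    simp; nlinarith)
  have d3 : 2 * ρ < ‖(y₁ : EuclideanSpace ℝ (Fin d)) - y₂‖ := by
    refine lt_of_pow_lt_pow_left₀ 2 (norm_nonneg _) ?_
    rw [← real_inner_self_eq_norm_sq]
    simp only [y₁, y₂, inner_add_left, inner_add_right, inner_sub_left, inner_sub_right,
      inner_smul_left, inner_smul_right, huu, hvv, huv, hvu]
    simp only [conj_trivial]
    rw [mul_pow, hρ2]
    nlinarith
  have hpt : ∀ z : Sph d, (if ⟪(y₁ : EuclideanSpace ℝ (Fin d)), z⟫ ≤ 2 * γ / 9 - 1 then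
      (1 : ℝ) else 0) +
      (if ⟪(y₂ : EuclideanSpace ℝ (Fin d)), z⟫ ≤ 2 * γ / 9 - 1 then (1 : ℝ) else 0) ≤
      if ⟪(y₀ : EuclideanSpace ℝ (Fin d)), z⟫ ≤ 2 * γ - 1 then (1 : ℝ) else 0 := by
    intro z
    have k1 : ⟪(y₁ : EuclideanSpace ℝ (Fin d)), z⟫ ≤ 2 * γ / 9 - 1 →
        ⟪(y₀ : EuclideanSpace ℝ (Fin d)), z⟫ ≤ 2 * γ - 1 := by
      intro h
      refine hcap' _ _ ?_
      have e : (y₀ : EuclideanSpace ℝ (Fin d)) + z = (y₀ - y₁) + (y₁ + z) := by abel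
      rw [e]
      linarith [norm_add_le ((y₀ : EuclideanSpace ℝ (Fin d)) - y₁) (y₁ + z), hcap _ _ h]
    have k2 : ⟪(y₂ : EuclideanSpace ℝ (Fin d)), z⟫ ≤ 2 * γ / 9 - 1 →
        ⟪(y₀ : EuclideanSpace ℝ (Fin d)), z⟫ ≤ 2 * γ - 1 := by
      intro h
      refine hcap' _ _ ?_
      have e : (y₀ : EuclideanSpace ℝ (Fin d)) + z = (y₀ - y₂) + (y₂ + z) := by abel
      rw [e]
      linarith [norm_add_le ((y₀ : EuclideanSpace ℝ (Fin d)) - y₂) (y₂ + z), hcap _ _ h]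
    have k3 : ⟪(y₁ : EuclideanSpace ℝ (Fin d)), z⟫ ≤ 2 * γ / 9 - 1 →
        ⟪(y₂ : EuclideanSpace ℝ (Fin d)), z⟫ ≤ 2 * γ / 9 - 1 → False := by
      intro h h'
      have e : (y₁ : EuclideanSpace ℝ (Fin d)) - y₂ = (y₁ + z) - (y₂ + z) := by abel
      rw [e] at d3
      linarith [norm_sub_le ((y₁ : EuclideanSpace ℝ (Fin d)) + z) (y₂ + z), hcap _ _ h, hcap _ _ h']
    clear_value y₀ y₁ y₂
    by_cases q1 : ⟪(y₁ : EuclideanSpace ℝ (Fin d)), z⟫ ≤ 2 * γ / 9 - 1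
    · rw [if_pos q1, if_neg (k3 q1), if_pos (k1 q1), add_zero]
    · by_cases q2 : ⟪(y₂ : EuclideanSpace ℝ (Fin d)), z⟫ ≤ 2 * γ / 9 - 1
      · rw [if_neg q1, if_pos q2, if_pos (k2 q2), zero_add]
      · rw [if_neg q1, if_neg q2, zero_add]
        split_ifs <;> norm_num
  have := integral_mono ((integrable_ite_inner_le _ y₁).add (integrable_ite_inner_le _ y₂))
    (integrable_ite_inner_le _ y₀) hpt
  rw [integral_add' (integrable_ite_inner_le _ y₁) (integrable_ite_inner_le _ y₂)] at this
  change capMeasure d _ y₁ + capMeasure d _ y₂ ≤ capMeasure d _ y₀ at this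
  rw [capMeasure_eq _ y₁ y, capMeasure_eq _ y₂ y, capMeasure_eq _ y₀ y] at this
  linarith

/-- A closed regular polygon on the sphere with odd length and prescribed inner product of
neighbours. -/
lemma exists_polygon {d : ℕ} (hd : 3 ≤ d) {L : ℕ} (hL : Odd L) {s : ℝ}
    (hs : -Real.cos (Real.pi / L) ≤ s) (hs1 : s ≤ 1) :
    ∃ p : ℕ → Sph d, p L = p 0 ∧ ∀ t, ⟪(p t : EuclideanSpace ℝ (Fin d)), p (t + 1)⟫ = s := by
  obtain ⟨u, v, w, huu, hvv, hww, huv, huw, hvw⟩ := exists_orthonormal_triple hd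
  have hvu : ⟪v, u⟫ = 0 := by rw [real_inner_comm, huv]
  have hwu : ⟪w, u⟫ = 0 := by rw [real_inner_comm, huw]
  have hwv : ⟪w, v⟫ = 0 := by rw [real_inner_comm, hvw]
  have hmem : ∀ x : EuclideanSpace ℝ (Fin d), ⟪x, x⟫ = 1 → x ∈ Metric.sphere
      (0 : EuclideanSpace ℝ (Fin d)) 1 := by
    intro x hx
    rw [mem_sphere_zero_iff_norm, norm_eq_sqrt_real_inner, hx, Real.sqrt_one]
  have hL0 : (L : ℝ) ≠ 0 := by
    have := hL.pos; positivity
  set ψ : ℝ := Real.pi - Real.pi / L with hψ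
  have hcos : Real.cos ψ = -Real.cos (Real.pi / L) := by rw [hψ, Real.cos_pi_sub]
  obtain ⟨A, B, hAB, hABs⟩ : ∃ A B : ℝ, A ^ 2 + B ^ 2 = 1 ∧ A ^ 2 * Real.cos ψ + B ^ 2 = s := by
    rcases eq_or_lt_of_le (Real.cos_le_one ψ) with h | h
    · refine ⟨1, 0, by norm_num, ?_⟩
      rw [h]; rw [← hcos, h] at hs; linarith
    · refine ⟨Real.sqrt ((1 - s) / (1 - Real.cos ψ)), Real.sqrt ((s - Real.cos ψ) /
          (1 - Real.cos ψ)), ?_, ?_⟩ <;>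
      rw [Real.sq_sqrt (div_nonneg (by linarith) (by linarith)),
        Real.sq_sqrt (div_nonneg (by linarith) (by linarith))] <;>
      field_simp [sub_ne_zero.mpr h.ne'] <;> ring
  let P : ℝ → EuclideanSpace ℝ (Fin d) := fun a => (A * Real.cos a) • u +
      (A * Real.sin a) • v + B • w
  have hP : ∀ a b, ⟪P a, P b⟫ = A ^ 2 * Real.cos (a - b) + B ^ 2 := by
    intro a b
    simp only [P, inner_add_left, inner_add_right, inner_smul_left, inner_smul_right, huu, hvv, hww,
      huv, huw, hvw, hvu, hwu, hwv, conj_trivial, Real.cos_sub]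
    ring
  refine ⟨fun t => ⟨P (t * ψ), hmem _ (by rw [hP]; simpa using hAB)⟩, ?_, fun t => ?_⟩
  · ext1
    obtain ⟨k, rfl⟩ := hL
    have : ((2 * k + 1 : ℕ) : ℝ) * ψ = k * (2 * Real.pi) := by
      rw [hψ, mul_sub, mul_div_cancel₀ _ hL0]; push_cast; ring
    simp only [this, P, Real.cos_nat_mul_two_pi]
    have h2 := Real.sin_nat_mul_pi (2 * k)
    have h3 : (k : ℝ) * (2 * Real.pi) = ((2 * k : ℕ) : ℝ) * Real.pi := by push_cast; ring
    rw [h3, h2]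
    simp
  · change ⟪P _, P _⟫ = s
    rw [hP, ← hABs]
    congr 2
    rw [← Real.cos_neg]
    congr 1
    push_cast; ring

/-- The sum of a function satisfying the triangle inequalities over an odd closed walk is at
least one. -/
lemma one_le_sum_odd_closed_walk {S : Type*} {e : S → S → ℝ} (hsym : ∀ x y, e x y = e y x)
    (T1 : ∀ x y z, 1 ≤ e x y + e y z + e x z) (T2 : ∀ x y z, e x y + e y z ≤ 1 + e x z)
    (p : ℕ → S) (k : ℕ) (hk : 1 ≤ k) (hp : p (2 * k + 1) = p 0) :
    1 ≤ ∑ t ∈ range (2 * k + 1), e (p t) (p (t + 1)) := by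
  have key : 1 - e (p 0) (p (2 * k)) ≤ ∑ t ∈ range (2 * k), e (p t) (p (t + 1)) := by
    clear hp
    induction k, hk using Nat.le_induction with
    | base =>
      simp [sum_range_succ]
      linarith [T1 (p 0) (p 1) (p 2)]
    | succ k hk ih =>
      rw [show 2 * (k + 1) = 2 * k + 1 + 1 by ring, sum_range_succ, sum_range_succ]
      linarith [T1 (p (2 * k)) (p (2 * k + 1)) (p (2 * k + 1 + 1)),
        T2 (p 0) (p (2 * k)) (p (2 * k + 1 + 1))]
  rw [sum_range_succ, hp, hsym (p (2 * k))]
  linarith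

/-- The orthogonal group of `ℝ^d`. -/
def OrthGroup (d : ℕ) : Type :=
  ↥(unitary (EuclideanSpace ℝ (Fin d) →L[ℝ] EuclideanSpace ℝ (Fin d)))

instance (d : ℕ) : ContinuousStar (EuclideanSpace ℝ (Fin d) →L[ℝ] EuclideanSpace ℝ (Fin d)) :=
  ⟨(ContinuousLinearMap.adjoint (𝕜 := ℝ) (E := EuclideanSpace ℝ (Fin d))
    (F := EuclideanSpace ℝ (Fin d))).continuous⟩

noncomputable instance (d : ℕ) : Group (OrthGroup d) := inferInstanceAs
  (Group ↥(unitary (EuclideanSpace ℝ (Fin d) →L[ℝ] EuclideanSpace ℝ (Fin d))))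

instance (d : ℕ) : TopologicalSpace (OrthGroup d) := inferInstanceAs
  (TopologicalSpace ↥(unitary (EuclideanSpace ℝ (Fin d) →L[ℝ] EuclideanSpace ℝ (Fin d))))

instance (d : ℕ) : IsTopologicalGroup (OrthGroup d) := inferInstanceAs
  (IsTopologicalGroup ↥(unitary (EuclideanSpace ℝ (Fin d) →L[ℝ] EuclideanSpace ℝ (Fin d))))

instance (d : ℕ) : SecondCountableTopology (OrthGroup d) :=
  TopologicalSpace.Subtype.secondCountableTopology
    ((unitary (EuclideanSpace ℝ (Fin d) →L[ℝ] EuclideanSpace ℝ (Fin d)) :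
      Set (EuclideanSpace ℝ (Fin d) →L[ℝ] EuclideanSpace ℝ (Fin d))))

instance (d : ℕ) : MeasurableSpace (OrthGroup d) := borel _

instance (d : ℕ) : BorelSpace (OrthGroup d) := ⟨rfl⟩

instance (d : ℕ) : CompactSpace (OrthGroup d) := by
  suffices h : IsCompact (unitary (EuclideanSpace ℝ (Fin d) →L[ℝ] EuclideanSpace ℝ (Fin d)) :
      Set (EuclideanSpace ℝ (Fin d) →L[ℝ] EuclideanSpace ℝ (Fin d))) from
    isCompact_iff_compactSpace.mp h
  refine Metric.isCompact_of_isClosed_isBounded isClosed_unitary ?_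
  refine (Metric.isBounded_closedBall (x := 0) (r := 1)).subset fun g hg => ?_
  rw [mem_closedBall_zero_iff]
  refine ContinuousLinearMap.opNorm_le_bound _ zero_le_one fun y => ?_
  have := (Unitary.linearIsometryEquiv ⟨g, hg⟩).norm_map y
  rw [one_mul]
  exact this.le

/-- The isometry given by an element of the orthogonal group. -/
noncomputable def OrthGroup.toIsometry {d : ℕ} :
    OrthGroup d ≃* (EuclideanSpace ℝ (Fin d) ≃ₗᵢ[ℝ] EuclideanSpace ℝ (Fin d)) :=
  Unitary.linearIsometryEquiv

lemma OrthGroup.continuous_toIsometry_inv_apply (d : ℕ) :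
    Continuous (fun p : OrthGroup d × EuclideanSpace ℝ (Fin d) => p.1⁻¹.toIsometry p.2) := by
  have h : Continuous fun p : (EuclideanSpace ℝ (Fin d) →L[ℝ] EuclideanSpace ℝ (Fin d)) ×
    EuclideanSpace ℝ (Fin d) => p.1 p.2 := isBoundedBilinearMap_apply.continuous
  have h2 : Continuous fun g : OrthGroup d => (Subtype.val g⁻¹ :
      EuclideanSpace ℝ (Fin d) →L[ℝ] EuclideanSpace ℝ (Fin d)) :=
    Continuous.comp (f := fun g : OrthGroup d => g⁻¹) continuous_subtype_val continuous_inv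
  exact h.comp ((h2.comp continuous_fst).prodMk continuous_snd)

/-- The normalized Haar measure on the orthogonal group. -/
noncomputable def orthHaar (d : ℕ) : Measure (OrthGroup d) := Measure.haarMeasure ⊤

instance (d : ℕ) : IsProbabilityMeasure (orthHaar d) :=
  ⟨by simpa [orthHaar] using Measure.haarMeasure_self (K₀ :=
      (⊤ : TopologicalSpace.PositiveCompacts (OrthGroup d)))⟩

instance (d : ℕ) : (orthHaar d).IsMulLeftInvariant := by unfold orthHaar; infer_instance

/-- The action of the orthogonal group on the sphere. -/
noncomputable def orthAct {d : ℕ} (g : OrthGroup d) (y : Sph d) : Sph d :=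
  sphRot (OrthGroup.toIsometry g) y

lemma orthAct_mul {d : ℕ} (g h : OrthGroup d) (y : Sph d) :
    orthAct (g * h) y = orthAct g (orthAct h y) := by
  ext1; simp [orthAct, map_mul]

lemma inner_orthAct {d : ℕ} (g : OrthGroup d) (y z : Sph d) :
    ⟪(orthAct g y : EuclideanSpace ℝ (Fin d)), orthAct g z⟫ =
      ⟪(y : EuclideanSpace ℝ (Fin d)), z⟫ := by
  simp [orthAct]

lemma measurable_orthAct_inv {d : ℕ} :
    Measurable (fun p : OrthGroup d × Sph d => orthAct p.1⁻¹ p.2) := by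
  refine Continuous.measurable ?_
  refine Continuous.subtype_mk ?_ _
  have h2 : Continuous fun p : OrthGroup d × Sph d => (p.1, (p.2 : EuclideanSpace ℝ (Fin d))) := by
    fun_prop
  have := (OrthGroup.continuous_toIsometry_inv_apply d).comp h2
  exact this

lemma measurable_orthAct_inv_comp {α : Type*} [MeasurableSpace α] {d : ℕ} (f : α → OrthGroup d)
    (g : α → Sph d) (hf : Measurable f) (hg : Measurable g) :
    Measurable (fun a => orthAct (f a)⁻¹ (g a)) := by
  have := (measurable_orthAct_inv (d := d)).comp (hf.prodMk hg)
  exact this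

/-- Average of a kernel over simultaneous rotations. -/
noncomputable def orthAvg {d : ℕ} (e : Sph d → Sph d → ℝ) (y z : Sph d) : ℝ :=
  ∫ k, e (orthAct k⁻¹ y) (orthAct k⁻¹ z) ∂(orthHaar d)

lemma orthAvg_orthAct {d : ℕ} (e : Sph d → Sph d → ℝ) (g : OrthGroup d) (y z : Sph d) :
    orthAvg e (orthAct g y) (orthAct g z) = orthAvg e y z := by
  unfold orthAvg
  rw [← integral_mul_left_eq_self _ g]
  congr 1
  ext k
  have : ∀ w : Sph d, orthAct (g * k)⁻¹ (orthAct g w) = orthAct k⁻¹ w := by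
    intro w; rw [← orthAct_mul]; congr 1; group
  rw [this, this]

lemma orthAvg_congr {d : ℕ} (e : Sph d → Sph d → ℝ) {p q p' q' : Sph d}
    (h : ⟪(p : EuclideanSpace ℝ (Fin d)), q⟫ = ⟪(p' : EuclideanSpace ℝ (Fin d)), q'⟫) :
    orthAvg e p q = orthAvg e p' q' := by
  obtain ⟨g, h1, h2⟩ := exists_isometry_pair p q p' q' h
  have := orthAvg_orthAct e (OrthGroup.toIsometry.symm g) p q
  have hg : ∀ w : Sph d, orthAct (OrthGroup.toIsometry.symm g) w = sphRot g w := by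
    intro w; unfold orthAct; rw [MulEquiv.apply_symm_apply]
  rw [hg, hg, h1, h2] at this
  exact this.symm

lemma measurable_orthAct_inv_pair {d : ℕ} {e : Sph d → Sph d → ℝ}
    (he : Measurable (Function.uncurry e)) :
    Measurable (fun p : OrthGroup d × (Sph d × Sph d) =>
      e (orthAct p.1⁻¹ p.2.1) (orthAct p.1⁻¹ p.2.2)) := by
  have h1 : Measurable (fun p : OrthGroup d × (Sph d × Sph d) => orthAct p.1⁻¹ p.2.1) := by
    exact measurable_orthAct_inv_comp _ _ (by fun_prop) (by fun_prop)
  have h2 : Measurable (fun p : OrthGroup d × (Sph d × Sph d) => orthAct p.1⁻¹ p.2.2) := by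
    exact measurable_orthAct_inv_comp _ _ (by fun_prop) (by fun_prop)
  have := he.comp (h1.prodMk h2)
  exact this

lemma integral_prod_orthAvg {d : ℕ} [NeZero d] {e : Sph d → Sph d → ℝ}
    (he : Measurable (Function.uncurry e)) (h01 : ∀ y z, 0 ≤ e y z ∧ e y z ≤ 1) :
    ∫ p : Sph d × Sph d, orthAvg e p.1 p.2 ∂((sphereUniform d).prod (sphereUniform d)) =
      ∫ p : Sph d × Sph d, e p.1 p.2 ∂((sphereUniform d).prod (sphereUniform d)) := by
  unfold orthAvg
  rw [integral_integral_swap]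
  · have : ∀ k : OrthGroup d, ∫ p : Sph d × Sph d, e (orthAct k⁻¹ p.1) (orthAct k⁻¹ p.2)
        ∂((sphereUniform d).prod (sphereUniform d)) =
        ∫ p : Sph d × Sph d, e p.1 p.2 ∂((sphereUniform d).prod (sphereUniform d)) := by
      intro k
      have hmp := measurePreserving_sphRot (OrthGroup.toIsometry k⁻¹)
      have hmp2 := hmp.prod hmp
      have := hmp2.map_eq
      have h3 := integral_map (μ := (sphereUniform d).prod (sphereUniform d))
        hmp2.measurable.aemeasurable he.aestronglyMeasurable
      rw [this] at h3
      exact h3.symm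
    simp [this]
  · refine integrable_of_mem_Icc (A := 0) (B := 1) ?_ (fun x => h01 _ _)
    have := (measurable_orthAct_inv_pair he).comp
      (measurable_swap (α := Sph d × Sph d) (β := OrthGroup d))
    exact this

lemma inv_le_orthAvg {d : ℕ} (hd : 3 ≤ d) {e : Sph d → Sph d → ℝ}
    (he : Measurable (Function.uncurry e)) (h01 : ∀ y z, 0 ≤ e y z ∧ e y z ≤ 1)
    (hsym : ∀ x y, e x y = e y x)
    (T1 : ∀ x y z, 1 ≤ e x y + e y z + e x z) (T2 : ∀ x y z, e x y + e y z ≤ 1 + e x z)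
    {k : ℕ} (hk : 1 ≤ k) (y z : Sph d)
    (h : -Real.cos (Real.pi / (2 * k + 1 : ℕ)) ≤ ⟪(y : EuclideanSpace ℝ (Fin d)), z⟫) :
    1 / ((2 * k + 1 : ℕ) : ℝ) ≤ orthAvg e y z := by
  obtain ⟨p, hp0, hp⟩ := exists_polygon hd ⟨k, rfl⟩ h (by
    simpa using real_inner_le_norm (y : EuclideanSpace ℝ (Fin d)) z)
  have hInt : ∀ t, Integrable (fun g : OrthGroup d => e (orthAct g⁻¹ (p t)) (orthAct g⁻¹ (p
      (t + 1))))
      (orthHaar d) := fun t => by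
    refine integrable_of_mem_Icc (A := 0) (B := 1) ?_ (fun x => h01 _ _)
    have := (measurable_orthAct_inv_pair he).comp
      (measurable_id.prodMk (measurable_const (a := (p t, p (t + 1))) (β := OrthGroup d)))
    exact this
  have h1 : ∀ t, orthAvg e y z = orthAvg e (p t) (p (t + 1)) := fun t =>
    orthAvg_congr e (hp t).symm
  have h2 : ∑ t ∈ range (2 * k + 1), orthAvg e (p t) (p (t + 1)) =
      ∫ g, ∑ t ∈ range (2 * k + 1), e (orthAct g⁻¹ (p t)) (orthAct g⁻¹ (p (t + 1)))
          ∂(orthHaar d) := by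
    rw [integral_finsetSum _ (fun t _ => hInt t)]; rfl
  have h3 : (1 : ℝ) ≤ ∫ g, ∑ t ∈ range (2 * k + 1),
      e (orthAct g⁻¹ (p t)) (orthAct g⁻¹ (p (t + 1))) ∂(orthHaar d) := by
    have := integral_mono (μ := orthHaar d) (integrable_const (1 : ℝ))
      (integrable_finsetSum (range (2 * k + 1)) (fun t _ => hInt t))
      (fun g => one_le_sum_odd_closed_walk hsym T1 T2 (fun t => orthAct g⁻¹ (p t)) k hk
          (by simp only [hp0]))
    simpa using this
  rw [← h2] at h3
  simp only [← h1, sum_const, card_range, nsmul_eq_mul] at h3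
  rw [div_le_iff₀ (by positivity)]
  linarith

lemma integrable_sphAdj_mul {d : ℕ} [NeZero d] {γ : ℝ} {e : Sph d → Sph d → ℝ}
    (he : Measurable (Function.uncurry e)) (h01 : ∀ y z, 0 ≤ e y z ∧ e y z ≤ 1) :
    Integrable (fun p : Sph d × Sph d => sphAdj γ p.1 p.2 * e p.1 p.2)
      ((sphereUniform d).prod (sphereUniform d)) :=
  integrable_of_mem_Icc (A := 0) (B := 1) ((measurable_sphAdj γ).mul he) (fun _ =>
    ⟨mul_nonneg (sphAdj_nonneg _ _ _) (h01 _ _).1,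
      mul_le_one₀ (sphAdj_le_one _ _ _) (h01 _ _).1 (h01 _ _).2⟩)

/-- The continuous geometric graph has no cheap solution. -/
theorem sphereMu_div_le_integral {d : ℕ} (hd : 3 ≤ d) {γ : ℝ} (h0 : 0 < γ) (h1 : γ ≤ 1 / 2)
    {e : Sph d → Sph d → ℝ}
    (he : Measurable (Function.uncurry e)) (h01 : ∀ y z, 0 ≤ e y z ∧ e y z ≤ 1)
    (hsym : ∀ x y, e x y = e y x)
    (T1 : ∀ x y z, 1 ≤ e x y + e y z + e x z) (T2 : ∀ x y z, e x y + e y z ≤ 1 + e x z)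
    {k : ℕ} (hk : 1 ≤ k) (hcos : 1 - 2 * γ / 9 ≤ Real.cos (Real.pi / (2 * k + 1 : ℕ))) :
    sphereMu d γ / (2 * (2 * k + 1 : ℕ)) ≤
      ∫ y, ∫ z, sphAdj γ y z * e y z ∂(sphereUniform d) ∂(sphereUniform d) := by
  have : NeZero d := ⟨by omega⟩
  set s : Sph d → Sph d → ℝ := fun y z =>
    if ⟪(y : EuclideanSpace ℝ (Fin d)), z⟫ ≤ 2 * γ / 9 - 1 then 1 else 0 with hs
  have hsm : Measurable (fun p : Sph d × Sph d => s p.1 p.2) := measurable_ite_inner_le _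
  have hsa : ∀ y z, s y z ≤ sphAdj γ y z := by
    intro y z
    simp only [hs, sphAdj_eq_inner]
    split_ifs with q1 q2 <;> first | (exfalso; linarith) | norm_num
  have hs01 : ∀ y z, 0 ≤ s y z := fun y z => by simp only [hs]; split_ifs <;> norm_num
  set f : Sph d → Sph d → ℝ := fun y z => (sphAdj γ y z - s y z) * e y z with hf
  have hfm : Measurable (Function.uncurry f) := ((measurable_sphAdj γ).sub hsm).mul he
  have hf01 : ∀ y z, 0 ≤ f y z ∧ f y z ≤ 1 := fun y z =>
    ⟨mul_nonneg (sub_nonneg.mpr (hsa y z)) (h01 y z).1,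
      mul_le_one₀ (by linarith [hs01 y z, sphAdj_le_one γ y z]) (h01 _ _).1 (h01 _ _).2⟩
  have havg : ∀ y z, orthAvg f y z = (sphAdj γ y z - s y z) * orthAvg e y z := by
    intro y z
    unfold orthAvg
    rw [← integral_const_mul]
    congr 1
    ext g
    simp only [hf, hs, sphAdj_eq_inner, inner_orthAct]
  have hlow : ∀ y z, (sphAdj γ y z - s y z) * (1 / ((2 * k + 1 : ℕ) : ℝ)) ≤ orthAvg f y z := by
    intro y z
    rw [havg]
    by_cases q : ⟪(y : EuclideanSpace ℝ (Fin d)), z⟫ ≤ 2 * γ / 9 - 1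
    · have : sphAdj γ y z - s y z = 0 := by
        simp only [hs, sphAdj_eq_inner, if_pos q]
        rw [if_pos (by linarith), sub_self]
      rw [this, zero_mul, zero_mul]
    · refine mul_le_mul_of_nonneg_left ?_ (sub_nonneg.mpr (hsa y z))
      exact inv_le_orthAvg hd he h01 hsym T1 T2 hk y z (by linarith)
  have hfint : Integrable (fun p : Sph d × Sph d => f p.1 p.2)
      ((sphereUniform d).prod (sphereUniform d)) :=
    integrable_of_mem_Icc hfm (fun p => hf01 p.1 p.2)
  have hae := integrable_sphAdj_mul (γ := γ) he h01
  have hai : Integrable (fun p : Sph d × Sph d => sphAdj γ p.1 p.2 - s p.1 p.2)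
      ((sphereUniform d).prod (sphereUniform d)) :=
    integrable_of_mem_Icc (A := 0) (B := 1) ((measurable_sphAdj γ).sub hsm) (fun p =>
      ⟨sub_nonneg.mpr (hsa _ _), by linarith [hs01 p.1 p.2, sphAdj_le_one γ p.1 p.2]⟩)
  have havgint : Integrable (fun p : Sph d × Sph d => orthAvg f p.1 p.2)
      ((sphereUniform d).prod (sphereUniform d)) := by
    have := (integrable_of_mem_Icc (m := (orthHaar d).prod ((sphereUniform d).prod
        (sphereUniform d)))
      (measurable_orthAct_inv_pair hfm) (fun p => hf01 _ _)).integral_prod_right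
    exact this
  have step1 : ∫ p : Sph d × Sph d, f p.1 p.2 ∂((sphereUniform d).prod (sphereUniform d)) ≤
      ∫ p : Sph d × Sph d, sphAdj γ p.1 p.2 * e p.1 p.2
        ∂((sphereUniform d).prod (sphereUniform d)) := by
    refine integral_mono hfint hae fun p => ?_
    exact mul_le_mul_of_nonneg_right (by linarith [hs01 p.1 p.2]) (h01 _ _).1
  have step2 := integral_mono (hai.mul_const (1 / ((2 * k + 1 : ℕ) : ℝ))) havgint
    (fun p => hlow p.1 p.2)
  rw [integral_prod_orthAvg hfm hf01, integral_mul_const, integral_prod _ hai] at step2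
  have hin : ∀ y : Sph d, sphereMu d γ / 2 ≤
      ∫ z, (sphAdj γ y z - s y z) ∂(sphereUniform d) := by
    intro y
    have i1 : Integrable (fun z => sphAdj γ y z) (sphereUniform d) := by
      simp only [sphAdj_eq_inner]; exact integrable_ite_inner_le _ y
    rw [integral_sub i1 (integrable_ite_inner_le _ y), integral_sphAdj]
    have h2 := two_mul_capMeasure_le hd h0 h1 y
    have h3 : capMeasure d (2 * γ - 1) y = sphereMu d γ := by
      rw [← integral_sphAdj γ y]
      simp only [sphAdj_eq_inner]; rfl
    rw [h3] at h2
    change _ ≤ _ - capMeasure d _ y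
    linarith
  have step3 : sphereMu d γ / 2 ≤
      ∫ y, ∫ z, (sphAdj γ y z - s y z) ∂(sphereUniform d) ∂(sphereUniform d) := by
    have := integral_mono (integrable_const (sphereMu d γ / 2)) hai.integral_prod_left hin
    simpa using this
  rw [← integral_prod (f := fun p : Sph d × Sph d => sphAdj γ p.1 p.2 * e p.1 p.2) hae]
  refine le_trans ?_ (step2.trans step1)
  rw [← div_div, div_eq_mul_one_div (sphereMu d γ / 2)]
  exact mul_le_mul_of_nonneg_right step3 (by positivity)

lemma Sdp3Feasible.symm {V : Type} [Fintype V] {X : Matrix V V ℝ} (h : Sdp3Feasible X) (i j : V) :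
    X i j = X j i := by
  have := h.1.1.apply i j
  simpa using this.symm

lemma Sdp3Feasible.le_one {V : Type} [Fintype V] {X : Matrix V V ℝ} (h : Sdp3Feasible X) (i j : V) :
    X i j ≤ 1 := by
  have h1 := h.2.2.1 i j i
  rw [h.symm j i, h.2.1 i] at h1; linarith

lemma Sdp3Feasible.neg_one_le {V : Type} [Fintype V] {X : Matrix V V ℝ} (h : Sdp3Feasible X)
    (i j : V) : -1 ≤ X i j := by
  have h1 := h.2.2.2 i j i
  rw [h.symm j i, h.2.1 i] at h1; linarith

/-- The value of a feasible solution. -/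
noncomputable def cutVal {V : Type} [Fintype V] (p : V → V → ℝ) (X : Matrix V V ℝ) : ℝ :=
  ∑ i, ∑ j, p i j * ((1 - X i j) / 2)

lemma Sdp3Feasible.objective_eq {V : Type} [Fintype V] {X : Matrix V V ℝ} (h : Sdp3Feasible X)
    (p : V → V → ℝ) :
    ∑ i, ∑ j, p i j * ((X i i + X j j - 2 * X i j) / 4) = cutVal p X := by
  unfold cutVal
  refine sum_congr rfl fun i _ => sum_congr rfl fun j _ => ?_
  rw [h.2.1, h.2.1]; ring

lemma sdp3Feasible_one (V : Type) [Fintype V] : Sdp3Feasible (fun _ _ => 1 : Matrix V V ℝ) := by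
  refine ⟨?_, fun _ => rfl, fun _ _ _ => by norm_num, fun _ _ _ => by norm_num⟩
  have h : (fun _ _ => 1 : Matrix V V ℝ) =
      Matrix.vecMulVec (fun _ : V => (1 : ℝ)) (star fun _ : V => (1 : ℝ)) := by
    ext i j
    simp [Matrix.vecMulVec_apply]
  rw [h]
  exact Matrix.posSemidef_vecMulVec_self_star _

lemma Sdp3Feasible.cutVal_le {V : Type} [Fintype V] {X : Matrix V V ℝ} (h : Sdp3Feasible X)
    (p q : V → V → ℝ) : cutVal p X ≤ cutVal q X + ∑ i, ∑ j, |p i j - q i j| := by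
  unfold cutVal
  simp_rw [← sum_add_distrib]
  refine sum_le_sum fun i _ => sum_le_sum fun j _ => ?_
  have h1 := h.le_one i j
  have h2 := h.neg_one_le i j
  have h3 : (p i j - q i j) * ((1 - X i j) / 2) ≤ |p i j - q i j| * 1 :=
    (mul_le_mul_of_nonneg_right (le_abs_self _) (by linarith)).trans
      (mul_le_mul_of_nonneg_left (by linarith) (abs_nonneg _))
  linarith

lemma cutVal_zero {V : Type} [Fintype V] (X : Matrix V V ℝ) : cutVal (0 : V → V → ℝ) X = 0 := by
  simp [cutVal]

lemma Sdp3Feasible.cutVal_le_sdp3 {V : Type} [Fintype V] {X : Matrix V V ℝ} (h : Sdp3Feasible X)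
    (p : V → V → ℝ) : cutVal p X ≤ sdp3 p := by
  rw [← h.objective_eq]
  refine le_csSup ⟨∑ i, ∑ j, |p i j|, ?_⟩ ⟨X, h, rfl⟩
  rintro _ ⟨Y, hY, rfl⟩
  simp only []
  rw [Sdp3Feasible.objective_eq hY]
  simpa [cutVal_zero] using hY.cutVal_le p 0

lemma sdp3_le {V : Type} [Fintype V] {p : V → V → ℝ} {c : ℝ}
    (h : ∀ X : Matrix V V ℝ, Sdp3Feasible X → cutVal p X ≤ c) : sdp3 p ≤ c := by
  refine csSup_le ⟨_, _, sdp3Feasible_one V, rfl⟩ ?_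
  rintro _ ⟨Y, hY, rfl⟩
  simp only []
  rw [Sdp3Feasible.objective_eq hY]
  exact h Y hY

lemma sdp3_nonneg {V : Type} [Fintype V] (p : V → V → ℝ) : 0 ≤ sdp3 p := by
  have := (sdp3Feasible_one V).cutVal_le_sdp3 p
  simpa [cutVal] using this

lemma sdp3_le_add {V : Type} [Fintype V] (p q : V → V → ℝ) :
    sdp3 p ≤ sdp3 q + ∑ i, ∑ j, |p i j - q i j| :=
  sdp3_le fun X hX => (hX.cutVal_le p q).trans (by linarith [hX.cutVal_le_sdp3 q])

lemma sdp3_le_sum {V : Type} [Fintype V] {p : V → V → ℝ} (hp : ∀ i j, 0 ≤ p i j) :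
    sdp3 p ≤ ∑ i, ∑ j, p i j :=
  sdp3_le fun X hX => by
    refine sum_le_sum fun i _ => sum_le_sum fun j _ => ?_
    have := hX.neg_one_le i j
    exact mul_le_of_le_one_right (hp i j) (by linarith)

lemma continuous_sdp3 (V : Type) [Fintype V] : Continuous (sdp3 : (V → V → ℝ) → ℝ) := by
  rw [continuous_iff_continuousAt]
  intro p
  have hc : ∀ q, Filter.Tendsto (fun q : V → V → ℝ => ∑ i, ∑ j, |q i j - p i j|) (nhds q)
      (nhds (∑ i, ∑ j, |q i j - p i j|)) := fun q => Continuous.tendsto (by fun_prop) q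
  have h0 := hc p
  simp only [sub_self, abs_zero, sum_const_zero] at h0
  refine tendsto_order.2 ⟨fun a ha => ?_, fun a ha => ?_⟩
  · filter_upwards [h0.eventually_lt_const (sub_pos.mpr ha)] with q hq
    have := sdp3_le_add p q
    simp_rw [abs_sub_comm (p _ _)] at this
    linarith
  · filter_upwards [h0.eventually_lt_const (sub_pos.mpr ha)] with q hq
    have := sdp3_le_add q p
    linarith

lemma measurable_sdp3_comp {V : Type} [Fintype V] {α : Type*} [MeasurableSpace α]
    (f : α → V → V → ℝ) (hf : ∀ i j, Measurable fun a => f a i j) :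
    Measurable fun a => sdp3 (f a) := by
  have h1 : Measurable f := measurable_pi_lambda _ fun i => measurable_pi_lambda _ fun j => hf i j
  have := (continuous_sdp3 V).measurable.comp h1
  exact this

/-- Adjacency of two distinct vertices. -/
noncomputable def vertAdj {d n : ℕ} (γ : ℝ) (x : Fin n → Sph d) (i j : Fin n) : ℝ :=
  if i ≠ j then sphAdj γ (x i) (x j) else 0

lemma vertAdj_nonneg {d n : ℕ} (γ : ℝ) (x : Fin n → Sph d) (i j : Fin n) :
    0 ≤ vertAdj γ x i j := by
  unfold vertAdj; split_ifs; exacts [sphAdj_nonneg _ _ _, le_rfl]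

lemma measurable_vertAdj {d n : ℕ} (γ : ℝ) (i j : Fin n) :
    Measurable (fun x : Fin n → Sph d => vertAdj γ x i j) := by
  unfold vertAdj
  split_ifs
  · exact measurable_sphAdj_comp γ _ _ (measurable_pi_apply i) (measurable_pi_apply j)
  · exact measurable_const

/-- Twice the number of edges. -/
noncomputable def edgeCount {d n : ℕ} (γ : ℝ) (x : Fin n → Sph d) : ℝ :=
  ∑ i, ∑ j, vertAdj γ x i j

lemma edgeCount_nonneg {d n : ℕ} (γ : ℝ) (x : Fin n → Sph d) : 0 ≤ edgeCount γ x :=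
  sum_nonneg fun i _ => sum_nonneg fun j _ => vertAdj_nonneg γ x i j

lemma measurable_edgeCount {d n : ℕ} (γ : ℝ) :
    Measurable (fun x : Fin n → Sph d => edgeCount γ x) :=
  Finset.measurable_fun_sum _ fun i _ => Finset.measurable_fun_sum _ fun j _ => measurable_vertAdj γ i j

lemma geomEdgeDist_eq {d n : ℕ} (γ : ℝ) (x : Fin n → Sph d) :
    geomEdgeDist d n γ x = fun i j => vertAdj γ x i j / edgeCount γ x := by
  have h : ∀ i j, (if i ≠ j ∧ 1 - γ ≤ ‖(x i : EuclideanSpace ℝ (Fin d)) -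
      (x j : EuclideanSpace ℝ (Fin d))‖ ^ 2 / 4 then (1 : ℝ) else 0) = vertAdj γ x i j := by
    intro i j
    unfold vertAdj sphAdj
    rw [ite_and]
  funext i j
  simp only [geomEdgeDist, edgeCount, h]

lemma geomEdgeDist_nonneg {d n : ℕ} (γ : ℝ) (x : Fin n → Sph d) (i j : Fin n) :
    0 ≤ geomEdgeDist d n γ x i j := by
  rw [geomEdgeDist_eq]; exact div_nonneg (vertAdj_nonneg _ _ _ _) (edgeCount_nonneg _ _)

lemma sum_geomEdgeDist {d n : ℕ} (γ : ℝ) (x : Fin n → Sph d) :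
    ∑ i, ∑ j, geomEdgeDist d n γ x i j = edgeCount γ x / edgeCount γ x := by
  rw [geomEdgeDist_eq]
  simp only [← sum_div]; rfl

lemma measurable_sdp3_geomEdgeDist (d n : ℕ) (γ : ℝ) :
    Measurable (fun x : Fin n → Sph d => sdp3 (geomEdgeDist d n γ x)) := by
  refine measurable_sdp3_comp _ fun i j => ?_
  simp only [geomEdgeDist_eq]
  exact (measurable_vertAdj γ i j).div (measurable_edgeCount γ)

lemma sdp3_geomEdgeDist_le_one {d n : ℕ} (γ : ℝ) (x : Fin n → Sph d) :
    sdp3 (geomEdgeDist d n γ x) ≤ 1 := by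
  refine (sdp3_le_sum (geomEdgeDist_nonneg γ x)).trans ?_
  rw [sum_geomEdgeDist]
  exact div_self_le_one _

lemma integrable_sdp3_geomEdgeDist {d n : ℕ} [NeZero d] (γ : ℝ) :
    Integrable (fun x : Fin n → Sph d => sdp3 (geomEdgeDist d n γ x))
      (Measure.pi fun _ : Fin n => sphereUniform d) :=
  integrable_of_mem_Icc (measurable_sdp3_geomEdgeDist d n γ)
    (fun x => ⟨sdp3_nonneg _, sdp3_geomEdgeDist_le_one γ x⟩)

/-- The side of the hyperplane orthogonal to `g` on which `y` lies. -/
noncomputable def sideSign {d : ℕ} (y g : Sph d) : ℝ :=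
  if 0 ≤ ⟪(y : EuclideanSpace ℝ (Fin d)), g⟫ then 1 else -1

lemma sideSign_eq {d : ℕ} (y g : Sph d) : sideSign y g = 1 ∨ sideSign y g = -1 := by
  unfold sideSign; split_ifs <;> simp

lemma sideSign_mul_self {d : ℕ} (y g : Sph d) : sideSign y g * sideSign y g = 1 := by
  rcases sideSign_eq y g with h | h <;> rw [h] <;> norm_num

lemma measurable_sideSign {d : ℕ} (y : Sph d) : Measurable (sideSign y) :=
  Measurable.ite (isClosed_le continuous_const (by fun_prop)).measurableSet
    measurable_const measurable_const

lemma sideSign_mul_mem {d : ℕ} (y z g : Sph d) :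
    -1 ≤ sideSign y g * sideSign z g ∧ sideSign y g * sideSign z g ≤ 1 := by
  rcases sideSign_eq y g with h | h <;> rcases sideSign_eq z g with h' | h' <;>
    rw [h, h'] <;> norm_num

lemma integrable_sideSign_mul {d : ℕ} [NeZero d] (y z : Sph d) :
    Integrable (fun g => sideSign y g * sideSign z g) (sphereUniform d) :=
  integrable_of_mem_Icc ((measurable_sideSign y).mul (measurable_sideSign z))
    (fun g => sideSign_mul_mem y z g)

/-- The covariance of random hyperplane rounding. -/
noncomputable def signCov {d : ℕ} (y z : Sph d) : ℝ :=
  ∫ g, sideSign y g * sideSign z g ∂(sphereUniform d)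

lemma sdp3Feasible_signCov {d n : ℕ} [NeZero d] (x : Fin n → Sph d) :
    Sdp3Feasible (fun i j => signCov (x i) (x j) : Matrix (Fin n) (Fin n) ℝ) := by
  refine ⟨?_, fun i => ?_, fun i j k => ?_, fun i j k => ?_⟩
  · refine Matrix.PosSemidef.of_dotProduct_mulVec_nonneg ?_ fun c => ?_
    · refine Matrix.IsHermitian.ext fun i j => ?_
      exact integral_congr_ae (.of_forall fun g => mul_comm _ _)
    · have : star c ⬝ᵥ Matrix.mulVec (fun i j => signCov (x i) (x j) : Matrix (Fin n) (Fin n) ℝ) c =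
          ∫ g, (∑ i, c i * sideSign (x i) g) ^ 2 ∂(sphereUniform d) := by
        have h2 : ∀ g, (∑ i, c i * sideSign (x i) g) ^ 2 =
            ∑ i, ∑ j, (c i * c j) * (sideSign (x i) g * sideSign (x j) g) := by
          intro g
          rw [sq, sum_mul_sum]
          exact sum_congr rfl fun i _ => sum_congr rfl fun j _ => by ring
        simp_rw [h2]
        rw [integral_finsetSum _ (fun i _ => integrable_finsetSum _ (fun j _ =>
          (integrable_sideSign_mul _ _).const_mul _))]
        simp only [dotProduct, Matrix.mulVec, Pi.star_apply, star_trivial, mul_sum]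
        refine sum_congr rfl fun i _ => ?_
        rw [integral_finsetSum _ (fun j _ => (integrable_sideSign_mul _ _).const_mul _)]
        refine sum_congr rfl fun j _ => ?_
        rw [integral_const_mul]
        unfold signCov
        ring
      rw [this]
      exact integral_nonneg fun g => sq_nonneg _
  · simp [signCov, sideSign_mul_self]
  · have h := integral_mono (((integrable_sideSign_mul (x i) (x j)).add
      (integrable_sideSign_mul (x j) (x k))).sub (integrable_sideSign_mul (x i) (x k)))
      (integrable_const (1 : ℝ)) (fun g => by
        change sideSign (x i) g * sideSign (x j) g + sideSign (x j) g * sideSign (x k) g -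
          sideSign (x i) g * sideSign (x k) g ≤ 1
        rcases sideSign_eq (x i) g with h1 | h1 <;> rcases sideSign_eq (x j) g with h2 | h2 <;>
        rcases sideSign_eq (x k) g with h3 | h3 <;> rw [h1, h2, h3] <;> norm_num)
    rw [integral_sub' ((integrable_sideSign_mul (x i) (x j)).add
      (integrable_sideSign_mul (x j) (x k))) (integrable_sideSign_mul (x i) (x k)),
      integral_add' (integrable_sideSign_mul (x i) (x j)) (integrable_sideSign_mul (x j)
          (x k))] at h
    simpa [signCov] using h
  · have h := integral_mono (integrable_const (-1 : ℝ)) (((integrable_sideSign_mul (x i) (x j)).add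
      (integrable_sideSign_mul (x j) (x k))).add (integrable_sideSign_mul (x i) (x k)))
      (fun g => by
        change -1 ≤ sideSign (x i) g * sideSign (x j) g + sideSign (x j) g * sideSign (x k) g +
          sideSign (x i) g * sideSign (x k) g
        rcases sideSign_eq (x i) g with h1 | h1 <;> rcases sideSign_eq (x j) g with h2 | h2 <;>
        rcases sideSign_eq (x k) g with h3 | h3 <;> rw [h1, h2, h3] <;> norm_num)
    rw [integral_add' ((integrable_sideSign_mul (x i) (x j)).add
      (integrable_sideSign_mul (x j) (x k))) (integrable_sideSign_mul (x i) (x k)),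
      integral_add' (integrable_sideSign_mul (x i) (x j)) (integrable_sideSign_mul (x j)
          (x k))] at h
    simpa [signCov] using h

lemma signCov_congr {d : ℕ} {p q p' q' : Sph d}
    (h : ⟪(p : EuclideanSpace ℝ (Fin d)), q⟫ = ⟪(p' : EuclideanSpace ℝ (Fin d)), q'⟫) :
    signCov p q = signCov p' q' := by
  obtain ⟨g, hp, hq⟩ := exists_isometry_pair p q p' q' h
  have hm := measurePreserving_sphRot g
  have h3 := integral_map (μ := sphereUniform d) hm.measurable.aemeasurable
    (f := fun w => sideSign p' w * sideSign q' w)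
    ((measurable_sideSign p').mul (measurable_sideSign q')).aestronglyMeasurable
  rw [hm.map_eq] at h3
  unfold signCov
  rw [h3]
  congr 1
  ext w
  rw [← hp, ← hq]
  simp [sideSign]

lemma sphereUniform_hyperplane {d : ℕ} (y : Sph d) :
    sphereUniform d {g | ⟪(y : EuclideanSpace ℝ (Fin d)), g⟫ = 0} = 0 := by
  have hm : MeasurableSet {g : Sph d | ⟪(y : EuclideanSpace ℝ (Fin d)), g⟫ = 0} :=
    (isClosed_eq (by fun_prop) continuous_const).measurableSet
  rw [sphereUniform, Measure.smul_apply, Measure.toSphere_apply' _ hm]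
  have h0 : (volume : Measure (EuclideanSpace ℝ (Fin d)))
      ((ℝ ∙ (y : EuclideanSpace ℝ (Fin d)))ᗮ : Submodule ℝ (EuclideanSpace ℝ (Fin d))) = 0 := by
    refine Measure.addHaar_submodule _ _ fun h => ?_
    have hy : (y : EuclideanSpace ℝ (Fin d)) ∈ (ℝ ∙ (y : EuclideanSpace ℝ (Fin d)))ᗮ := by
      rw [h]; trivial
    rw [Submodule.mem_orthogonal_singleton_iff_inner_right] at hy
    simp at hy
  have h1 : (volume : Measure (EuclideanSpace ℝ (Fin d))) (Set.Ioo (0 : ℝ) 1 •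
      ((Subtype.val : Sph d → EuclideanSpace ℝ (Fin d)) ''
        {g : Sph d | ⟪(y : EuclideanSpace ℝ (Fin d)), g⟫ = 0})) = 0 := by
    refine measure_mono_null ?_ h0
    rintro _ ⟨r, -, _, ⟨g, hg, rfl⟩, rfl⟩
    simp only [SetLike.mem_coe, Submodule.mem_orthogonal_singleton_iff_inner_right]
    rw [inner_smul_right, hg, mul_zero]
  rw [h1]; simp

lemma signCov_neg_right {d : ℕ} (y z : Sph d) : signCov y (-z) = -signCov y z := by
  unfold signCov
  rw [← integral_neg]
  refine integral_congr_ae ?_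
  have : ∀ᵐ g : Sph d ∂(sphereUniform d), ⟪(z : EuclideanSpace ℝ (Fin d)), g⟫ ≠ 0 := by
    rw [ae_iff]; simpa using sphereUniform_hyperplane z
  filter_upwards [this] with g hg
  have : sideSign (-z) g = -sideSign z g := by
    unfold sideSign
    rcases lt_or_gt_of_ne hg with h | h
    · rw [if_pos (by simpa using h.le), if_neg (by linarith)]; norm_num
    · rw [if_neg (by simpa using h), if_pos h.le]
  rw [this]; ring

/-- Along an arc shorter than a half circle the side changes at most once. -/
lemma sum_side_changes {f : ℕ → ℝ} {m : ℕ} {s : ℕ → ℝ}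
    (hs : ∀ t, s t = if 0 ≤ f t then 1 else -1)
    (hf : ∀ k, 0 < k → k < m → ∃ A B : ℝ, 0 < A ∧ 0 < B ∧ f k = A * f 0 + B * f (k + 1)) :
    ∀ k ≤ m, ∑ t ∈ range k, (1 - s t * s (t + 1)) / 2 = (1 - s 0 * s k) / 2 := by
  intro k
  induction k with
  | zero =>
    intro _
    have := hs 0
    split_ifs at this <;> rw [sum_range_zero, this] <;> norm_num
  | succ k ih =>
    intro hk
    rw [sum_range_succ, ih (by omega)]
    rcases Nat.eq_zero_or_pos k with rfl | hk0
    · have := hs 0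
      split_ifs at this <;> rw [this] <;> ring
    obtain ⟨A, B, hA, hB, hAB⟩ := hf k hk0 (by omega)
    have h0 := hs 0
    have h1 := hs k
    have h2 := hs (k + 1)
    split_ifs at h0 h1 h2 with q0 q1 q2 q2 q1 q2 q2 <;> rw [h0, h1, h2] <;> norm_num
    · exact q1 (by rw [hAB]; positivity)
    · nlinarith

lemma signCov_of_angle {d : ℕ} (hd : 3 ≤ d) {m : ℕ} {β : ℝ} (hβ : 0 < β) (hm : m * β < Real.pi)
    (y z : Sph d) (h : ⟪(y : EuclideanSpace ℝ (Fin d)), z⟫ = Real.cos β) :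
    m * ((1 - signCov y z) / 2) ≤ 1 := by
  have : NeZero d := ⟨by omega⟩
  obtain ⟨u, v, -, huu, hvv, -, huv, -, -⟩ := exists_orthonormal_triple hd
  have hvu : ⟪v, u⟫ = 0 := by rw [real_inner_comm, huv]
  have hmem : ∀ x : EuclideanSpace ℝ (Fin d), ⟪x, x⟫ = 1 →
      x ∈ Metric.sphere (0 : EuclideanSpace ℝ (Fin d)) 1 := by
    intro x hx
    rw [mem_sphere_zero_iff_norm, norm_eq_sqrt_real_inner, hx, Real.sqrt_one]
  let P : ℝ → EuclideanSpace ℝ (Fin d) := fun a => Real.cos a • u + Real.sin a • v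
  have hP : ∀ a b, ⟪P a, P b⟫ = Real.cos (a - b) := by
    intro a b
    simp only [P, inner_add_left, inner_add_right, inner_smul_left, inner_smul_right, huu, hvv,
      huv, hvu, conj_trivial, Real.cos_sub]
    ring
  let q : ℕ → Sph d := fun t => ⟨P (t * β), hmem _ (by rw [hP]; simp)⟩
  have hq : ∀ t, signCov (q t) (q (t + 1)) = signCov y z := by
    intro t
    refine signCov_congr ?_
    rw [h]
    change ⟪P _, P _⟫ = _
    rw [hP, ← Real.cos_neg]
    congr 1
    push_cast; ring
  have hpt : ∀ g : Sph d, ∑ t ∈ range m, (1 - sideSign (q t) g * sideSign (q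
      (t + 1)) g) / 2 ≤ 1 := by
    intro g
    rw [sum_side_changes (f := fun t => ⟪(q t : EuclideanSpace ℝ (Fin d)), g⟫) (m := m)
      (s := fun t => sideSign (q t) g) (fun t => rfl) ?_ m le_rfl]
    · linarith [(sideSign_mul_mem (q 0) (q m) g).1]
    · intro k hk hkm
      have hkm' : ((k : ℝ) + 1) ≤ m := by exact_mod_cast hkm
      have hk' : (0 : ℝ) < k := by exact_mod_cast hk
      have s1 : 0 < Real.sin ((k + 1) * β) :=
        Real.sin_pos_of_pos_of_lt_pi (by positivity) (by nlinarith)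
      have s2 : 0 < Real.sin β := Real.sin_pos_of_pos_of_lt_pi hβ (by nlinarith)
      have s3 : 0 < Real.sin (k * β) :=
        Real.sin_pos_of_pos_of_lt_pi (by positivity) (by nlinarith)
      refine ⟨Real.sin β / Real.sin ((k + 1) * β), Real.sin (k * β) / Real.sin ((k + 1) * β),
        by positivity, by positivity, ?_⟩
      simp only [q, P, inner_add_left, inner_smul_left, conj_trivial]
      have e1 : Real.sin ((k + 1) * β) = Real.sin (k * β) * Real.cos β + Real.cos
          (k * β) * Real.sin β := by
        rw [← Real.sin_add]; congr 1; ring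
      have e2 : Real.cos ((k + 1) * β) = Real.cos (k * β) * Real.cos β - Real.sin
          (k * β) * Real.sin β := by
        rw [← Real.cos_add]; congr 1; ring
      simp only [Nat.cast_zero, Nat.cast_add, Nat.cast_one, zero_mul, Real.cos_zero,
          Real.sin_zero, zero_mul, add_zero, one_mul]
      rw [div_mul_eq_mul_div, div_mul_eq_mul_div, ← add_div, eq_div_iff s1.ne', e1, e2]
      linear_combination (⟪u, (g : EuclideanSpace ℝ (Fin d))⟫ * Real.sin β) *
          (Real.sin_sq_add_cos_sq (k * β))
  have hInt : ∀ t, Integrable (fun g => (1 - sideSign (q t) g * sideSign (q (t + 1)) g) / 2)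
      (sphereUniform d) := fun t =>
    ((integrable_const 1).sub (integrable_sideSign_mul _ _)).div_const 2
  have hsum := integral_mono (integrable_finsetSum (range m) fun t _ => hInt t)
    (integrable_const (1 : ℝ)) hpt
  rw [integral_finsetSum _ fun t _ => hInt t] at hsum
  have : ∀ t, ∫ g, (1 - sideSign (q t) g * sideSign (q (t + 1)) g) / 2 ∂(sphereUniform d) =
      (1 - signCov y z) / 2 := by
    intro t
    rw [integral_div, integral_sub (integrable_const _) (integrable_sideSign_mul _ _), ← hq t]
    simp [signCov]
  simpa [this] using hsum

lemma signCov_self {d : ℕ} [NeZero d] (y : Sph d) : signCov y y = 1 := by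
  simp [signCov, sideSign_mul_self]

/-- Adjacent points are separated with high probability. -/
lemma signCov_le_of_adj {d : ℕ} (hd : 3 ≤ d) {γ : ℝ} (h0 : 0 < γ) (h1 : γ ≤ 1 / 4) (y z : Sph d)
    (h : ⟪(y : EuclideanSpace ℝ (Fin d)), z⟫ ≤ 2 * γ - 1) :
    1 - 4 * Real.sqrt γ ≤ (1 - signCov y z) / 2 := by
  have : NeZero d := ⟨by omega⟩
  have hsq : 0 < Real.sqrt γ := Real.sqrt_pos.mpr h0
  have hin : 1 - 2 * γ ≤ ⟪(y : EuclideanSpace ℝ (Fin d)), (-z : Sph d)⟫ := by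
    simp; linarith
  have hin1 : ⟪(y : EuclideanSpace ℝ (Fin d)), (-z : Sph d)⟫ ≤ 1 := by
    simpa using real_inner_le_norm (y : EuclideanSpace ℝ (Fin d)) (-z : Sph d)
  suffices hs : (1 - signCov y (-z)) / 2 ≤ 4 * Real.sqrt γ by
    rw [signCov_neg_right] at hs; linarith
  set β := Real.arccos ⟪(y : EuclideanSpace ℝ (Fin d)), (-z : Sph d)⟫ with hβ
  have hcos : Real.cos β = ⟪(y : EuclideanSpace ℝ (Fin d)), (-z : Sph d)⟫ :=
    Real.cos_arccos (by linarith) hin1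
  rcases eq_or_lt_of_le (Real.arccos_nonneg ⟪(y : EuclideanSpace ℝ (Fin d)),
      (-z : Sph d)⟫) with hz | hz
  · have h2 : ⟪(y : EuclideanSpace ℝ (Fin d)), (-z : Sph d)⟫ = ⟪(y : EuclideanSpace ℝ (Fin d)),
        y⟫ := by
      rw [← hcos, hβ, ← hz]; simp
    rw [signCov_congr h2, signCov_self]
    simp
  · have hle : β ≤ Real.pi * Real.sqrt γ := by
      have hb := Real.cos_le_one_sub_mul_cos_sq (x := β) (by
        rw [abs_of_pos hz]; exact Real.arccos_le_pi _)
      rw [hcos] at hb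
      have hpi := Real.pi_pos
      have h3 : β ^ 2 ≤ Real.pi ^ 2 * γ := by
        have : 2 / Real.pi ^ 2 * β ^ 2 ≤ 2 * γ := by linarith
        rw [div_mul_eq_mul_div, div_le_iff₀ (by positivity)] at this
        linarith
      refine abs_le_of_sq_le_sq' ?_ (by positivity) |>.2
      rw [mul_pow, Real.sq_sqrt h0.le]; exact h3
    have hs12 : Real.sqrt γ ≤ 1 / 2 := by
      rw [Real.sqrt_le_left (by norm_num)]; linarith
    set m := ⌊1 / (2 * Real.sqrt γ)⌋₊ with hm
    have hx1 : 1 ≤ 1 / (2 * Real.sqrt γ) := by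
      rw [le_div_iff₀ (by positivity)]; linarith
    have hm1 : (m : ℝ) ≤ 1 / (2 * Real.sqrt γ) := Nat.floor_le (by positivity)
    have hm2 : 1 / (2 * Real.sqrt γ) < m + 1 := Nat.lt_floor_add_one _
    have hm0 : (1 : ℝ) ≤ m := by
      have : 1 ≤ m := Nat.le_floor (by simpa using hx1)
      exact_mod_cast this
    have hm3 : (m : ℝ) * β < Real.pi := by
      have e : (1 / (2 * Real.sqrt γ)) * (Real.pi * Real.sqrt γ) = Real.pi / 2 := by field_simp
      have : (m : ℝ) * β ≤ (1 / (2 * Real.sqrt γ)) * (Real.pi * Real.sqrt γ) := by gcongr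
      linarith [Real.pi_pos]
    have hmain := signCov_of_angle hd hz hm3 y (-z) hcos.symm
    have hm4 : 1 ≤ 4 * Real.sqrt γ * m := by
      rw [div_lt_iff₀ (by positivity)] at hm2
      nlinarith
    have hmpos : (0 : ℝ) < m := by linarith
    refine le_of_mul_le_mul_left ?_ hmpos
    linarith

/-- Hyperplane rounding gives a good solution of the relaxation. -/
lemma le_sdp3_geomEdgeDist {d n : ℕ} (hd : 3 ≤ d) {γ : ℝ} (h0 : 0 < γ) (h1 : γ ≤ 1 / 4)
    (x : Fin n → Sph d) (hN : 0 < edgeCount γ x) :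
    1 - 4 * Real.sqrt γ ≤ sdp3 (geomEdgeDist d n γ x) := by
  have : NeZero d := ⟨by omega⟩
  refine le_trans ?_ ((sdp3Feasible_signCov x).cutVal_le_sdp3 _)
  have hs := sum_geomEdgeDist γ x
  rw [div_self hN.ne'] at hs
  have hs' : 1 - 4 * Real.sqrt γ =
      ∑ i, (1 - 4 * Real.sqrt γ) * ∑ j, geomEdgeDist d n γ x i j := by
    rw [← mul_sum, hs, mul_one]
  rw [hs']
  unfold cutVal
  refine sum_le_sum fun i _ => ?_
  rw [mul_sum]
  refine sum_le_sum fun j _ => ?_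
  rw [mul_comm]
  by_cases h : ⟪(x i : EuclideanSpace ℝ (Fin d)), x j⟫ ≤ 2 * γ - 1
  · exact mul_le_mul_of_nonneg_left (signCov_le_of_adj hd h0 h1 _ _ h) (geomEdgeDist_nonneg _ _ _ _)
  · have : geomEdgeDist d n γ x i j = 0 := by
      rw [geomEdgeDist_eq]
      simp only [vertAdj, sphAdj_eq_inner, if_neg h, ite_self, zero_div]
    rw [this, zero_mul, zero_mul]

/-- The deviation from `1` of the normalized degree of `y` into the points `x`. -/
noncomputable def degNoise {d : ℕ} {ι : Type} [Fintype ι] (γ : ℝ) (y : Sph d) (x : ι → Sph d) : ℝ :=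
  |(∑ j, sphAdj γ y (x j)) / (Fintype.card ι * sphereMu d γ) - 1|

lemma degNoise_nonneg {d : ℕ} {ι : Type} [Fintype ι] (γ : ℝ) (y : Sph d) (x : ι → Sph d) :
    0 ≤ degNoise γ y x := abs_nonneg _

lemma measurable_degNoise_comp {d : ℕ} {ι α : Type} [Fintype ι] [MeasurableSpace α] (γ : ℝ)
    (f : α → Sph d) (g : α → ι → Sph d) (hf : Measurable f) (hg : ∀ i, Measurable fun a => g a i) :
    Measurable (fun a => degNoise γ (f a) (g a)) := by
  unfold degNoise
  have h : Measurable fun a => ∑ j, sphAdj γ (f a) (g a j) :=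
    Finset.measurable_fun_sum _ fun j _ => measurable_sphAdj_comp γ _ _ hf (hg j)
  have h2 := ((h.div_const (Fintype.card ι * sphereMu d γ)).sub_const 1).abs
  exact h2

lemma degNoise_le {d : ℕ} {ι : Type} [Fintype ι] (γ : ℝ) (hμ : 0 < sphereMu d γ)
    (y : Sph d) (x : ι → Sph d) : degNoise γ y x ≤ 1 / sphereMu d γ + 1 := by
  unfold degNoise
  have h0 : 0 ≤ (∑ j, sphAdj γ y (x j)) / (Fintype.card ι * sphereMu d γ) :=
    div_nonneg (sum_nonneg fun j _ => sphAdj_nonneg _ _ _) (by positivity)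
  have h1 : (∑ j, sphAdj γ y (x j)) / (Fintype.card ι * sphereMu d γ) ≤ 1 / sphereMu d γ := by
    have : ∑ j, sphAdj γ y (x j) ≤ Fintype.card ι := by
      refine (sum_le_sum fun j _ => sphAdj_le_one γ y (x j)).trans (by simp)
    rw [mul_comm, ← div_div, div_right_comm]
    refine div_le_div_of_nonneg_right ?_ hμ.le
    exact div_le_one_of_le₀ this (by positivity)
  have : 0 < 1 / sphereMu d γ := by positivity
  rw [abs_le]; constructor <;> linarith

lemma integral_degNoise_le {d : ℕ} [NeZero d] {ι : Type} [Fintype ι] [Nonempty ι] (γ : ℝ)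
    (hμ : 0 < sphereMu d γ) (y : Sph d) :
    ∫ x : ι → Sph d, degNoise γ y x ∂(Measure.pi fun _ : ι => sphereUniform d) ≤
      1 / √(Fintype.card ι * sphereMu d γ) := by
  set P := (Measure.pi fun _ : ι => sphereUniform d)
  set c : ℝ := Fintype.card ι * sphereMu d γ with hc
  have hcard : (0 : ℝ) < Fintype.card ι := by exact_mod_cast Fintype.card_pos
  have hc0 : 0 < c := by positivity
  have hma : Measurable (fun z => sphAdj γ y z) :=
    measurable_sphAdj_comp γ _ _ measurable_const measurable_id
  have hb : ∀ z, 0 ≤ sphAdj γ y z ∧ sphAdj γ y z ≤ 1 :=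
    fun z => ⟨sphAdj_nonneg _ _ _, sphAdj_le_one _ _ _⟩
  have hL2 : MemLp (fun z => sphAdj γ y z) 2 (sphereUniform d) :=
    MemLp.of_bound hma.aestronglyMeasurable 1 (Filter.Eventually.of_forall fun z => by
      rw [Real.norm_eq_abs, abs_of_nonneg (hb z).1]; exact (hb z).2)
  have hvar := ProbabilityTheory.variance_sum_pi (μ := fun _ : ι => sphereUniform d)
    (X := fun _ z => sphAdj γ y z) (fun _ => hL2)
  have hv1 : ProbabilityTheory.variance (fun z => sphAdj γ y z)
      (sphereUniform d) ≤ sphereMu d γ := by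
    refine (ProbabilityTheory.variance_le_expectation_sq hma.aestronglyMeasurable).trans ?_
    rw [← integral_sphAdj γ y]
    refine le_of_eq (integral_congr_ae (Filter.Eventually.of_forall fun z => ?_))
    simp only [Pi.pow_apply, sphAdj_sq]
  have hS : (∑ i : ι, fun ω : ι → Sph d => sphAdj γ y (ω i)) = fun ω => ∑ i, sphAdj γ y (ω i) := by
    funext ω; simp
  have hmS : Measurable fun ω : ι → Sph d => ∑ i, sphAdj γ y (ω i) :=
    Finset.measurable_fun_sum _ fun j _ =>
      measurable_sphAdj_comp γ _ _ measurable_const (measurable_pi_apply j)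
  have hmean : ∫ ω, ∑ i, sphAdj γ y (ω i) ∂P = c := by
    rw [integral_finsetSum]
    · have : ∀ i : ι, ∫ ω : ι → Sph d, sphAdj γ y (ω i) ∂P = sphereMu d γ := by
        intro i
        rw [← integral_sphAdj γ y]
        exact integral_comp_eval (μ := fun _ : ι => sphereUniform d) hma.aestronglyMeasurable
      simp [this, hc]
    · intro i _
      exact integrable_of_mem_Icc (measurable_sphAdj_comp γ _ _ measurable_const
        (measurable_pi_apply i)) fun ω => hb (ω i)
  rw [hS, ProbabilityTheory.variance_eq_integral hmS.aemeasurable, hmean] at hvar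
  have hvle : ∫ ω, (∑ i, sphAdj γ y (ω i) - c) ^ 2 ∂P ≤ c := by
    rw [hvar]
    refine (sum_le_sum fun i _ => hv1).trans ?_
    simp [hc]
  have hsq : 0 < √c := Real.sqrt_pos.2 hc0
  have hsc : √c ^ 2 = c := Real.sq_sqrt hc0.le
  have hSb : ∀ ω : ι → Sph d, 0 ≤ ∑ i, sphAdj γ y (ω i) ∧ ∑ i, sphAdj γ y (ω i) ≤ Fintype.card ι :=
    fun ω => ⟨sum_nonneg fun i _ => (hb _).1, (sum_le_sum fun i _ => (hb (ω i)).2).trans (by simp)⟩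
  have hInt_sq : Integrable (fun ω : ι → Sph d => (∑ i, sphAdj γ y (ω i) - c) ^ 2) P := by
    refine integrable_of_mem_Icc (A := 0) (B := (Fintype.card ι + c) ^ 2)
      ((hmS.sub_const c).pow_const 2) fun ω => ⟨sq_nonneg _, ?_⟩
    have := hSb ω
    exact sq_le_sq' (by linarith) (by linarith)
  calc ∫ x : ι → Sph d, degNoise γ y x ∂P
      ≤ ∫ x : ι → Sph d, (1 / √c / 2 + 1 / (2 * c * √c) * (∑ i, sphAdj γ y (x i) - c) ^ 2) ∂P := by
        refine integral_mono ?_ ?_ ?_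
        · exact integrable_of_mem_Icc (measurable_degNoise_comp γ _ _ measurable_const
            fun i => measurable_pi_apply i) fun x => ⟨degNoise_nonneg _ _ _, degNoise_le γ hμ y x⟩
        · exact (integrable_const _).add (hInt_sq.const_mul _)
        · intro x
          simp only [degNoise]
          rw [← hc]
          set S := ∑ i, sphAdj γ y (x i)
          have e1 : S / c - 1 = (S - c) / c := by field_simp
          rw [e1, abs_div, abs_of_pos hc0, ← sq_abs (S - c)]
          set A := |S - c|
          have e2 : 1 / √c / 2 + 1 / (2 * c * √c) * A ^ 2 - A / c = (√c - A) ^ 2 /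
              (2 * c * √c) := by
            rw [sub_sq, hsc]; field_simp; nlinarith [hsc]
          have : 0 ≤ (√c - A) ^ 2 / (2 * c * √c) := by positivity
          linarith
    _ = 1 / √c / 2 + 1 / (2 * c * √c) * ∫ ω, (∑ i, sphAdj γ y (ω i) - c) ^ 2 ∂P := by
        rw [integral_add (integrable_const _) (hInt_sq.const_mul _), integral_const_mul]; simp
    _ ≤ 1 / √c / 2 + 1 / (2 * c * √c) * c := by gcongr
    _ = 1 / √c := by field_simp; norm_num

lemma integral_degNoise_succAbove_le {d k : ℕ} [NeZero d] (hk : 0 < k) (γ : ℝ)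
    (hμ : 0 < sphereMu d γ) (i : Fin (k + 1)) :
    ∫ x : Fin (k + 1) → Sph d, degNoise γ (x i) (fun j : Fin k => x (i.succAbove j))
      ∂(Measure.pi fun _ : Fin (k + 1) => sphereUniform d) ≤ 1 / √(k * sphereMu d γ) := by
  set P := (Measure.pi fun _ : Fin (k + 1) => sphereUniform d)
  have : Nonempty (Fin k) := ⟨⟨0, hk⟩⟩
  have hmp := measurePreserving_piFinSuccAbove (fun _ : Fin (k + 1) => sphereUniform d) i
  have hG : Measurable fun p : Sph d × (Fin k → Sph d) => degNoise γ p.1 p.2 :=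
    measurable_degNoise_comp γ _ _ measurable_fst fun j =>
        (measurable_pi_apply j).comp measurable_snd
  have hGi : Integrable (fun p : Sph d × (Fin k → Sph d) => degNoise γ p.1 p.2)
      ((sphereUniform d).prod (Measure.pi fun _ : Fin k => sphereUniform d)) :=
    integrable_of_mem_Icc hG fun x => ⟨degNoise_nonneg _ _ _, degNoise_le γ hμ _ _⟩
  have h1 := hmp.integral_comp' (fun p : Sph d × (Fin k → Sph d) => degNoise γ p.1 p.2)
  have h2 : ∫ x : Fin (k + 1) → Sph d,
    degNoise γ (x i) (fun j : Fin k => x (i.succAbove j)) ∂P = ∫ p, degNoise γ p.1 p.2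
      ∂((sphereUniform d).prod (Measure.pi fun _ : Fin k => sphereUniform d)) := h1
  rw [h2, integral_prod _ hGi]
  calc _ ≤ ∫ _ : Sph d, 1 / √(k * sphereMu d γ) ∂(sphereUniform d) := by
        refine integral_mono hGi.integral_prod_left (integrable_const _) fun y => ?_
        have := integral_degNoise_le (ι := Fin k) γ hμ y
        simpa using this
    _ = _ := by simp

lemma integral_edgeCount_noise_le {d k : ℕ} [NeZero d] (hk : 0 < k) (γ : ℝ)
    (hμ : 0 < sphereMu d γ) :
    ∫ x : Fin (k + 1) → Sph d, |edgeCount γ x / ((k + 1 : ℕ) * k * sphereMu d γ) - 1|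
      ∂(Measure.pi fun _ : Fin (k + 1) => sphereUniform d) ≤ 1 / √(k * sphereMu d γ) := by
  set P := (Measure.pi fun _ : Fin (k + 1) => sphereUniform d)
  have : Nonempty (Fin k) := ⟨⟨0, hk⟩⟩
  have hk' : (0 : ℝ) < k := by exact_mod_cast hk
  have hpt : ∀ x : Fin (k + 1) → Sph d, |edgeCount γ x / ((k + 1 : ℕ) * k * sphereMu d γ) - 1| ≤
      ∑ i, (1 / (k + 1 : ℕ) : ℝ) * degNoise γ (x i) (fun j : Fin k => x (i.succAbove j)) := by
    intro x
    have e : edgeCount γ x / ((k + 1 : ℕ) * k * sphereMu d γ) - 1 =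
        ∑ i, (1 / (k + 1 : ℕ) : ℝ) *
          ((∑ j : Fin k, sphAdj γ (x i) (x (i.succAbove j))) / (k * sphereMu d γ) - 1) := by
      have h1 : edgeCount γ x = ∑ i, ∑ j : Fin k, sphAdj γ (x i) (x (i.succAbove j)) := by
        unfold edgeCount
        refine sum_congr rfl fun i _ => ?_
        rw [Fin.sum_univ_succAbove _ i]
        simp [vertAdj, Fin.ne_succAbove]
      rw [h1, ← mul_sum, sum_sub_distrib, ← sum_div]
      simp only [sum_const, card_univ, Fintype.card_fin, nsmul_eq_mul, mul_one]
      have : ((k + 1 : ℕ) : ℝ) ≠ 0 := by positivity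
      field_simp
    rw [e]
    refine (abs_sum_le_sum_abs _ _).trans (le_of_eq (sum_congr rfl fun i _ => ?_))
    rw [abs_mul, abs_of_nonneg (by positivity)]
    simp [degNoise]
  have hmd : ∀ i : Fin (k + 1), Measurable fun x : Fin (k + 1) → Sph d =>
      degNoise γ (x i) (fun j : Fin k => x (i.succAbove j)) := fun i =>
    measurable_degNoise_comp γ _ _ (measurable_pi_apply i) fun j => measurable_pi_apply _
  have hid : ∀ i : Fin (k + 1), Integrable (fun x : Fin (k + 1) → Sph d =>
      degNoise γ (x i) (fun j : Fin k => x (i.succAbove j))) P := fun i =>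
    integrable_of_mem_Icc (hmd i) fun x => ⟨degNoise_nonneg _ _ _, degNoise_le γ hμ _ _⟩
  calc _ ≤ ∫ x : Fin (k + 1) → Sph d,
        ∑ i, (1 / (k + 1 : ℕ) : ℝ) * degNoise γ (x i) (fun j : Fin k => x (i.succAbove j)) ∂P := by
        refine integral_mono_of_nonneg (Filter.Eventually.of_forall fun x => abs_nonneg _)
          (integrable_finsetSum _ fun i _ => (hid i).const_mul _) (Filter.Eventually.of_forall hpt)
    _ = ∑ i, (1 / (k + 1 : ℕ) : ℝ) * ∫ x : Fin (k + 1) → Sph d,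
          degNoise γ (x i) (fun j : Fin k => x (i.succAbove j)) ∂P := by
        rw [integral_finsetSum _ fun i _ => (hid i).const_mul _]
        simp only [integral_const_mul]
    _ ≤ ∑ _i : Fin (k + 1), (1 / (k + 1 : ℕ) : ℝ) * (1 / √(k * sphereMu d γ)) := by
        gcongr with i; exact integral_degNoise_succAbove_le hk γ hμ i
    _ = _ := by
        simp only [sum_const, card_univ, Fintype.card_fin, nsmul_eq_mul]
        have : ((k + 1 : ℕ) : ℝ) ≠ 0 := by positivity
        field_simp

lemma integrable_edgeCount_noise {d k : ℕ} [NeZero d] (γ c : ℝ) (hc : 0 < c) :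
    Integrable (fun x : Fin k → Sph d => |edgeCount γ x / c - 1|)
      (Measure.pi fun _ : Fin k => sphereUniform d) := by
  refine integrable_of_mem_Icc (A := 0) (B := (k * k : ℕ) / c + 1)
    (((measurable_edgeCount γ).div_const c).sub_const 1).abs fun x => ⟨abs_nonneg _, ?_⟩
  have h0 := edgeCount_nonneg γ x
  have h1 : edgeCount γ x ≤ (k * k : ℕ) := by
    unfold edgeCount
    refine (sum_le_sum fun i _ => sum_le_sum fun j _ => (?_ : _ ≤ (1 : ℝ))).trans (by simp)
    unfold vertAdj; split_ifs; exacts [sphAdj_le_one _ _ _, zero_le_one]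
  have h2 : edgeCount γ x / c ≤ (k * k : ℕ) / c := by gcongr
  have h3 : 0 ≤ edgeCount γ x / c := by positivity
  rw [abs_le]; constructor <;> linarith

lemma le_integral_sdp3_geomEdgeDist {d k : ℕ} (hd : 3 ≤ d) (hk : 0 < k) {γ : ℝ} (h0 : 0 < γ)
    (h1 : γ ≤ 1 / 4) (hμ : 0 < sphereMu d γ) :
    1 - 4 * √γ - 1 / √(k * sphereMu d γ) ≤
      ∫ x : Fin (k + 1) → Sph d, sdp3 (geomEdgeDist d (k + 1) γ x)
        ∂(Measure.pi fun _ : Fin (k + 1) => sphereUniform d) := by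
  have : NeZero d := ⟨by omega⟩
  have hc : (0 : ℝ) < (k + 1 : ℕ) * k * sphereMu d γ := by positivity
  have hin := integrable_edgeCount_noise (d := d) (k := k + 1) γ _ hc
  have hle := integral_edgeCount_noise_le (d := d) hk γ hμ
  calc 1 - 4 * √γ - 1 / √(k * sphereMu d γ) ≤ ∫ x : Fin (k + 1) → Sph d, (1 - 4 * √γ -
        |edgeCount γ x / ((k + 1 : ℕ) * k * sphereMu d γ) - 1|)
          ∂(Measure.pi fun _ : Fin (k + 1) => sphereUniform d) := by
        rw [integral_sub (integrable_const _) hin, integral_const, probReal_univ,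
            one_smul]; linarith
    _ ≤ _ := by
        refine integral_mono ((integrable_const _).sub hin) (integrable_sdp3_geomEdgeDist γ) ?_
        intro x
        rcases (edgeCount_nonneg γ x).eq_or_lt with h | h
        · have := sdp3_nonneg (geomEdgeDist d (k + 1) γ x)
          simp only [← h]
          have := Real.sqrt_nonneg γ
          norm_num
          linarith
        · have := le_sdp3_geomEdgeDist hd h0 h1 x h
          have := abs_nonneg (edgeCount γ x / ((k + 1 : ℕ) * k * sphereMu d γ) - 1)
          simp only
          linarith

/-- The sign `±1` of a Boolean. -/
def boolSign (s : Bool) : ℝ := if s then 1 else -1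

lemma abs_boolSign (s : Bool) : |boolSign s| = 1 := by cases s <;> simp [boolSign]

lemma exists_boolSign_mul_eq_abs (a : ℝ) : ∃ s, boolSign s * a = |a| := by
  rcases le_total 0 a with h | h
  · exact ⟨true, by simp [boolSign, abs_of_nonneg h]⟩
  · exact ⟨false, by simp [boolSign, abs_of_nonpos h]⟩

/-- The Rademacher sum with coefficients `u`. -/
def radSum {N : ℕ} (u : Fin N → ℝ) (z : Fin N → Bool) : ℝ := ∑ a, boolSign (z a) * u a

lemma sum_cons_bool {N : ℕ} (F : (Fin (N + 1) → Bool) → ℝ) :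
    ∑ z, F z = ∑ z : Fin N → Bool, (F (Fin.cons true z) + F (Fin.cons false z)) := by
  rw [← (Fin.consEquiv fun _ : Fin (N + 1) => Bool).sum_comp, Fintype.sum_prod_type,
    Fintype.sum_bool, ← sum_add_distrib]
  rfl

lemma radSum_cons {N : ℕ} (u : Fin (N + 1) → ℝ) (s : Bool) (z : Fin N → Bool) :
    radSum u (Fin.cons s z) = boolSign s * u 0 + radSum (fun a => u a.succ) z := by
  simp [radSum, Fin.sum_univ_succ]

lemma sum_radSum_mul {N : ℕ} (u v : Fin N → ℝ) :
    ∑ z, radSum u z * radSum v z = 2 ^ N * ∑ a, u a * v a := by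
  induction N with
  | zero => simp [radSum]
  | succ N ih =>
    rw [sum_cons_bool]
    simp only [radSum_cons]
    have e : ∀ z : Fin N → Bool,
        (boolSign true * u 0 + radSum (fun a => u a.succ) z) *
          (boolSign true * v 0 + radSum (fun a => v a.succ) z) +
        (boolSign false * u 0 + radSum (fun a => u a.succ) z) *
          (boolSign false * v 0 + radSum (fun a => v a.succ) z) =
        2 * (u 0 * v 0) + 2 * (radSum (fun a => u a.succ) z * radSum (fun a => v a.succ) z) := by
      intro z; simp [boolSign]; ring
    simp only [e, sum_add_distrib, ← mul_sum, ih, Fin.sum_univ_succ]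
    simp
    ring

lemma sum_radSum_pow_four_le {N : ℕ} (u : Fin N → ℝ) :
    ∑ z, radSum u z ^ 4 ≤ 2 ^ N * (3 * (∑ a, u a ^ 2) ^ 2) := by
  induction N with
  | zero => simp [radSum]
  | succ N ih =>
    rw [sum_cons_bool]
    simp only [radSum_cons]
    have e : ∀ z : Fin N → Bool,
        (boolSign true * u 0 + radSum (fun a => u a.succ) z) ^ 4 +
        (boolSign false * u 0 + radSum (fun a => u a.succ) z) ^ 4 =
        2 * u 0 ^ 4 + 12 * u 0 ^ 2 * (radSum (fun a => u a.succ) z * radSum (fun a => u a.succ) z)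
          + 2 * radSum (fun a => u a.succ) z ^ 4 := by
      intro z; simp [boolSign]; ring
    simp only [e, sum_add_distrib, ← mul_sum, sum_radSum_mul, Fin.sum_univ_succ]
    have h := ih (fun a => u a.succ)
    have e2 : ∑ a : Fin N, u a.succ * u a.succ = ∑ a : Fin N, u a.succ ^ 2 :=
      sum_congr rfl fun a _ => by ring
    rw [e2]
    set S := ∑ a : Fin N, u a.succ ^ 2
    have h2 : (0 : ℝ) ≤ 2 ^ N * u 0 ^ 4 := by positivity
    have h4 : (∑ _z : Fin N → Bool, u 0 ^ 4) = 2 ^ N * u 0 ^ 4 := by simp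
    rw [pow_succ (2 : ℝ), h4]
    nlinarith

/-- Truncation to `[-8, 8]`. -/
noncomputable def trunc (x : ℝ) : ℝ := max (-8) (min 8 x)

lemma abs_trunc_le (x : ℝ) : |trunc x| ≤ 8 := by
  unfold trunc; rw [abs_le]; constructor
  · exact le_max_left _ _
  · exact max_le (by norm_num) (min_le_left _ _)

lemma trunc_sq_le (x : ℝ) : trunc x ^ 2 ≤ x ^ 2 := by
  unfold trunc
  rcases le_total (8 : ℝ) x with h | h
  · rw [min_eq_left h, max_eq_right (by norm_num)]; nlinarith
  · rw [min_eq_right h]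
    rcases le_total (-8 : ℝ) x with h' | h'
    · rw [max_eq_right h']
    · rw [max_eq_left h']; nlinarith

lemma sub_trunc_sq_le (x : ℝ) : (x - trunc x) ^ 2 ≤ x ^ 4 / 64 := by
  have e : x ^ 4 / 64 = (x ^ 2 / 8) ^ 2 := by ring
  unfold trunc
  rcases le_total (8 : ℝ) x with h | h
  · rw [min_eq_left h, max_eq_right (by norm_num), e]
    exact pow_le_pow_left₀ (by linarith) (by nlinarith) 2
  · rw [min_eq_right h]
    rcases le_total (-8 : ℝ) x with h' | h'
    · rw [max_eq_right h']; simp; positivity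
    · rw [max_eq_left h', e, ← neg_sq]
      exact pow_le_pow_left₀ (by linarith) (by nlinarith) 2

/-- `A` bounds the bilinear form `D` on all families of vectors in the unit ball. -/
def VectorBound {B : Type} [Fintype B] (D : B → B → ℝ) (A : ℝ) : Prop :=
  0 ≤ A ∧ ∀ (N : ℕ) (u v : B → Fin N → ℝ), (∀ j, ∑ a, u j a ^ 2 ≤ 1) → (∀ j, ∑ a, v j a ^ 2 ≤ 1) →
    ∑ j, ∑ k, D j k * ∑ a, u j a * v k a ≤ A

lemma VectorBound.of_fintype {B : Type} [Fintype B] {D : B → B → ℝ} {A : ℝ} (h : VectorBound D A)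
    {ι : Type} [Fintype ι] (u v : B → ι → ℝ) {r s : ℝ} (hr : 0 < r) (hs : 0 < s)
    (hu : ∀ j, ∑ a, u j a ^ 2 ≤ r ^ 2) (hv : ∀ j, ∑ a, v j a ^ 2 ≤ s ^ 2) :
    ∑ j, ∑ k, D j k * ∑ a, u j a * v k a ≤ r * s * A := by
  have e := Fintype.equivFin ι
  have h1 := h.2 (Fintype.card ι) (fun j a => u j (e.symm a) / r) (fun j a => v j (e.symm a) / s)
    (fun j => by
      rw [e.symm.sum_comp fun a => (u j a / r) ^ 2]
      simp only [div_pow, ← sum_div]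
      exact div_le_one_of_le₀ (hu j) (by positivity))
    (fun j => by
      rw [e.symm.sum_comp fun a => (v j a / s) ^ 2]
      simp only [div_pow, ← sum_div]
      exact div_le_one_of_le₀ (hv j) (by positivity))
  have h2 : ∀ j k, ∑ a, u j (e.symm a) / r * (v k (e.symm a) / s) =
      (∑ a, u j a * v k a) / (r * s) := by
    intro j k
    rw [e.symm.sum_comp fun a => u j a / r * (v k a / s), sum_div]
    exact sum_congr rfl fun a _ => by field_simp
  simp only [h2] at h1
  simp only [← mul_div_assoc, ← sum_div] at h1
  rw [div_le_iff₀ (by positivity)] at h1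
  linarith

lemma sum_mul_le_of_boolSign {B : Type} [Fintype B] {D : B → B → ℝ} {t : ℝ}
    (h : ∀ ε δ : B → Bool, ∑ j, ∑ k, D j k * (boolSign (ε j) * boolSign (δ k)) ≤ t)
    {M : ℝ} (hM : 0 ≤ M) {s r : B → ℝ} (hs : ∀ j, |s j| ≤ M) (hr : ∀ j, |r j| ≤ M) :
    ∑ j, ∑ k, D j k * (s j * r k) ≤ M ^ 2 * t := by
  choose ε hε using fun j => exists_boolSign_mul_eq_abs (∑ k, D j k * r k)
  choose δ hδ using fun k => exists_boolSign_mul_eq_abs (∑ j, D j k * boolSign (ε j))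
  have key : ∀ (a w : ℝ), |a| ≤ M → a * w ≤ M * |w| := fun a w h => by
    calc a * w ≤ |a * w| := le_abs_self _
      _ = |a| * |w| := abs_mul _ _
      _ ≤ _ := by gcongr
  calc ∑ j, ∑ k, D j k * (s j * r k) = ∑ j, s j * ∑ k, D j k * r k := by
        refine sum_congr rfl fun j _ => ?_
        rw [mul_sum]; exact sum_congr rfl fun k _ => by ring
    _ ≤ ∑ j, M * |∑ k, D j k * r k| := sum_le_sum fun j _ => key _ _ (hs j)
    _ = M * ∑ k, r k * ∑ j, D j k * boolSign (ε j) := by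
        simp only [← hε, ← mul_sum]
        congr 1
        simp only [mul_sum]
        rw [sum_comm]
        exact sum_congr rfl fun k _ => sum_congr rfl fun j _ => by ring
    _ ≤ M * ∑ k, M * |∑ j, D j k * boolSign (ε j)| := by
        exact mul_le_mul_of_nonneg_left (sum_le_sum fun k _ => key _ _ (hr k)) hM
    _ = M ^ 2 * ∑ j, ∑ k, D j k * (boolSign (ε j) * boolSign (δ k)) := by
        simp only [← hδ, ← mul_sum]
        rw [← mul_assoc, ← sq]
        congr 1
        simp only [mul_sum]
        rw [sum_comm]
        exact sum_congr rfl fun k _ => sum_congr rfl fun j _ => by ring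
    _ ≤ M ^ 2 * t := by gcongr; exact h ε δ

lemma VectorBound.halve {B : Type} [Fintype B] {D : B → B → ℝ} {t : ℝ} (ht : 0 ≤ t)
    (h : ∀ ε δ : B → Bool, ∑ j, ∑ k, D j k * (boolSign (ε j) * boolSign (δ k)) ≤ t)
    {A : ℝ} (hA : VectorBound D A) : VectorBound D (64 * t + A / 2) := by
  refine ⟨by have := hA.1; positivity, fun N u v hu hv => ?_⟩
  set c : ℝ := √(2 ^ N) with hc
  have hc0 : 0 < c := Real.sqrt_pos.2 (by positivity)
  have hcc : c ^ 2 = 2 ^ N := Real.sq_sqrt (by positivity)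
  have nrm : ∀ w : Fin N → ℝ, ∑ a, w a ^ 2 ≤ 1 → ∑ z, (radSum w z / c) ^ 2 ≤ 1 := by
    intro w hw
    simp only [div_pow, ← sum_div, hcc]
    have := sum_radSum_mul w w
    simp only [← sq] at this
    rw [this, mul_div_cancel_left₀ _ (by positivity)]; exact hw
  have nrmT : ∀ w : Fin N → ℝ, ∑ a, w a ^ 2 ≤ 1 → ∑ z, (trunc (radSum w z) / c) ^ 2 ≤ 1 := by
    intro w hw
    refine le_trans (sum_le_sum fun z _ => ?_) (nrm w hw)
    simp only [div_pow]
    exact div_le_div_of_nonneg_right (trunc_sq_le _) (sq_nonneg _)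
  have nrmS : ∀ w : Fin N → ℝ, ∑ a, w a ^ 2 ≤ 1 →
      ∑ z, ((radSum w z - trunc (radSum w z)) / c) ^ 2 ≤ (1 / 4 : ℝ) ^ 2 := by
    intro w hw
    simp only [div_pow, ← sum_div, hcc]
    rw [div_le_iff₀ (by positivity)]
    have h4 := sum_radSum_pow_four_le w
    have hw0 : 0 ≤ ∑ a, w a ^ 2 := sum_nonneg fun a _ => sq_nonneg _
    have h5 : (∑ a, w a ^ 2) ^ 2 ≤ 1 := pow_le_one₀ hw0 hw
    have h6 : ∑ z, (radSum w z - trunc (radSum w z)) ^ 2 ≤ (∑ z, radSum w z ^ 4) / 64 := by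
      rw [sum_div]; exact sum_le_sum fun z _ => sub_trunc_sq_le _
    have h7 : (0 : ℝ) < 2 ^ N := by positivity
    nlinarith
  have split : ∀ j k, ∑ a, u j a * v k a =
      (∑ z, (radSum (u j) z - trunc (radSum (u j) z)) / c * (radSum (v k) z / c)) +
      (∑ z, trunc (radSum (u j) z) / c * ((radSum (v k) z - trunc (radSum (v k) z)) / c)) +
      (∑ z, trunc (radSum (u j) z) * trunc (radSum (v k) z)) / 2 ^ N := by
    intro j k
    have := sum_radSum_mul (u j) (v k)
    have e : ∑ a, u j a * v k a = (∑ z, radSum (u j) z * radSum (v k) z) / 2 ^ N := by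
      rw [this, mul_div_cancel_left₀ _ (by positivity)]
    rw [e, ← hcc, sum_div, sum_div, ← sum_add_distrib, ← sum_add_distrib]
    exact sum_congr rfl fun z _ => by field_simp; ring
  have b1 := hA.of_fintype (fun j z => (radSum (u j) z - trunc (radSum (u j) z)) / c)
    (fun k z => radSum (v k) z / c) (r := 1 / 4) (s := 1) (by norm_num) (by norm_num)
    (fun j => nrmS _ (hu j)) (fun k => by simpa using nrm _ (hv k))
  have b2 := hA.of_fintype (fun j z => trunc (radSum (u j) z) / c)
    (fun k z => (radSum (v k) z - trunc (radSum (v k) z)) / c) (r := 1) (s := 1 / 4)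
    (by norm_num) (by norm_num)
    (fun j => by simpa using nrmT _ (hu j)) (fun k => nrmS _ (hv k))
  have b3 : ∑ j, ∑ k, D j k * ((∑ z, trunc (radSum (u j) z) * trunc (radSum (v k) z)) / 2 ^ N) ≤
      64 * t := by
    have : ∑ j, ∑ k, D j k * ((∑ z, trunc (radSum (u j) z) * trunc (radSum (v k) z)) / 2 ^ N) =
        (∑ z : Fin N → Bool, ∑ j, ∑ k, D j k * (trunc (radSum (u j) z) * trunc (radSum
            (v k) z))) / 2 ^ N := by
      rw [sum_comm (s := univ (α := Fin N → Bool)), sum_div]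
      refine sum_congr rfl fun j _ => ?_
      rw [sum_comm (s := univ (α := Fin N → Bool)), sum_div]
      refine sum_congr rfl fun k _ => ?_
      rw [mul_div_assoc', mul_sum]
    rw [this, div_le_iff₀ (by positivity)]
    refine (sum_le_sum fun z _ => sum_mul_le_of_boolSign h (by norm_num : (0 : ℝ) ≤ 8)
      (fun j => abs_trunc_le _) (fun j => abs_trunc_le _)).trans ?_
    simp
    linarith
  simp only [split, mul_add, sum_add_distrib]
  linarith

open scoped MatrixOrder in
lemma exists_eq_conjTranspose_mul_self {B : Type} [Fintype B] [DecidableEq B] {X : Matrix B B ℝ}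
    (hX : X.PosSemidef) : ∃ A : Matrix B B ℝ, X = A.conjTranspose * A :=
  CStarAlgebra.nonneg_iff_eq_star_mul_self.mp hX.nonneg

/-- A Grothendieck-type inequality for positive semidefinite matrices with unit diagonal. -/
lemma sum_mul_posSemidef_le {B : Type} [Fintype B] {D : B → B → ℝ} {t : ℝ}
    (h : ∀ ε δ : B → Bool, ∑ j, ∑ k, D j k * (boolSign (ε j) * boolSign (δ k)) ≤ t)
    {X : Matrix B B ℝ} (hX : X.PosSemidef) (h1 : ∀ i, X i i = 1) :
    ∑ j, ∑ k, D j k * X j k ≤ 128 * t := by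
  classical
  have ht : 0 ≤ t := by
    have e1 := h (fun _ => true) (fun _ => true)
    have e2 := h (fun _ => true) (fun _ => false)
    simp only [boolSign] at e1 e2
    simp at e1 e2
    linarith
  have hS : VectorBound D (∑ j, ∑ k, |D j k|) := by
    refine ⟨sum_nonneg fun j _ => sum_nonneg fun k _ => abs_nonneg _, fun N u v hu hv => ?_⟩
    refine sum_le_sum fun j _ => sum_le_sum fun k _ => ?_
    refine (le_abs_self _).trans ?_
    rw [abs_mul]
    refine mul_le_of_le_one_right (abs_nonneg _) ?_
    rw [← sq_le_one_iff_abs_le_one]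
    exact (sum_mul_sq_le_sq_mul_sq _ _ _).trans
      (mul_le_one₀ (hu j) (sum_nonneg fun _ _ => sq_nonneg _) (hv k))
  set S := {A | VectorBound D A}
  have hbdd : BddBelow S := ⟨0, fun A hA => hA.1⟩
  have hG : VectorBound D (sInf S) :=
    ⟨le_csInf ⟨_, hS⟩ fun A hA => hA.1,
      fun N u v hu hv => le_csInf ⟨_, hS⟩ fun A hA => hA.2 N u v hu hv⟩
  have hG2 := csInf_le hbdd (hG.halve ht h)
  obtain ⟨A, rfl⟩ := exists_eq_conjTranspose_mul_self hX
  have e : ∀ j k, (A.conjTranspose * A) j k = ∑ a, A a j * A a k := by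
    intro j k; simp [Matrix.mul_apply]
  have := hG.of_fintype (fun j a => A a j) (fun j a => A a j) (r := 1) (s := 1) one_pos one_pos
    (fun j => by rw [one_pow, ← h1 j, e]; exact le_of_eq (sum_congr rfl fun a _ => sq _))
    (fun j => by rw [one_pow, ← h1 j, e]; exact le_of_eq (sum_congr rfl fun a _ => sq _))
  simp only [e]
  linarith

lemma measureReal_mean_dev_le {Ω : Type} [MeasurableSpace Ω]
    (ρ : Measure Ω) [IsProbabilityMeasure ρ]
    {f : Ω → ℝ} (hf : Measurable f) (h1 : ∀ z, |f z| ≤ 1) {m : ℕ} (hm : 0 < m) {t : ℝ}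
        (ht : 0 ≤ t) :
    (Measure.pi fun _ : Fin m => ρ).real {x | t ≤ (∫ z, f z ∂ρ) - (∑ i, f (x i)) / m} ≤
      Real.exp (-(m * t ^ 2 / 2)) := by
  set P := Measure.pi fun _ : Fin m => ρ
  set I := ∫ z, f z ∂ρ
  have hm' : (0 : ℝ) < m := by exact_mod_cast hm
  have hmeas : Measurable fun z => I - f z := measurable_const.sub hf
  have hfi : Integrable f ρ := integrable_of_mem_Icc hf fun z => abs_le.1 (h1 z)
  have hind : ProbabilityTheory.iIndepFun (fun (i : Fin m) (ω : Fin m → Ω) => I - f (ω i)) P :=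
    ProbabilityTheory.iIndepFun_pi (μ := fun _ : Fin m => ρ) (X := fun _ z => I - f z)
      fun _ => hmeas.aemeasurable
  have hsub : ∀ i ∈ (univ : Finset (Fin m)), ProbabilityTheory.HasSubgaussianMGF
      (fun ω : Fin m → Ω => I - f (ω i)) 1 P := by
    intro i _
    have := ProbabilityTheory.hasSubgaussianMGF_of_mem_Icc_of_integral_eq_zero (μ := P)
      (X := fun ω : Fin m → Ω => I - f (ω i)) (a := I - 1) (b := I + 1)
      (hmeas.comp (measurable_pi_apply i)).aemeasurable
      (Filter.Eventually.of_forall fun ω => by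
        have := abs_le.1 (h1 (ω i)); constructor <;> linarith)
      (by
        have h2 : ∫ ω : Fin m → Ω, (I - f (ω i)) ∂P = ∫ z, (I - f z) ∂ρ :=
          integral_comp_eval (μ := fun _ : Fin m => ρ) hmeas.aestronglyMeasurable
        rw [h2, integral_sub (integrable_const _) hfi]; simp [I])
    have e : (‖I + 1 - (I - 1)‖₊ / 2) ^ 2 = 1 := by
      have : I + 1 - (I - 1) = 2 := by ring
      rw [this]; simp
    rwa [e] at this
  have h := ProbabilityTheory.HasSubgaussianMGF.measure_sum_ge_le_of_iIndepFun hind hsub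
    (ε := m * t) (by positivity)
  have eset : {x : Fin m → Ω | t ≤ I - (∑ i, f (x i)) / m} = {ω | m * t ≤ ∑ i, (I - f (ω i))} := by
    ext x
    simp only [Set.mem_ofPred_eq, sum_sub_distrib, sum_const, card_univ, Fintype.card_fin,
      nsmul_eq_mul]
    rw [← mul_le_mul_iff_right₀ hm', mul_sub, mul_div_cancel₀ _ hm'.ne']
  rw [eset]
  refine h.trans (le_of_eq ?_)
  congr 1
  simp
  field_simp

lemma abs_sum_mul_boolSign_le {B : Type} [Fintype B] {w : B → B → ℝ} (h0 : ∀ j k, 0 ≤ w j k)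
    (h1 : ∑ j, ∑ k, w j k = 1) (ε δ : B → Bool) :
    |∑ j, ∑ k, w j k * (boolSign (ε j) * boolSign (δ k))| ≤ 1 := by
  rw [← h1]
  refine (abs_sum_le_sum_abs _ _).trans (sum_le_sum fun j _ => ?_)
  refine (abs_sum_le_sum_abs _ _).trans (sum_le_sum fun k _ => ?_)
  rw [abs_mul, abs_mul, abs_boolSign, abs_boolSign, abs_of_nonneg (h0 j k)]; simp

/-- Uniform sampling bound: empirical averages of `W` approximate the mean of `W`, simultaneously
against all positive semidefinite matrices with unit diagonal. -/
lemma exists_samplingNoise {Ω : Type} [MeasurableSpace Ω] (ρ : Measure Ω) [IsProbabilityMeasure ρ]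
    {B : Type} [Fintype B] [Nonempty B] {m : ℕ} (W : Ω → B → B → ℝ)
    (hW : ∀ j k, Measurable fun z => W z j k) (h0 : ∀ z j k, 0 ≤ W z j k)
    (h1 : ∀ z, ∑ j, ∑ k, W z j k = 1) {θ : ℝ} (hθ : 0 < θ) (hθ1 : θ ≤ 1)
    (hm : 10 ^ 5 * (Fintype.card B : ℝ) ≤ m * θ ^ 3) :
    ∃ N : (Fin m → Ω) → ℝ, Measurable N ∧ (∀ x, 0 ≤ N x ∧ N x ≤ 2) ∧
      ∫ x, N x ∂(Measure.pi fun _ : Fin m => ρ) ≤ 2 * θ ∧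
      ∀ x (X : Matrix B B ℝ), X.PosSemidef → (∀ i, X i i = 1) → (∀ i j, -1 ≤ X i j ∧ X i j ≤ 1) →
        ∑ j, ∑ k, (∫ z, W z j k ∂ρ) * ((1 + X j k) / 2) ≤
          (∑ i, ∑ j, ∑ k, W (x i) j k * ((1 + X j k) / 2)) / m + N x := by
  classical
  set P := Measure.pi fun _ : Fin m => ρ
  have hcard : (1 : ℝ) ≤ Fintype.card B := by exact_mod_cast Fintype.card_pos
  have hm0 : 0 < m := by
    rcases Nat.eq_zero_or_pos m with h | h
    · rw [h] at hm; simp at hm; linarith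
    · exact h
  have hm' : (0 : ℝ) < m := by exact_mod_cast hm0
  have hW1 : ∀ z j k, W z j k ≤ 1 := fun z j k => by
    rw [← h1 z]
    exact (single_le_sum (f := fun k => W z j k) (fun k _ => h0 z j k) (mem_univ k)).trans
      (single_le_sum (f := fun j => ∑ k, W z j k) (fun j _ => sum_nonneg fun k _ => h0 z j k)
        (mem_univ j))
  have hWi : ∀ j k, Integrable (fun z => W z j k) ρ := fun j k =>
    integrable_of_mem_Icc (hW j k) fun z => ⟨h0 z j k, hW1 z j k⟩
  set f : (B → Bool) → (B → Bool) → Ω → ℝ := fun ε δ z =>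
    ∑ j, ∑ k, W z j k * (boolSign (ε j) * boolSign (δ k)) with hf
  have hfm : ∀ ε δ, Measurable (f ε δ) := fun ε δ =>
    Finset.measurable_fun_sum _ fun j _ => Finset.measurable_fun_sum _ fun k _ =>
        (hW j k).mul_const _
  set t := θ / 128
  have ht : 0 < t := by positivity
  set bad : (B → Bool) × (B → Bool) → Set (Fin m → Ω) := fun q =>
    {x | t ≤ (∫ z, f q.1 q.2 z ∂ρ) - (∑ i, f q.1 q.2 (x i)) / m}
  have hbadm : ∀ q, MeasurableSet (bad q) := fun q => by
    refine measurableSet_le measurable_const (measurable_const.sub (Measurable.div_const ?_ _))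
    exact Finset.measurable_fun_sum _ fun i _ => (hfm _ _).comp (measurable_pi_apply i)
  set Bad : Set (Fin m → Ω) := ⋃ q, bad q
  have hBad : MeasurableSet Bad := MeasurableSet.iUnion hbadm
  have hPBad : P.real Bad ≤ θ := by
    calc P.real Bad ≤ ∑ q, P.real (bad q) := measureReal_iUnion_fintype_le _
      _ ≤ ∑ _q : (B → Bool) × (B → Bool), Real.exp (-(m * t ^ 2 / 2)) :=
          sum_le_sum fun q _ => measureReal_mean_dev_le ρ (hfm _ _)
            (fun z => abs_sum_mul_boolSign_le (h0 z) (h1 z) _ _) hm0 ht.le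
      _ = 4 ^ (Fintype.card B) * Real.exp (-(m * t ^ 2 / 2)) := by
          simp only [sum_const, card_univ, nsmul_eq_mul, Fintype.card_prod, Fintype.card_fun,
            Fintype.card_bool]
          push_cast
          rw [← mul_pow]; norm_num
      _ ≤ Real.exp (Fintype.card B * 2) * Real.exp (-(m * t ^ 2 / 2)) := by
          gcongr
          rw [Real.exp_nat_mul]
          gcongr
          have h2 : (2 : ℝ) ≤ Real.exp 1 := by have := Real.add_one_le_exp (1 : ℝ); linarith
          have : Real.exp 2 = Real.exp 1 * Real.exp 1 := by rw [← Real.exp_add]; norm_num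
          nlinarith
      _ = Real.exp (-(m * t ^ 2 / 2 - Fintype.card B * 2)) := by rw [← Real.exp_add]; ring_nf
      _ ≤ Real.exp (-(1 / θ)) := by
          gcongr
          have : m * t ^ 2 / 2 = m * θ ^ 3 / θ / 32768 := by simp only [t]; field_simp; norm_num
          rw [this]
          have h3 : 10 ^ 5 * (Fintype.card B : ℝ) / θ / 32768 ≤ m * θ ^ 3 / θ / 32768 := by gcongr
          refine le_trans ?_ (sub_le_sub_right h3 _)
          have h4 : 3 * (Fintype.card B : ℝ) / θ ≤ 10 ^ 5 * (Fintype.card B : ℝ) / θ / 32768 := by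
            rw [div_div, div_le_div_iff₀ hθ (by positivity)]
            have : 0 < (Fintype.card B : ℝ) * θ := by positivity
            nlinarith
          have h5 : (Fintype.card B : ℝ) ≤ Fintype.card B / θ := by
            rw [le_div_iff₀ hθ]; nlinarith
          have h6 : 1 / θ ≤ Fintype.card B / θ := by gcongr
          have h7 : 3 * (Fintype.card B : ℝ) / θ = 3 * (Fintype.card B / θ) := by ring
          linarith
      _ ≤ θ := by
          rw [Real.exp_neg]
          refine inv_le_of_inv_le₀ hθ ?_
          have := Real.add_one_le_exp (1 / θ)
          rw [one_div] at this
          rw [one_div]; linarith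
  refine ⟨fun x => θ + Bad.indicator 1 x,
    measurable_const.add (measurable_const.indicator hBad), fun x => ?_, ?_, ?_⟩
  · simp only [Set.indicator_apply, Pi.one_apply]
    split_ifs <;> constructor <;> linarith
  · rw [integral_add (integrable_const _) ((integrable_const 1).indicator hBad)]
    have e1 : ∫ a, Bad.indicator (1 : (Fin m → Ω) → ℝ) a
        ∂P = P.real Bad := integral_indicator_one hBad
    rw [e1]
    simp
    linarith
  · intro x X hX hX1 hXb
    have he : ∀ j k, 0 ≤ (1 + X j k) / 2 ∧ (1 + X j k) / 2 ≤ 1 := fun j k => by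
      have := hXb j k; constructor <;> linarith
    have hI1 : ∑ j, ∑ k, ∫ z, W z j k ∂ρ = 1 := by
      have : ∫ z, ∑ j, ∑ k, W z j k ∂ρ = 1 := by simp [h1]
      rw [integral_finsetSum _ fun j _ => integrable_finsetSum _ fun k _ => hWi j k] at this
      simp only [integral_finsetSum _ fun k _ => hWi _ k] at this
      exact this
    by_cases hx : x ∈ Bad
    · simp only [Set.indicator_of_mem hx, Pi.one_apply]
      have hl : ∑ j, ∑ k, (∫ z, W z j k ∂ρ) * ((1 + X j k) / 2) ≤ 1 := by
        refine le_trans (sum_le_sum fun j _ => sum_le_sum fun k _ =>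
          mul_le_of_le_one_right (integral_nonneg fun z => h0 z j k) (he j k).2) hI1.le
      have hr : 0 ≤ (∑ i, ∑ j, ∑ k, W (x i) j k * ((1 + X j k) / 2)) / m :=
        div_nonneg (sum_nonneg fun i _ => sum_nonneg fun j _ => sum_nonneg fun k _ =>
          mul_nonneg (h0 _ _ _) (he j k).1) hm'.le
      linarith
    · simp only [Set.indicator_of_notMem hx, add_zero]
      set D : B → B → ℝ := fun j k => (∫ z, W z j k ∂ρ) - (∑ i, W (x i) j k) / m with hD
      have hDle : ∀ ε δ : B → Bool, ∑ j, ∑ k, D j k * (boolSign (ε j) * boolSign (δ k)) ≤ t := by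
        intro ε δ
        have hnot : x ∉ bad (ε, δ) := fun h => hx (Set.mem_iUnion.2 ⟨_, h⟩)
        simp only [bad, Set.mem_ofPred_eq, not_le] at hnot
        have e1 : ∫ z, f ε δ z ∂ρ =
            ∑ j, ∑ k, (∫ z, W z j k ∂ρ) * (boolSign (ε j) * boolSign (δ k)) := by
          simp only [hf]
          rw [integral_finsetSum _ fun j _ => integrable_finsetSum _ fun k _ =>
              (hWi j k).mul_const _]
          refine sum_congr rfl fun j _ => ?_
          rw [integral_finsetSum _ fun k _ => (hWi j k).mul_const _]
          exact sum_congr rfl fun k _ => integral_mul_const _ _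
        have e2 : (∑ i, f ε δ (x i)) / m =
            ∑ j, ∑ k, (∑ i, W (x i) j k) / m * (boolSign (ε j) * boolSign (δ k)) := by
          simp only [hf]
          rw [sum_comm, sum_div]
          refine sum_congr rfl fun j _ => ?_
          rw [sum_comm, sum_div]
          refine sum_congr rfl fun k _ => ?_
          rw [← sum_mul]; ring
        rw [e1, e2, ← sum_sub_distrib] at hnot
        refine le_trans (le_of_eq ?_) hnot.le
        refine sum_congr rfl fun j _ => ?_
        rw [← sum_sub_distrib]
        exact sum_congr rfl fun k _ => by simp only [hD]; ring
      have hG := sum_mul_posSemidef_le hDle hX hX1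
      have hD0 : ∑ j, ∑ k, D j k = 0 := by
        simp only [hD, sum_sub_distrib, hI1, ← sum_div]
        have : ∑ j, ∑ k, ∑ i, W (x i) j k = m := by
          have e : ∀ j, ∑ k, ∑ i, W (x i) j k = ∑ i, ∑ k, W (x i) j k := fun j => sum_comm
          simp only [e]
          rw [sum_comm]
          simp [h1]
        rw [this, div_self hm'.ne']; simp
      have e3 : ∑ j, ∑ k, (∫ z, W z j k ∂ρ) * ((1 + X j k) / 2) -
          (∑ i, ∑ j, ∑ k, W (x i) j k * ((1 + X j k) / 2)) / m =
          (∑ j, ∑ k, D j k) / 2 + (∑ j, ∑ k, D j k * X j k) / 2 := by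
        have e4 : (∑ i, ∑ j, ∑ k, W (x i) j k * ((1 + X j k) / 2)) / m =
            ∑ j, ∑ k, (∑ i, W (x i) j k) / m * ((1 + X j k) / 2) := by
          rw [sum_comm, sum_div]
          refine sum_congr rfl fun j _ => ?_
          rw [sum_comm, sum_div]
          refine sum_congr rfl fun k _ => ?_
          rw [← sum_mul]; ring
        rw [e4, ← sum_sub_distrib, sum_div, sum_div, ← sum_add_distrib]
        refine sum_congr rfl fun j _ => ?_
        rw [← sum_sub_distrib, sum_div, sum_div, ← sum_add_distrib]
        exact sum_congr rfl fun k _ => by simp only [hD]; ring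
      have : 128 * t = θ := by simp only [t]; ring
      linarith

/-- The uniform distribution on the neighbours of `y` among the points `x`
(on all points if there are none). -/
noncomputable def nbrDist {d : ℕ} {ι : Type} [Fintype ι] (γ : ℝ) (x : ι → Sph d) (y : Sph d)
    (j : ι) : ℝ :=
  if ∑ i, sphAdj γ y (x i) = 0 then 1 / Fintype.card ι
  else sphAdj γ y (x j) / ∑ i, sphAdj γ y (x i)

section nbrDist
variable {d : ℕ} {ι : Type} [Fintype ι] (γ : ℝ)

lemma nbrDist_nonneg (x : ι → Sph d) (y : Sph d) (j : ι) : 0 ≤ nbrDist γ x y j := by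
  unfold nbrDist; split_ifs
  · positivity
  · exact div_nonneg (sphAdj_nonneg _ _ _) (sum_nonneg fun i _ => sphAdj_nonneg _ _ _)

lemma sum_nbrDist [Nonempty ι] (x : ι → Sph d) (y : Sph d) : ∑ j, nbrDist γ x y j = 1 := by
  unfold nbrDist; split_ifs with h
  · simp
  · rw [← sum_div, div_self h]

lemma nbrDist_le_one [Nonempty ι] (x : ι → Sph d) (y : Sph d) (j : ι) : nbrDist γ x y j ≤ 1 := by
  rw [← sum_nbrDist γ x y]
  exact single_le_sum (fun i _ => nbrDist_nonneg γ x y i) (mem_univ j)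

lemma measurable_nbrDist_comp {α : Type} [MeasurableSpace α] (x : ι → Sph d) (f : α → Sph d)
    (hf : Measurable f) (j : ι) : Measurable fun a => nbrDist γ x (f a) j := by
  have hs : Measurable fun a => ∑ i, sphAdj γ (f a) (x i) :=
    Finset.measurable_fun_sum _ fun j _ => measurable_sphAdj_comp γ _ _ hf measurable_const
  have h1 : Measurable fun a => sphAdj γ (f a) (x j) :=
    measurable_sphAdj_comp γ _ _ hf measurable_const
  have hset : MeasurableSet {a | ∑ i, sphAdj γ (f a) (x i) = 0} := hs (measurableSet_singleton 0)
  unfold nbrDist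
  exact Measurable.ite hset measurable_const (h1.div hs)

lemma abs_sum_nbrDist_sub_le [Nonempty ι] (hμ : 0 < sphereMu d γ) (x : ι → Sph d) (y : Sph d)
    {f : ι → ℝ} (h0 : ∀ j, 0 ≤ f j) (h1 : ∀ j, f j ≤ 1) :
    |∑ j, nbrDist γ x y j * f j - ∑ j, sphAdj γ y (x j) / (Fintype.card ι * sphereMu d γ) * f j| ≤
      degNoise γ y x := by
  have hb0 : 0 ≤ ∑ j, nbrDist γ x y j * f j :=
    sum_nonneg fun j _ => mul_nonneg (nbrDist_nonneg γ x y j) (h0 j)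
  have hb1 : ∑ j, nbrDist γ x y j * f j ≤ 1 := by
    refine (sum_le_sum fun j _ => mul_le_of_le_one_right (nbrDist_nonneg γ x y j) (h1 j)).trans ?_
    rw [sum_nbrDist]
  by_cases h : ∑ i, sphAdj γ y (x i) = 0
  · have ha : ∀ j, sphAdj γ y (x j) = 0 := fun j =>
      (sum_eq_zero_iff_of_nonneg fun i _ => sphAdj_nonneg _ _ _).1 h j (mem_univ j)
    simp only [ha, zero_div, zero_mul, sum_const_zero, sub_zero, degNoise, zero_sub, abs_neg,
        abs_one]
    rw [abs_of_nonneg hb0]; exact hb1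
  · have e : ∑ j, nbrDist γ x y j * f j -
        ∑ j, sphAdj γ y (x j) / (Fintype.card ι * sphereMu d γ) * f j =
        (1 - (∑ i, sphAdj γ y (x i)) / (Fintype.card ι * sphereMu d γ)) *
          ∑ j, nbrDist γ x y j * f j := by
      rw [mul_sum, ← sum_sub_distrib]
      refine sum_congr rfl fun j _ => ?_
      simp only [nbrDist, if_neg h]
      have : (Fintype.card ι : ℝ) ≠ 0 := by
        have := Fintype.card_ne_zero (α := ι); exact_mod_cast this
      field_simp
    rw [e, abs_mul, abs_of_nonneg hb0, abs_sub_comm]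
    exact mul_le_of_le_one_right (abs_nonneg _) hb1

end nbrDist

lemma Sdp3Feasible.submatrix {S T : Type} [Fintype S] [Fintype T] {X : Matrix T T ℝ}
    (h : Sdp3Feasible X) (f : S → T) : Sdp3Feasible (X.submatrix f f) :=
  ⟨h.1.submatrix f, fun i => h.2.1 (f i), fun _ _ _ => h.2.2.1 _ _ _, fun _ _ _ => h.2.2.2 _ _ _⟩

/-- The similarity `(1 + X) / 2`, extended from the points `xB` to the whole sphere. -/
noncomputable def hatE {d : ℕ} {B : Type} [Fintype B] (γ : ℝ) (xB : B → Sph d) (X : Matrix B B ℝ)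
    (y z : Sph d) : ℝ :=
  ∑ j, ∑ k, nbrDist γ xB y j * nbrDist γ xB z k * ((1 + X j k) / 2)

section hatE
variable {d : ℕ} {B : Type} [Fintype B] (γ : ℝ) (xB : B → Sph d) {X : Matrix B B ℝ}

lemma Sdp3Feasible.sim_mem (h : Sdp3Feasible X) (j k : B) :
    0 ≤ (1 + X j k) / 2 ∧ (1 + X j k) / 2 ≤ 1 := by
  have h1 := h.le_one j k; have h2 := h.neg_one_le j k
  constructor <;> linarith

lemma sum_weights_eq {p q : B → ℝ} (hp : ∑ j, p j = 1) (hq : ∑ j, q j = 1) :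
    ∑ j, ∑ k, p j * q k = 1 := by
  simp only [← mul_sum, hq, mul_one, hp]

lemma hatE_mem [Nonempty B] (h : Sdp3Feasible X)
    (y z : Sph d) : 0 ≤ hatE γ xB X y z ∧ hatE γ xB X y z ≤ 1 := by
  have hn := fun y j => nbrDist_nonneg γ xB y j
  constructor
  · exact sum_nonneg fun j _ => sum_nonneg fun k _ =>
      mul_nonneg (mul_nonneg (hn _ _) (hn _ _)) (h.sim_mem j k).1
  · refine le_trans (sum_le_sum fun j _ => sum_le_sum fun k _ =>
      mul_le_of_le_one_right (mul_nonneg (hn _ _) (hn _ _)) (h.sim_mem j k).2) ?_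
    rw [sum_weights_eq (sum_nbrDist γ xB y) (sum_nbrDist γ xB z)]

lemma hatE_symm (h : Sdp3Feasible X) (y z : Sph d) : hatE γ xB X y z = hatE γ xB X z y := by
  unfold hatE
  rw [sum_comm]
  exact sum_congr rfl fun j _ => sum_congr rfl fun k _ => by rw [h.symm k j]; ring

lemma measurable_hatE_comp {α : Type} [MeasurableSpace α] (X : Matrix B B ℝ) (f g : α → Sph d)
    (hf : Measurable f) (hg : Measurable g) : Measurable fun a => hatE γ xB X (f a) (g a) :=
  Finset.measurable_fun_sum _ fun j _ => Finset.measurable_fun_sum _ fun k _ =>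
    ((measurable_nbrDist_comp γ xB f hf j).mul (measurable_nbrDist_comp γ xB g hg k)).mul_const _

lemma hatE_triple (p q r : B → ℝ) (hp : ∑ j, p j = 1) (hq : ∑ j, q j = 1) (hr : ∑ j, r j = 1)
    (e : B → B → ℝ) :
    ∑ j, ∑ k, p j * q k * e j k = ∑ i, ∑ j, ∑ k, p i * q j * r k * e i j ∧
    ∑ j, ∑ k, q j * r k * e j k = ∑ i, ∑ j, ∑ k, p i * q j * r k * e j k ∧
    ∑ j, ∑ k, p j * r k * e j k = ∑ i, ∑ j, ∑ k, p i * q j * r k * e i k := by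
  refine ⟨?_, ?_, ?_⟩
  · refine sum_congr rfl fun i _ => sum_congr rfl fun j _ => ?_
    have : ∀ k, p i * q j * r k * e i j = r k * (p i * q j * e i j) := fun k => by ring
    simp only [this, ← sum_mul, hr, one_mul]
  · have : ∀ i j k, p i * q j * r k * e j k = p i * (q j * r k * e j k) := fun i j k => by ring
    simp only [this, ← mul_sum, ← sum_mul, hp, one_mul]
  · refine sum_congr rfl fun i _ => ?_
    rw [sum_comm]
    refine sum_congr rfl fun k _ => ?_
    have : ∀ j, p i * q j * r k * e i k = q j * (p i * r k * e i k) := fun k => by ring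
    simp only [this, ← sum_mul, hq, one_mul]

lemma one_le_hatE_add_add [Nonempty B] (h : Sdp3Feasible X) (x y z : Sph d) :
    1 ≤ hatE γ xB X x y + hatE γ xB X y z + hatE γ xB X x z := by
  have hn := fun y j => nbrDist_nonneg γ xB y j
  have ht := hatE_triple (nbrDist γ xB x) (nbrDist γ xB y) (nbrDist γ xB z) (sum_nbrDist _ _ _)
    (sum_nbrDist _ _ _) (sum_nbrDist _ _ _) (fun j k => (1 + X j k) / 2)
  unfold hatE
  rw [ht.1, ht.2.1, ht.2.2, ← sum_add_distrib, ← sum_add_distrib]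
  have h1 : (1 : ℝ) = ∑ i, ∑ j, ∑ k, nbrDist γ xB x i * nbrDist γ xB y j * nbrDist γ xB z k := by
    simp only [← mul_sum, sum_nbrDist, mul_one]
  rw [h1]
  refine sum_le_sum fun i _ => ?_
  rw [← sum_add_distrib, ← sum_add_distrib]
  refine sum_le_sum fun j _ => ?_
  rw [← sum_add_distrib, ← sum_add_distrib]
  refine sum_le_sum fun k _ => ?_
  have hw : 0 ≤ nbrDist γ xB x i * nbrDist γ xB y j * nbrDist γ xB z k :=
    mul_nonneg (mul_nonneg (hn _ _) (hn _ _)) (hn _ _)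
  have := h.2.2.2 i j k
  nlinarith

lemma hatE_add_le [Nonempty B] (h : Sdp3Feasible X) (x y z : Sph d) :
    hatE γ xB X x y + hatE γ xB X y z ≤ 1 + hatE γ xB X x z := by
  have hn := fun y j => nbrDist_nonneg γ xB y j
  have ht := hatE_triple (nbrDist γ xB x) (nbrDist γ xB y) (nbrDist γ xB z) (sum_nbrDist _ _ _)
    (sum_nbrDist _ _ _) (sum_nbrDist _ _ _) (fun j k => (1 + X j k) / 2)
  have h1 : (1 : ℝ) = ∑ i, ∑ j, ∑ k, nbrDist γ xB x i * nbrDist γ xB y j * nbrDist γ xB z k := by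
    simp only [← mul_sum, sum_nbrDist, mul_one]
  unfold hatE
  rw [ht.1, ht.2.1, ht.2.2, h1, ← sum_add_distrib, ← sum_add_distrib]
  refine sum_le_sum fun i _ => ?_
  rw [← sum_add_distrib, ← sum_add_distrib]
  refine sum_le_sum fun j _ => ?_
  rw [← sum_add_distrib, ← sum_add_distrib]
  refine sum_le_sum fun k _ => ?_
  have hw : 0 ≤ nbrDist γ xB x i * nbrDist γ xB y j * nbrDist γ xB z k :=
    mul_nonneg (mul_nonneg (hn _ _) (hn _ _)) (hn _ _)
  have := h.2.2.1 i j k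
  nlinarith

end hatE

/-- The average of `hatE` over the neighbours of `y` among the points `xR`. -/
noncomputable def nbrAvg {d : ℕ} {B R : Type} [Fintype B] [Fintype R] (γ : ℝ) (xB : B → Sph d)
    (xR : R → Sph d) (X : Matrix B B ℝ) (y : Sph d) : ℝ :=
  ∑ r, nbrDist γ xR y r * hatE γ xB X y (xR r)

section chain
variable {d m : ℕ} {B : Type} [Fintype B] {γ : ℝ}

lemma measurable_nbrAvg {R : Type} [Fintype R] (xB : B → Sph d) (xR : R → Sph d)
    (X : Matrix B B ℝ) : Measurable (nbrAvg γ xB xR X) := by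
  have : Measurable fun y => ∑ r, nbrDist γ xR y r * hatE γ xB X y (xR r) :=
    Finset.measurable_fun_sum _ fun r _ =>
      (measurable_nbrDist_comp γ xR _ measurable_id r).mul
        (measurable_hatE_comp γ xB X _ _ measurable_id measurable_const)
  exact this

lemma nbrAvg_mem [Nonempty B] {R : Type} [Fintype R] [Nonempty R] (xB : B → Sph d) (xR : R → Sph d)
    {X : Matrix B B ℝ} (h : Sdp3Feasible X) (y : Sph d) :
    0 ≤ nbrAvg γ xB xR X y ∧ nbrAvg γ xB xR X y ≤ 1 := by
  constructor
  · exact sum_nonneg fun r _ => mul_nonneg (nbrDist_nonneg _ _ _ _) (hatE_mem γ xB h _ _).1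
  · rw [← sum_nbrDist γ xR y]
    exact sum_le_sum fun r _ =>
      mul_le_of_le_one_right (nbrDist_nonneg _ _ _ _) (hatE_mem γ xB h _ _).2

lemma integrable_degNoise [NeZero d] {R : Type} [Fintype R] (hμ : 0 < sphereMu d γ)
    (xR : R → Sph d) :
    Integrable (fun y => degNoise γ y xR) (sphereUniform d) :=
  integrable_of_mem_Icc (measurable_degNoise_comp γ _ _ measurable_id fun _ => measurable_const)
    fun y => ⟨degNoise_nonneg _ _ _, degNoise_le γ hμ y xR⟩

lemma exists_noise_nbrAvg [Nonempty B] (hd : 3 ≤ d) (h0 : 0 < γ) (h1 : γ ≤ 1 / 2)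
    (hμ : 0 < sphereMu d γ)
    {k : ℕ} (hk : 1 ≤ k) (hcos : 1 - 2 * γ / 9 ≤ Real.cos (Real.pi / (2 * k + 1 : ℕ)))
    {θ : ℝ} (hθ : 0 < θ) (hθ1 : θ ≤ 1) (hm : 10 ^ 5 * (Fintype.card B : ℝ) ≤ m * θ ^ 3)
    (hm0 : 0 < m) (xB : B → Sph d) :
    ∃ N : (Fin m → Sph d) → ℝ, Measurable N ∧ (∀ x, 0 ≤ N x ∧ N x ≤ 2) ∧
      ∫ x, N x ∂(Measure.pi fun _ : Fin m => sphereUniform d) ≤ 2 * θ ∧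
      ∀ (xR : Fin m → Sph d) (X : Matrix B B ℝ), Sdp3Feasible X →
        1 / (2 * (2 * k + 1 : ℕ) : ℝ) ≤ (∫ y, nbrAvg γ xB xR X y ∂(sphereUniform d)) +
          (∫ y, degNoise γ y xR ∂(sphereUniform d)) + N xR := by
  have : NeZero d := ⟨by omega⟩
  have : Nonempty (Fin m) := ⟨⟨0, hm0⟩⟩
  have hm' : (0 : ℝ) < m := by exact_mod_cast hm0
  set μ := sphereMu d γ with hμdef
  have hInt : ∀ z j, Integrable (fun y => sphAdj γ y z * nbrDist γ xB y j) (sphereUniform d) := by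
    intro z j
    refine integrable_of_mem_Icc (A := 0) (B := 1)
      ((measurable_sphAdj_comp γ _ _ measurable_id measurable_const).mul
        (measurable_nbrDist_comp γ xB _ measurable_id j)) fun y =>
      ⟨mul_nonneg (sphAdj_nonneg _ _ _) (nbrDist_nonneg _ _ _ _),
        mul_le_one₀ (sphAdj_le_one _ _ _) (nbrDist_nonneg _ _ _ _) (nbrDist_le_one _ _ _ _)⟩
  set c : Sph d → B → ℝ := fun z j => (∫ y, sphAdj γ y z * nbrDist γ xB y j ∂(sphereUniform d)) / μ
    with hc
  have hcm : ∀ j, Measurable fun z => c z j := by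
    intro j
    have h2 : Measurable (fun p : Sph d × Sph d => sphAdj γ p.2 p.1 * nbrDist γ xB p.2 j) :=
      (measurable_sphAdj_comp γ _ _ measurable_snd measurable_fst).mul
        (measurable_nbrDist_comp γ xB _ measurable_snd j)
    have h3 := (h2.stronglyMeasurable.integral_prod_right'
        (ν := sphereUniform d)).measurable.div_const μ
    exact h3
  have hc0 : ∀ z j, 0 ≤ c z j := fun z j => div_nonneg (integral_nonneg fun y =>
    mul_nonneg (sphAdj_nonneg _ _ _) (nbrDist_nonneg _ _ _ _)) hμ.le
  have hc1 : ∀ z, ∑ j, c z j = 1 := by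
    intro z
    simp only [hc]
    rw [← sum_div, ← integral_finsetSum _ fun j _ => hInt z j]
    simp only [← mul_sum, sum_nbrDist, mul_one]
    have : ∀ y, sphAdj γ y z = sphAdj γ z y := fun y => sphAdj_comm _ _ _
    simp only [this]
    rw [integral_sphAdj, div_self hμ.ne']
  obtain ⟨N, hN, hN2, hNi, hNX⟩ := exists_samplingNoise (sphereUniform d) (m := m)
    (fun z j k => c z j * nbrDist γ xB z k)
    (fun j k => (hcm j).mul (measurable_nbrDist_comp γ xB _ measurable_id k))
    (fun z j k => mul_nonneg (hc0 z j) (nbrDist_nonneg _ _ _ _))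
    (fun z => sum_weights_eq (hc1 z) (sum_nbrDist γ xB z)) hθ hθ1 hm
  refine ⟨N, hN, hN2, hNi, fun xR X hX => ?_⟩
  have hHint : ∀ z, Integrable (fun y => sphAdj γ y z * hatE γ xB X y z)
      (sphereUniform d) := fun z =>
    integrable_of_mem_Icc (A := 0) (B := 1)
      ((measurable_sphAdj_comp γ _ _ measurable_id measurable_const).mul
        (measurable_hatE_comp γ xB X _ _ measurable_id measurable_const)) fun y =>
      ⟨mul_nonneg (sphAdj_nonneg _ _ _) (hatE_mem γ xB hX _ _).1,
        mul_le_one₀ (sphAdj_le_one _ _ _) (hatE_mem γ xB hX _ _).1 (hatE_mem γ xB hX _ _).2⟩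
  have hW : ∀ z, ∑ j, ∑ k, c z j * nbrDist γ xB z k * ((1 + X j k) / 2) =
      (∫ y, sphAdj γ y z * hatE γ xB X y z ∂(sphereUniform d)) / μ := by
    intro z
    have e1 : ∀ y, sphAdj γ y z * hatE γ xB X y z = ∑ j, ∑ k,
        (sphAdj γ y z * nbrDist γ xB y j) * (nbrDist γ xB z k * ((1 + X j k) / 2)) := by
      intro y
      simp only [hatE, mul_sum]
      exact sum_congr rfl fun j _ => sum_congr rfl fun k _ => by ring
    simp only [e1]
    rw [integral_finsetSum _ fun j _ => integrable_finsetSum _ fun k _ =>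
        (hInt z j).mul_const _, sum_div]
    refine sum_congr rfl fun j _ => ?_
    rw [integral_finsetSum _ fun k _ => (hInt z j).mul_const _, sum_div]
    refine sum_congr rfl fun k _ => ?_
    rw [integral_mul_const]
    simp only [hc]; ring
  have hcle : ∀ z j, c z j ≤ 1 := fun z j => by
    rw [← hc1 z]; exact single_le_sum (fun i _ => hc0 z i) (mem_univ j)
  have hWint : ∀ j k, Integrable (fun z => c z j * nbrDist γ xB z k) (sphereUniform d) := fun j k =>
    integrable_of_mem_Icc (A := 0) (B := 1)
      ((hcm j).mul (measurable_nbrDist_comp γ xB _ measurable_id k)) fun z =>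
      ⟨mul_nonneg (hc0 z j) (nbrDist_nonneg _ _ _ _),
        mul_le_one₀ (hcle z j) (nbrDist_nonneg _ _ _ _) (nbrDist_le_one _ _ _ _)⟩
  have hL := sphereMu_div_le_integral hd h0 h1 (e := hatE γ xB X)
    (measurable_hatE_comp γ xB X _ _ measurable_fst measurable_snd) (hatE_mem γ xB hX)
    (hatE_symm γ xB hX) (one_le_hatE_add_add γ xB hX) (hatE_add_le γ xB hX) hk hcos
  have hlhs : ∑ j, ∑ k, (∫ z, c z j * nbrDist γ xB z k ∂(sphereUniform d)) * ((1 + X j k) / 2) =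
      (∫ y, ∫ z, sphAdj γ y z * hatE γ xB X y z ∂(sphereUniform d) ∂(sphereUniform d)) / μ := by
    have e2 : ∀ z, (∫ y, sphAdj γ z y * hatE γ xB X z y ∂(sphereUniform d)) / μ =
        ∑ j, ∑ k, c z j * nbrDist γ xB z k * ((1 + X j k) / 2) := by
      intro z
      rw [hW]
      congr 1
      refine integral_congr_ae (Filter.Eventually.of_forall fun y => ?_)
      simp only
      rw [sphAdj_comm γ z y, hatE_symm γ xB hX z y]
    rw [← integral_div]
    simp only [e2]
    rw [integral_finsetSum _ fun j _ => integrable_finsetSum _ fun k _ => (hWint j k).mul_const _]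
    refine sum_congr rfl fun j _ => ?_
    rw [integral_finsetSum _ fun k _ => (hWint j k).mul_const _]
    exact sum_congr rfl fun k _ => (integral_mul_const _ _).symm
  have hN3 := hNX xR X hX.1 hX.2.1 (fun i j => ⟨hX.neg_one_le i j, hX.le_one i j⟩)
  rw [hlhs] at hN3
  simp only [hW] at hN3
  have hstart : 1 / (2 * (2 * k + 1 : ℕ) : ℝ) ≤
      (∫ y, ∫ z, sphAdj γ y z * hatE γ xB X y z ∂(sphereUniform d) ∂(sphereUniform d)) / μ := by
    rw [le_div_iff₀ hμ]
    refine le_trans (le_of_eq ?_) hL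
    rw [hμdef]; ring
  have hmid : (∑ i, (∫ y, sphAdj γ y (xR i) * hatE γ xB X y (xR i) ∂(sphereUniform d)) / μ) / m ≤
      (∫ y, nbrAvg γ xB xR X y ∂(sphereUniform d)) + ∫ y, degNoise γ y xR ∂(sphereUniform d) := by
    rw [← sum_div, div_div, ← integral_finsetSum _ fun i _ => hHint (xR i), ← integral_div]
    have hA : Integrable (nbrAvg γ xB xR X) (sphereUniform d) :=
      integrable_of_mem_Icc (measurable_nbrAvg xB xR X) fun y => nbrAvg_mem xB xR hX y
    rw [← integral_add hA (integrable_degNoise hμ xR)]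
    refine integral_mono ((integrable_finsetSum _ fun i _ => hHint (xR i)).div_const _)
      (hA.add (integrable_degNoise hμ xR)) fun y => ?_
    have := abs_sum_nbrDist_sub_le γ hμ xR y (f := fun r => hatE γ xB X y (xR r))
      (fun r => (hatE_mem γ xB hX _ _).1) (fun r => (hatE_mem γ xB hX _ _).2)
    have h5 := (abs_le.1 this).1
    simp only [Fintype.card_fin] at h5
    have e6 : (∑ i, sphAdj γ y (xR i) * hatE γ xB X y (xR i)) / (μ * m) =
        ∑ r, sphAdj γ y (xR r) / (m * sphereMu d γ) * hatE γ xB X y (xR r) := by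
      rw [sum_div]; exact sum_congr rfl fun r _ => by rw [hμdef]; ring
    simp only [nbrAvg]
    rw [e6]
    linarith
  linarith

lemma exists_noise_sample_nbrAvg [NeZero d] [Nonempty B] {R : Type} [Fintype R] [Nonempty R]
    {θ : ℝ} (hθ : 0 < θ) (hθ1 : θ ≤ 1) (hm : 10 ^ 5 * (Fintype.card B : ℝ) ≤ m * θ ^ 3)
    (γ : ℝ) (xB : B → Sph d) (xR : R → Sph d) :
    ∃ N : (Fin m → Sph d) → ℝ, Measurable N ∧ (∀ x, 0 ≤ N x ∧ N x ≤ 2) ∧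
      ∫ x, N x ∂(Measure.pi fun _ : Fin m => sphereUniform d) ≤ 2 * θ ∧
      ∀ (xQ : Fin m → Sph d) (X : Matrix B B ℝ), Sdp3Feasible X →
        ∫ y, nbrAvg γ xB xR X y ∂(sphereUniform d) ≤
          (∑ q, nbrAvg γ xB xR X (xQ q)) / m + N xQ := by
  set w : Sph d → B → ℝ := fun y k => ∑ r, nbrDist γ xR y r * nbrDist γ xB (xR r) k with hw
  have hwm : ∀ k, Measurable fun y => w y k := fun k =>
    Finset.measurable_fun_sum _ fun r _ =>
      (measurable_nbrDist_comp γ xR _ measurable_id r).mul_const _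
  have hw0 : ∀ y k, 0 ≤ w y k := fun y k =>
    sum_nonneg fun r _ => mul_nonneg (nbrDist_nonneg _ _ _ _) (nbrDist_nonneg _ _ _ _)
  have hw1 : ∀ y, ∑ k, w y k = 1 := fun y => by
    simp only [hw]; rw [sum_comm]; simp only [← mul_sum, sum_nbrDist, mul_one]
  have hwle : ∀ z j, w z j ≤ 1 := fun z j => by
    rw [← hw1 z]; exact single_le_sum (fun i _ => hw0 z i) (mem_univ j)
  obtain ⟨N, hN, hN2, hNi, hNX⟩ := exists_samplingNoise (sphereUniform d) (m := m)
    (fun y j k => nbrDist γ xB y j * w y k)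
    (fun j k => (measurable_nbrDist_comp γ xB _ measurable_id j).mul (hwm k))
    (fun z j k => mul_nonneg (nbrDist_nonneg _ _ _ _) (hw0 z k))
    (fun z => sum_weights_eq (sum_nbrDist γ xB z) (hw1 z)) hθ hθ1 hm
  refine ⟨N, hN, hN2, hNi, fun xQ X hX => ?_⟩
  have e : ∀ y, ∑ j, ∑ k, nbrDist γ xB y j * w y k * ((1 + X j k) / 2) = nbrAvg γ xB xR X y := by
    intro y
    simp only [nbrAvg, hatE, hw, mul_sum, sum_mul]
    rw [sum_comm (s := univ (α := R))]
    refine sum_congr rfl fun j _ => ?_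
    rw [sum_comm (s := univ (α := R))]
    exact sum_congr rfl fun k _ => sum_congr rfl fun r _ => by ring
  have hInt : ∀ j k, Integrable (fun y => nbrDist γ xB y j * w y k) (sphereUniform d) := fun j k =>
    integrable_of_mem_Icc (A := 0) (B := 1)
      ((measurable_nbrDist_comp γ xB _ measurable_id j).mul (hwm k)) fun z =>
      ⟨mul_nonneg (nbrDist_nonneg _ _ _ _) (hw0 z k),
        mul_le_one₀ (nbrDist_le_one _ _ _ _) (hw0 z k) (hwle z k)⟩
  have h := hNX xQ X hX.1 hX.2.1 (fun i j => ⟨hX.neg_one_le i j, hX.le_one i j⟩)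
  simp only [e] at h
  refine le_trans (le_of_eq ?_) h
  simp only [← e]
  rw [integral_finsetSum _ fun j _ => integrable_finsetSum _ fun k _ => (hInt j k).mul_const _]
  refine sum_congr rfl fun j _ => ?_
  rw [integral_finsetSum _ fun k _ => (hInt j k).mul_const _]
  exact sum_congr rfl fun k _ => integral_mul_const _ _

end chain

/-- The uniform weights on pairs of points from different parts of `B ⊕ R ⊕ Q`. -/
noncomputable def partCoef (B R Q : Type) [Fintype B] [Fintype R] [Fintype Q] :
    B ⊕ R ⊕ Q → B ⊕ R ⊕ Q → ℝ
  | .inl _, .inr (.inl _) => 1 / (Fintype.card B * Fintype.card R)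
  | .inl _, .inr (.inr _) => 1 / (Fintype.card B * Fintype.card Q)
  | .inr (.inl _), .inr (.inr _) => 1 / (Fintype.card R * Fintype.card Q)
  | _, _ => 0

section tripartite
variable {d : ℕ} {B R Q : Type} [Fintype B] [Fintype R] [Fintype Q]

/-- The normalized edge weights of the tripartite geometric graph. -/
noncomputable def triW (γ : ℝ) (x : B ⊕ R ⊕ Q → Sph d) (s t : B ⊕ R ⊕ Q) : ℝ :=
  partCoef B R Q s t * (sphAdj γ (x s) (x t) / sphereMu d γ)

lemma partCoef_nonneg (s t : B ⊕ R ⊕ Q) : 0 ≤ partCoef B R Q s t := by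
  rcases s with _ | _ | _ <;> rcases t with _ | _ | _ <;> simp only [partCoef] <;> positivity

lemma triW_nonneg (γ : ℝ) (x : B ⊕ R ⊕ Q → Sph d) (s t : B ⊕ R ⊕ Q) : 0 ≤ triW γ x s t :=
  mul_nonneg (partCoef_nonneg s t) (div_nonneg (sphAdj_nonneg _ _ _) ENNReal.toReal_nonneg)

lemma degRatio_le {ι : Type} [Fintype ι] (γ : ℝ) (y : Sph d) (x : ι → Sph d) :
    ∑ j, sphAdj γ y (x j) / (Fintype.card ι * sphereMu d γ) ≤ 1 + degNoise γ y x := by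
  rw [← sum_div]
  have := le_abs_self ((∑ j, sphAdj γ y (x j)) / (Fintype.card ι * sphereMu d γ) - 1)
  unfold degNoise; linarith

lemma Sdp3Feasible.sim_path {T : Type} [Fintype T] {X : Matrix T T ℝ} (h : Sdp3Feasible X)
    (j q r k : T) : (1 + X j k) / 2 ≤ (1 + X j q) / 2 + (1 + X r q) / 2 + (1 + X k r) / 2 := by
  have h1 := h.2.2.2 j q r
  have h2 := h.2.2.1 k j r
  rw [h.symm r q, h.symm j k]
  linarith

lemma hatE_le_path [Nonempty B] (γ : ℝ) (xB : B → Sph d) {T : Type} [Fintype T]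
    {X : Matrix T T ℝ} (h : Sdp3Feasible X) (f : B → T) (q r : T) (y z : Sph d) :
    hatE γ xB (X.submatrix f f) y z ≤ (∑ j, nbrDist γ xB y j * ((1 + X (f j) q) / 2)) +
      (1 + X r q) / 2 + ∑ k, nbrDist γ xB z k * ((1 + X (f k) r) / 2) := by
  have hn := fun y j => nbrDist_nonneg γ xB y j
  have e : (∑ j, nbrDist γ xB y j * ((1 + X (f j) q) / 2)) +
      (1 + X r q) / 2 + ∑ k, nbrDist γ xB z k * ((1 + X (f k) r) / 2) =
      ∑ j, ∑ k, nbrDist γ xB y j * nbrDist γ xB z k *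
        ((1 + X (f j) q) / 2 + (1 + X r q) / 2 + (1 + X (f k) r) / 2) := by
    simp only [mul_add, sum_add_distrib]
    congr 1
    · congr 1
      · refine sum_congr rfl fun j _ => ?_
        have : ∀ k, nbrDist γ xB y j * nbrDist γ xB z k * ((1 + X (f j) q) / 2) =
            nbrDist γ xB z k * (nbrDist γ xB y j * ((1 + X (f j) q) / 2)) := fun k => by ring
        simp only [this, ← sum_mul, sum_nbrDist, one_mul]
      · simp only [← sum_mul, ← mul_sum, sum_nbrDist, one_mul, mul_one]
    · have : ∀ j k, nbrDist γ xB y j * nbrDist γ xB z k * ((1 + X (f k) r) / 2) =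
          nbrDist γ xB y j * (nbrDist γ xB z k * ((1 + X (f k) r) / 2)) := fun j k => by ring
      simp only [this, ← mul_sum, ← sum_mul, sum_nbrDist, one_mul]
  rw [e]
  exact sum_le_sum fun j _ => sum_le_sum fun k _ =>
    mul_le_mul_of_nonneg_left (h.sim_path _ _ _ _) (mul_nonneg (hn _ _) (hn _ _))

/-- The total degree noise of the tripartite graph. -/
noncomputable def triNoise (γ : ℝ) (x : B ⊕ R ⊕ Q → Sph d) : ℝ :=
  (∑ q, (3 * degNoise γ (x (.inr (.inr q))) (fun r => x (.inr (.inl r))) +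
    2 * degNoise γ (x (.inr (.inr q))) (fun j => x (.inl j)))) / Fintype.card Q +
  (∑ r, (degNoise γ (x (.inr (.inl r))) (fun q => x (.inr (.inr q))) +
    2 * degNoise γ (x (.inr (.inl r))) (fun j => x (.inl j)))) / Fintype.card R

lemma cutVal_triW_add_le [Nonempty B] [Nonempty R] [Nonempty Q] (γ : ℝ) (hμ : 0 < sphereMu d γ)
    (x : B ⊕ R ⊕ Q → Sph d) {X : Matrix (B ⊕ R ⊕ Q) (B ⊕ R ⊕ Q) ℝ} (h : Sdp3Feasible X) :
    cutVal (triW γ x) X + (∑ q, nbrAvg γ (fun j => x (.inl j)) (fun r => x (.inr (.inl r)))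
      (X.submatrix Sum.inl Sum.inl) (x (.inr (.inr q)))) / Fintype.card Q ≤ 3 + triNoise γ x := by
  set xB : B → Sph d := fun j => x (.inl j) with hxB
  set xR : R → Sph d := fun r => x (.inr (.inl r)) with hxR
  set xQ : Q → Sph d := fun q => x (.inr (.inr q)) with hxQ
  set μ := sphereMu d γ with hμdef
  have hB : (0 : ℝ) < Fintype.card B := by exact_mod_cast Fintype.card_pos
  have hR : (0 : ℝ) < Fintype.card R := by exact_mod_cast Fintype.card_pos
  have hQ : (0 : ℝ) < Fintype.card Q := by exact_mod_cast Fintype.card_pos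
  set eBQ : B → Q → ℝ := fun j q => (1 + X (.inl j) (.inr (.inr q))) / 2 with heBQ
  set eBR : B → R → ℝ := fun j r => (1 + X (.inl j) (.inr (.inl r))) / 2 with heBR
  set eRQ : R → Q → ℝ := fun r q => (1 + X (.inr (.inl r)) (.inr (.inr q))) / 2 with heRQ
  set FB : Q → ℝ := fun q => ∑ j, sphAdj γ (xQ q) (xB j) / (Fintype.card B * μ) * eBQ j q with hFB
  set FR : Q → ℝ := fun q => ∑ r, sphAdj γ (xQ q) (xR r) / (Fintype.card R * μ) * eRQ r q with hFR
  set FB' : R → ℝ := fun r => ∑ j, sphAdj γ (xR r) (xB j) / (Fintype.card B * μ) * eBR j r with hFB'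
  set A : Q → ℝ := fun q => ∑ j, nbrDist γ xB (xQ q) j * eBQ j q with hA
  set A' : R → ℝ := fun r => ∑ j, nbrDist γ xB (xR r) j * eBR j r with hA'
  have hAle : ∀ q, 0 ≤ A q ∧ A q ≤ 1 ∧ A q ≤ FB q + degNoise γ (xQ q) xB := by
    intro q
    refine ⟨sum_nonneg fun j _ => mul_nonneg (nbrDist_nonneg _ _ _ _) (h.sim_mem _ _).1, ?_, ?_⟩
    · rw [← sum_nbrDist γ xB (xQ q)]
      exact sum_le_sum fun j _ => mul_le_of_le_one_right (nbrDist_nonneg _ _ _ _) (h.sim_mem _ _).2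
    · have := (abs_le.1 (abs_sum_nbrDist_sub_le γ hμ xB (xQ q) (f := fun j => eBQ j q)
        (fun j => (h.sim_mem _ _).1) (fun j => (h.sim_mem _ _).2))).2
      simp only [hA, hFB]; linarith
  have hAle' : ∀ r, 0 ≤ A' r ∧ A' r ≤ 1 ∧ A' r ≤ FB' r + degNoise γ (xR r) xB := by
    intro r
    refine ⟨sum_nonneg fun j _ => mul_nonneg (nbrDist_nonneg _ _ _ _) (h.sim_mem _ _).1, ?_, ?_⟩
    · rw [← sum_nbrDist γ xB (xR r)]
      exact sum_le_sum fun j _ => mul_le_of_le_one_right (nbrDist_nonneg _ _ _ _) (h.sim_mem _ _).2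
    · have := (abs_le.1 (abs_sum_nbrDist_sub_le γ hμ xB (xR r) (f := fun j => eBR j r)
        (fun j => (h.sim_mem _ _).1) (fun j => (h.sim_mem _ _).2))).2
      simp only [hA', hFB']; linarith
  set G : Q → ℝ := fun q => ∑ r, sphAdj γ (xQ q) (xR r) / (Fintype.card R * μ) * A' r with hG
  have hJ : ∀ q, nbrAvg γ xB xR (X.submatrix Sum.inl Sum.inl) (xQ q) ≤
      FB q + FR q + G q + degNoise γ (xQ q) xB + 2 * degNoise γ (xQ q) xR := by
    intro q
    have hf := h.submatrix (Sum.inl : B → B ⊕ R ⊕ Q)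
    have h1 := (abs_le.1 (abs_sum_nbrDist_sub_le γ hμ xR (xQ q)
      (f := fun r => hatE γ xB (X.submatrix Sum.inl Sum.inl) (xQ q) (xR r))
      (fun r => (hatE_mem γ xB hf _ _).1) (fun r => (hatE_mem γ xB hf _ _).2))).2
    have h2 : ∑ r, sphAdj γ (xQ q) (xR r) / (Fintype.card R * μ) *
        hatE γ xB (X.submatrix Sum.inl Sum.inl) (xQ q) (xR r) ≤
        (∑ r, sphAdj γ (xQ q) (xR r) / (Fintype.card R * μ)) * A q + FR q + G q := by
      rw [sum_mul, ← sum_add_distrib, ← sum_add_distrib]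
      refine sum_le_sum fun r _ => ?_
      rw [← mul_add, ← mul_add]
      exact mul_le_mul_of_nonneg_left (hatE_le_path γ xB h Sum.inl _ _ _ _)
        (div_nonneg (sphAdj_nonneg _ _ _) (by positivity))
    have h3 : (∑ r, sphAdj γ (xQ q) (xR r) / (Fintype.card R * μ)) * A q ≤
        A q + degNoise γ (xQ q) xR := by
      have h4 := mul_le_mul_of_nonneg_right (degRatio_le γ (xQ q) xR) (hAle q).1
      have h5 := mul_le_of_le_one_right (degNoise_nonneg γ (xQ q) xR) (hAle q).2.1
      linarith
    have h6 := (hAle q).2.2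
    simp only [nbrAvg]
    linarith
  have hGsum : (∑ q, G q) / Fintype.card Q ≤
      (∑ r, (FB' r + degNoise γ (xR r) xB + degNoise γ (xR r) xQ)) / Fintype.card R := by
    have e : (∑ q, G q) / Fintype.card Q =
        (∑ r, (∑ q, sphAdj γ (xR r) (xQ q) / (Fintype.card Q * μ)) * A' r) / Fintype.card R := by
      simp only [hG, sum_mul]
      rw [sum_comm, sum_div, sum_div]
      refine sum_congr rfl fun r _ => ?_
      rw [sum_div, sum_div]
      refine sum_congr rfl fun q _ => ?_
      rw [sphAdj_comm γ (xQ q)]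
      field_simp
    rw [e]
    refine div_le_div_of_nonneg_right (sum_le_sum fun r _ => ?_) hR.le
    have h4 := mul_le_mul_of_nonneg_right (degRatio_le γ (xR r) xQ) (hAle' r).1
    have h5 := mul_le_of_le_one_right (degNoise_nonneg γ (xR r) xQ) (hAle' r).2.1
    have h6 := (hAle' r).2.2
    linarith
  have hcut : cutVal (triW γ x) X =
      (∑ r, ∑ j, sphAdj γ (xR r) (xB j) / (Fintype.card B * μ) * (1 - eBR j r)) / Fintype.card R +
      (∑ q, ∑ j, sphAdj γ (xQ q) (xB j) / (Fintype.card B * μ) * (1 - eBQ j q)) / Fintype.card Q +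
      (∑ q, ∑ r, sphAdj γ (xQ q) (xR r) / (Fintype.card R * μ) *
          (1 - eRQ r q)) / Fintype.card Q := by
    simp only [cutVal, triW, Fintype.sum_sum_type, partCoef, zero_mul, sum_const_zero, zero_add,
      add_zero, sum_add_distrib]
    rw [add_assoc]
    congr 1
    · rw [sum_comm (s := univ (α := B)), sum_div]
      refine sum_congr rfl fun r _ => ?_
      rw [sum_div]
      refine sum_congr rfl fun j _ => ?_
      simp only [hxB, hxR, heBR]
      rw [sphAdj_comm γ (x (.inl j))]
      have : (1 - X (.inl j) (.inr (.inl r))) / 2 =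
        1 - (1 + X (.inl j) (.inr (.inl r))) / 2 := by ring
      rw [this, ← hμdef]; field_simp
    congr 1
    · rw [sum_comm (s := univ (α := B)), sum_div]
      refine sum_congr rfl fun r _ => ?_
      rw [sum_div]
      refine sum_congr rfl fun j _ => ?_
      simp only [hxB, hxQ, heBQ]
      rw [sphAdj_comm γ (x (.inl j))]
      have : (1 - X (.inl j) (.inr (.inr r))) / 2 =
        1 - (1 + X (.inl j) (.inr (.inr r))) / 2 := by ring
      rw [this, ← hμdef]; field_simp
    · rw [sum_comm (s := univ (α := R)), sum_div]
      refine sum_congr rfl fun r _ => ?_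
      rw [sum_div]
      refine sum_congr rfl fun j _ => ?_
      simp only [hxR, hxQ, heRQ]
      rw [sphAdj_comm γ (x (.inr (.inl j)))]
      have : (1 - X (.inr (.inl j)) (.inr (.inr r))) / 2 =
        1 - (1 + X (.inr (.inl j)) (.inr (.inr r))) / 2 := by ring
      rw [this, ← hμdef]; field_simp
  have hK1 : ∀ r, ∑ j, sphAdj γ (xR r) (xB j) / (Fintype.card B * μ) * (1 - eBR j r) ≤
      1 + degNoise γ (xR r) xB - FB' r := by
    intro r
    simp only [mul_sub, mul_one, sum_sub_distrib, hFB']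
    have := degRatio_le γ (xR r) xB
    linarith
  have hK2 : ∀ q, ∑ j, sphAdj γ (xQ q) (xB j) / (Fintype.card B * μ) * (1 - eBQ j q) ≤
      1 + degNoise γ (xQ q) xB - FB q := by
    intro r
    simp only [mul_sub, mul_one, sum_sub_distrib, hFB]
    have := degRatio_le γ (xQ r) xB
    linarith
  have hK3 : ∀ q, ∑ r, sphAdj γ (xQ q) (xR r) / (Fintype.card R * μ) * (1 - eRQ r q) ≤
      1 + degNoise γ (xQ q) xR - FR q := by
    intro r
    simp only [mul_sub, mul_one, sum_sub_distrib, hFR]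
    have := degRatio_le γ (xQ r) xR
    linarith
  have s1 := div_le_div_of_nonneg_right (sum_le_sum fun r (_ : r ∈ univ) => hK1 r) hR.le
  have s2 := div_le_div_of_nonneg_right (sum_le_sum fun r (_ : r ∈ univ) => hK2 r) hQ.le
  have s3 := div_le_div_of_nonneg_right (sum_le_sum fun r (_ : r ∈ univ) => hK3 r) hQ.le
  have s4 := div_le_div_of_nonneg_right (sum_le_sum fun r (_ : r ∈ univ) => hJ r) hQ.le
  have oneR : (∑ _r : R, (1 : ℝ)) / Fintype.card R = 1 := by simp
  have oneQ : (∑ _r : Q, (1 : ℝ)) / Fintype.card Q = 1 := by simp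
  rw [hcut]
  simp only [triNoise, sum_add_distrib, sum_sub_distrib, ← mul_sum, add_div, sub_div, oneR, oneQ,
    mul_div_assoc] at s1 s2 s3 s4 hGsum ⊢
  linarith

end tripartite

lemma measurePreserving_pi_comp_injective {S T Y : Type} [Fintype S] [Fintype T] [MeasurableSpace Y]
    (σ : Measure Y) [IsProbabilityMeasure σ] {g : S → T} (hg : Function.Injective g) :
    MeasurePreserving (fun (x : T → Y) s => x (g s)) (Measure.pi fun _ : T => σ)
      (Measure.pi fun _ : S => σ) := by
  have h1 := ProbabilityTheory.iIndepFun_pi (μ := fun _ : T => σ) (X := fun _ y => y)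
    (fun _ => aemeasurable_id)
  have h2 := h1.precomp hg
  have hm : ∀ s, Measurable fun x : T → Y => x (g s) := fun s => measurable_pi_apply _
  rw [ProbabilityTheory.iIndepFun_iff_map_fun_eq_pi_map (fun s => (hm s).aemeasurable)] at h2
  refine ⟨measurable_pi_lambda _ hm, ?_⟩
  rw [h2]
  congr 1
  ext1 s
  exact (measurePreserving_eval (fun _ : T => σ) (g s)).map_eq

lemma integral_comp_measurePreserving {α β : Type} [MeasurableSpace α] [MeasurableSpace β]
    {μ : Measure α} {ν : Measure β} {f : α → β} (h : MeasurePreserving f μ ν) {g : β → ℝ}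
    (hg : Measurable g) : ∫ x, g (f x) ∂μ = ∫ y, g y ∂ν := by
  rw [← h.map_eq, integral_map h.measurable.aemeasurable hg.aestronglyMeasurable]

section expectation
variable {d b m : ℕ} {γ : ℝ}

lemma integral_degNoise_comp_le {T : Type} [Fintype T] [NeZero d] {k : ℕ} (hk : 0 < k)
    (hμ : 0 < sphereMu d γ) {f : Fin k → T} (hf : Function.Injective f) {s : T}
    (hs : ∀ j, s ≠ f j) :
    ∫ x : T → Sph d, degNoise γ (x s) (fun j => x (f j))
        ∂(Measure.pi fun _ : T => sphereUniform d) ≤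
      1 / √(k * sphereMu d γ) := by
  have hg : Function.Injective (Fin.cons s f : Fin (k + 1) → T) :=
    Fin.cons_injective_iff.2 ⟨fun ⟨j, hj⟩ => hs j hj.symm, hf⟩
  have h1 := measurePreserving_pi_comp_injective (sphereUniform d) hg
  have hm : Measurable fun x : Fin (k + 1) → Sph d =>
      degNoise γ (x 0) (fun j : Fin k => x (Fin.succAbove 0 j)) :=
    measurable_degNoise_comp γ _ _ (measurable_pi_apply _) fun j => measurable_pi_apply _
  have h2 := integral_comp_measurePreserving h1 hm
  have h3 := integral_degNoise_succAbove_le (d := d) hk γ hμ 0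
  rw [← h2] at h3
  simpa using h3

lemma measurable_triNoise :
    Measurable fun x : Fin b ⊕ Fin m ⊕ Fin m → Sph d => triNoise γ x := by
  unfold triNoise
  have h : ∀ (k : ℕ) (s : Fin b ⊕ Fin m ⊕ Fin m) (f : Fin k → Fin b ⊕ Fin m ⊕ Fin m),
      Measurable fun x : Fin b ⊕ Fin m ⊕ Fin m → Sph d => degNoise γ (x s) (fun j => x (f j)) :=
    fun k s f => measurable_degNoise_comp γ _ _
        (measurable_pi_apply _) fun j => measurable_pi_apply _
  refine .add (.div_const (Finset.measurable_sum _ fun q _ => ?_) _)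
    (.div_const (Finset.measurable_sum _ fun q _ => ?_) _)
  · exact ((h m _ _).const_mul 3).add ((h b _ _).const_mul 2)
  · exact (h m _ _).add ((h b _ _).const_mul 2)

lemma triNoise_nonneg (x : Fin b ⊕ Fin m ⊕ Fin m → Sph d) : 0 ≤ triNoise γ x := by
  have h : ∀ (k : ℕ) (y : Sph d) (f : Fin k → Sph d), 0 ≤ degNoise γ y f :=
    fun k y f => degNoise_nonneg γ y f
  unfold triNoise
  refine add_nonneg (div_nonneg (sum_nonneg fun q _ => ?_) (by positivity))
    (div_nonneg (sum_nonneg fun q _ => ?_) (by positivity))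
  · have := h m (x (.inr (.inr q))) fun r => x (.inr (.inl r))
    have := h b (x (.inr (.inr q))) fun r => x (.inl r)
    linarith
  · have := h m (x (.inr (.inl q))) fun r => x (.inr (.inr r))
    have := h b (x (.inr (.inl q))) fun r => x (.inl r)
    linarith

lemma integrable_degNoise_comp {T : Type} [Fintype T] [NeZero d] {k : ℕ}
    (hμ : 0 < sphereMu d γ) (f : Fin k → T) (s : T) :
    Integrable (fun x : T → Sph d => degNoise γ (x s) (fun j => x (f j)))
      (Measure.pi fun _ : T => sphereUniform d) :=
  integrable_of_mem_Icc (measurable_degNoise_comp γ _ _ (measurable_pi_apply _)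
    fun _ => measurable_pi_apply _) fun _ => ⟨degNoise_nonneg _ _ _, degNoise_le γ hμ _ _⟩

lemma triNoise_le (hμ : 0 < sphereMu d γ) (x : Fin b ⊕ Fin m ⊕ Fin m → Sph d) :
    triNoise γ x ≤ (∑ _q : Fin m, 5 * (1 / sphereMu d γ + 1)) / Fintype.card (Fin m) +
      (∑ _q : Fin m, 3 * (1 / sphereMu d γ + 1)) / Fintype.card (Fin m) := by
  have h : ∀ (k : ℕ) (y : Sph d) (f : Fin k → Sph d), degNoise γ y f ≤ 1 / sphereMu d γ + 1 :=
    fun k y f => degNoise_le γ hμ y f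
  unfold triNoise
  refine add_le_add (div_le_div_of_nonneg_right (sum_le_sum fun q _ => ?_) (by positivity))
    (div_le_div_of_nonneg_right (sum_le_sum fun q _ => ?_) (by positivity))
  · have := h m (x (.inr (.inr q))) fun r => x (.inr (.inl r))
    have := h b (x (.inr (.inr q))) fun r => x (.inl r)
    linarith
  · have := h m (x (.inr (.inl q))) fun r => x (.inr (.inr r))
    have := h b (x (.inr (.inl q))) fun r => x (.inl r)
    linarith

lemma integrable_triNoise [NeZero d] (hμ : 0 < sphereMu d γ) :
    Integrable (fun x : Fin b ⊕ Fin m ⊕ Fin m → Sph d => triNoise γ x)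
      (Measure.pi fun _ => sphereUniform d) :=
  integrable_of_mem_Icc measurable_triNoise fun x => ⟨triNoise_nonneg x, triNoise_le hμ x⟩

lemma integral_triNoise_le [NeZero d] (hμ : 0 < sphereMu d γ) (hb : 0 < b) (hm : 0 < m) :
    ∫ x : Fin b ⊕ Fin m ⊕ Fin m → Sph d, triNoise γ x ∂(Measure.pi fun _ => sphereUniform d) ≤
      4 * (1 / √(m * sphereMu d γ)) + 4 * (1 / √(b * sphereMu d γ)) := by
  set P := Measure.pi fun _ : Fin b ⊕ Fin m ⊕ Fin m => sphereUniform d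
  have hi : ∀ (k : ℕ) (f : Fin k → Fin b ⊕ Fin m ⊕ Fin m) (s),
      Integrable (fun x : Fin b ⊕ Fin m ⊕ Fin m → Sph d => degNoise γ (x s) (fun j => x (f j))) P :=
    fun k f s => integrable_degNoise_comp hμ f s
  have hm' : (0 : ℝ) < m := by exact_mod_cast hm
  unfold triNoise
  rw [integral_add, integral_div, integral_div, integral_finsetSum, integral_finsetSum]
  · have e1 : ∀ q : Fin m, ∫ x : Fin b ⊕ Fin m ⊕ Fin m → Sph d,
        (3 * degNoise γ (x (.inr (.inr q))) (fun r => x (.inr (.inl r))) +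
          2 * degNoise γ (x (.inr (.inr q))) (fun j => x (.inl j))) ∂P ≤
        3 * (1 / √(m * sphereMu d γ)) + 2 * (1 / √(b * sphereMu d γ)) := by
      intro q
      rw [integral_add ((hi m _ _).const_mul 3) ((hi b _ _).const_mul 2), integral_const_mul,
        integral_const_mul]
      have h1 := integral_degNoise_comp_le (T := Fin b ⊕ Fin m ⊕ Fin m) (d := d) hm hμ
        (f := fun r => .inr (.inl r)) (s := .inr (.inr q)) (fun a c h => by simpa using h) (by simp)
      have h2 := integral_degNoise_comp_le (T := Fin b ⊕ Fin m ⊕ Fin m) (d := d) hb hμ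
        (f := fun r => .inl r) (s := .inr (.inr q)) (fun a c h => by simpa using h) (by simp)
      linarith
    have e2 : ∀ q : Fin m, ∫ x : Fin b ⊕ Fin m ⊕ Fin m → Sph d,
        (degNoise γ (x (.inr (.inl q))) (fun r => x (.inr (.inr r))) +
          2 * degNoise γ (x (.inr (.inl q))) (fun j => x (.inl j))) ∂P ≤
        1 / √(m * sphereMu d γ) + 2 * (1 / √(b * sphereMu d γ)) := by
      intro q
      rw [integral_add (hi m _ _) ((hi b _ _).const_mul 2), integral_const_mul]
      have h1 := integral_degNoise_comp_le (T := Fin b ⊕ Fin m ⊕ Fin m) (d := d) hm hμ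
        (f := fun r => .inr (.inr r)) (s := .inr (.inl q)) (fun a c h => by simpa using h) (by simp)
      have h2 := integral_degNoise_comp_le (T := Fin b ⊕ Fin m ⊕ Fin m) (d := d) hb hμ
        (f := fun r => .inl r) (s := .inr (.inl q)) (fun a c h => by simpa using h) (by simp)
      linarith
    have s1 := div_le_div_of_nonneg_right (sum_le_sum fun q (_ : q ∈ univ) => e1 q) hm'.le
    have s2 := div_le_div_of_nonneg_right (sum_le_sum fun q (_ : q ∈ univ) => e2 q) hm'.le
    have e : ∀ c : ℝ, (∑ _q : Fin m, c) / m = c := fun c => by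
      simp only [sum_const, card_univ, Fintype.card_fin, nsmul_eq_mul]; field_simp
    rw [e] at s1 s2
    simp only [Fintype.card_fin]
    linarith
  · exact fun q _ => (hi m _ _).add ((hi b _ _).const_mul 2)
  · exact fun q _ => ((hi m _ _).const_mul 3).add ((hi b _ _).const_mul 2)
  · exact (integrable_finsetSum _ fun q _ => ((hi m _ _).const_mul 3).add
        ((hi b _ _).const_mul 2)).div_const _
  · exact (integrable_finsetSum _ fun q _ => (hi m _ _).add ((hi b _ _).const_mul 2)).div_const _

lemma partCoef_le_one {B R Q : Type} [Fintype B] [Fintype R] [Fintype Q] (s t : B ⊕ R ⊕ Q) :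
    partCoef B R Q s t ≤ 1 := by
  have h : ∀ a c : ℕ, 1 / ((a : ℝ) * c) ≤ 1 := fun a c => by
    rw [← Nat.cast_mul, one_div]; exact Nat.cast_inv_le_one _
  rcases s with _ | _ | _ <;> rcases t with _ | _ | _ <;> simp only [partCoef] <;>
    first | exact h _ _ | exact zero_le_one

lemma measurable_triW {B R Q : Type} [Fintype B] [Fintype R] [Fintype Q] (s t : B ⊕ R ⊕ Q) :
    Measurable fun x : B ⊕ R ⊕ Q → Sph d => triW γ x s t :=
  ((measurable_sphAdj_comp γ _ _ (measurable_pi_apply s) (measurable_pi_apply t)).div_const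
    _).const_mul _

lemma measurable_sdp3_triW {B R Q : Type} [Fintype B] [Fintype R] [Fintype Q] :
    Measurable fun x : B ⊕ R ⊕ Q → Sph d => sdp3 (triW γ x) :=
  measurable_sdp3_comp _ fun s t => measurable_triW s t

lemma sdp3_triW_le {B R Q : Type} [Fintype B] [Fintype R] [Fintype Q] (hμ : 0 < sphereMu d γ)
    (x : B ⊕ R ⊕ Q → Sph d) :
    sdp3 (triW γ x) ≤ ∑ _s : B ⊕ R ⊕ Q, ∑ _t : B ⊕ R ⊕ Q, 1 * (1 / sphereMu d γ) := by
  refine (sdp3_le_sum (triW_nonneg γ x)).trans (sum_le_sum fun s _ => sum_le_sum fun t _ => ?_)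
  refine mul_le_mul (partCoef_le_one s t)
    (div_le_div_of_nonneg_right (sphAdj_le_one _ _ _) hμ.le)
    (div_nonneg (sphAdj_nonneg _ _ _) hμ.le) zero_le_one

lemma integrable_sdp3_triW {B R Q : Type} [Fintype B] [Fintype R] [Fintype Q] [NeZero d]
    (hμ : 0 < sphereMu d γ) :
    Integrable (fun x : B ⊕ R ⊕ Q → Sph d => sdp3 (triW γ x))
      (Measure.pi fun _ => sphereUniform d) :=
  integrable_of_mem_Icc measurable_sdp3_triW fun x => ⟨sdp3_nonneg _, sdp3_triW_le hμ x⟩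

lemma integral_sum_pi {S T Y : Type} [Fintype S] [Fintype T] [MeasurableSpace Y]
    (σ : Measure Y) [IsProbabilityMeasure σ] {g : (S ⊕ T → Y) → ℝ} (hg : Measurable g)
    {A C : ℝ} (hgb : ∀ x, A ≤ g x ∧ g x ≤ C) :
    ∫ x, g x ∂(Measure.pi fun _ => σ) =
      ∫ y, ∫ z, g (Sum.elim y z) ∂(Measure.pi fun _ => σ) ∂(Measure.pi fun _ => σ) := by
  have h := measurePreserving_sumPiEquivProdPi_symm (X := fun _ : S ⊕ T => Y) (fun _ => σ)
  have hm : Measurable fun p : (S → Y) × (T → Y) => g (Sum.elim p.1 p.2) := by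
    refine hg.comp (measurable_pi_lambda _ ?_)
    rintro (s | t)
    · exact (measurable_pi_apply s).comp measurable_fst
    · exact (measurable_pi_apply t).comp measurable_snd
  rw [← integral_comp_measurePreserving h hg, ← integral_prod _
      (integrable_of_mem_Icc hm fun _ => hgb _)]
  refine integral_congr_ae (Filter.Eventually.of_forall fun p => ?_)
  refine congrArg g (funext ?_)
  rintro (s | t) <;> rfl

end expectation

lemma integral_sdp3_triW_le {d b m : ℕ} {γ : ℝ} (hd : 3 ≤ d) (h0 : 0 < γ) (h1 : γ ≤ 1 / 2)
    (hμ : 0 < sphereMu d γ) {k : ℕ} (hk : 1 ≤ k)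
    (hcos : 1 - 2 * γ / 9 ≤ Real.cos (Real.pi / (2 * k + 1 : ℕ)))
    {θ : ℝ} (hθ : 0 < θ) (hθ1 : θ ≤ 1) (hbm : 10 ^ 5 * (b : ℝ) ≤ m * θ ^ 3)
    (hb : 0 < b) (hm : 0 < m) :
    ∫ x : Fin b ⊕ Fin m ⊕ Fin m → Sph d, sdp3 (triW γ x) ∂(Measure.pi fun _ => sphereUniform d) ≤
      3 - 1 / (2 * (2 * k + 1 : ℕ) : ℝ) + 4 * θ + 5 * (1 / √(m * sphereMu d γ)) +
        4 * (1 / √(b * sphereMu d γ)) := by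
  have : NeZero d := ⟨by omega⟩
  have : Nonempty (Fin b) := ⟨⟨0, hb⟩⟩
  have : Nonempty (Fin m) := ⟨⟨0, hm⟩⟩
  set σ := sphereUniform d with hσ
  set F : (Fin b ⊕ Fin m ⊕ Fin m → Sph d) → ℝ := fun x => sdp3 (triW γ x) - triNoise γ x with hF
  obtain ⟨M, hM⟩ : ∃ M : ℝ, ∀ x, -M ≤ F x ∧ F x ≤ M := by
    refine ⟨max (∑ _s : Fin b ⊕ Fin m ⊕ Fin m, ∑ _t : Fin b ⊕ Fin m ⊕ Fin m, 1 * (1 / sphereMu d γ))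
      ((∑ _q : Fin m, 5 * (1 / sphereMu d γ + 1)) / Fintype.card (Fin m) +
      (∑ _q : Fin m, 3 * (1 / sphereMu d γ + 1)) / Fintype.card (Fin m)), fun x => ?_⟩
    have e1 := sdp3_triW_le hμ x
    have e2 := sdp3_nonneg (triW γ x)
    have e3 := triNoise_nonneg (γ := γ) x
    have e4 := triNoise_le hμ x
    simp only [hF]
    exact ⟨(neg_le_neg (le_max_of_le_right e4)).trans (by linarith), le_max_of_le_left
        (by linarith)⟩
  have hFm : Measurable F := measurable_sdp3_triW.sub measurable_triNoise
  set c : ℝ := 3 - 1 / (2 * (2 * k + 1 : ℕ) : ℝ) with hc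
  set D : (Fin m → Sph d) → ℝ := fun xR => ∫ y, degNoise γ y xR ∂σ with hD
  have hDm : Measurable fun p : (Fin m → Sph d) × Sph d => degNoise γ p.2 p.1 :=
    measurable_degNoise_comp γ _ _ measurable_snd fun j =>
        (measurable_pi_apply j).comp measurable_fst
  have hDi2 : Integrable (fun p : (Fin m → Sph d) × Sph d => degNoise γ p.2 p.1)
      ((Measure.pi fun _ : Fin m => σ).prod σ) :=
    integrable_of_mem_Icc hDm fun _ => ⟨degNoise_nonneg _ _ _, degNoise_le γ hμ _ _⟩
  have hDi : Integrable D (Measure.pi fun _ : Fin m => σ) := hDi2.integral_prod_left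
  have hDle : ∫ x, D x ∂(Measure.pi fun _ : Fin m => σ) ≤ 1 / √(m * sphereMu d γ) := by
    simp only [hD]
    rw [integral_integral_swap hDi2]
    calc _ ≤ ∫ _ : Sph d, 1 / √(m * sphereMu d γ) ∂σ := by
          refine integral_mono hDi2.integral_prod_right (integrable_const _) fun y => ?_
          have := integral_degNoise_le (ι := Fin m) γ hμ y
          simpa using this
      _ = _ := by simp
  have hinner : ∀ xB : Fin b → Sph d, ∫ z, F (Sum.elim xB z) ∂(Measure.pi fun _ => σ) ≤
      c + 4 * θ + 1 / √(m * sphereMu d γ) := by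
    intro xB
    have hme : Measurable fun z : Fin m ⊕ Fin m → Sph d => F (Sum.elim xB z) := by
      refine hFm.comp (measurable_pi_lambda _ ?_)
      rintro (s | t)
      · exact measurable_const
      · exact measurable_pi_apply t
    rw [integral_sum_pi σ hme fun z => hM _]
    obtain ⟨N1, hN1m, hN1b, hN1i, hN1⟩ := exists_noise_nbrAvg (B := Fin b)
        (m := m) hd h0 h1 hμ hk hcos
      hθ hθ1 (by simpa using hbm) hm xB
    have hN1int : Integrable N1 (Measure.pi fun _ : Fin m => σ) := integrable_of_mem_Icc hN1m hN1b
    have hpm : Measurable fun p : (Fin m → Sph d) × (Fin m → Sph d) =>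
        F (Sum.elim xB (Sum.elim p.1 p.2)) := by
      refine hFm.comp (measurable_pi_lambda _ ?_)
      rintro (s | t | t)
      · exact measurable_const
      · exact (measurable_pi_apply t).comp measurable_fst
      · exact (measurable_pi_apply t).comp measurable_snd
    have hpi : Integrable (fun p : (Fin m → Sph d) × (Fin m → Sph d) =>
        F (Sum.elim xB (Sum.elim p.1 p.2)))
        ((Measure.pi fun _ : Fin m => σ).prod (Measure.pi fun _ : Fin m => σ)) :=
      integrable_of_mem_Icc hpm fun _ => hM _
    have hstep : ∀ xR : Fin m → Sph d,
        ∫ xQ, F (Sum.elim xB (Sum.elim xR xQ)) ∂(Measure.pi fun _ : Fin m => σ) ≤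
          c + 2 * θ + D xR + N1 xR := by
      intro xR
      obtain ⟨N2, hN2m, hN2b, hN2i, hN2⟩ := exists_noise_sample_nbrAvg (B := Fin b) (R := Fin m)
        (m := m) hθ hθ1 (by simpa using hbm) γ xB xR
      have hN2int : Integrable N2 (Measure.pi fun _ : Fin m => σ) := integrable_of_mem_Icc hN2m hN2b
      have hpt : ∀ xQ, F (Sum.elim xB (Sum.elim xR xQ)) ≤ (c + D xR + N1 xR) + N2 xQ := by
        intro xQ
        simp only [hF]
        rw [sub_le_iff_le_add]
        refine sdp3_le fun X hX => ?_
        have e1 := cutVal_triW_add_le γ hμ (Sum.elim xB (Sum.elim xR xQ)) hX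
        have e2 := hN2 xQ _ (hX.submatrix (Sum.inl : Fin b → Fin b ⊕ Fin m ⊕ Fin m))
        have e3 := hN1 xR _ (hX.submatrix (Sum.inl : Fin b → Fin b ⊕ Fin m ⊕ Fin m))
        simp only [Sum.elim_inl, Sum.elim_inr, Fintype.card_fin] at e1
        simp only [hc, hD]
        linarith
      have hmq : Measurable fun xQ : Fin m → Sph d => F (Sum.elim xB (Sum.elim xR xQ)) := by
        have := hpm.comp (measurable_prodMk_left (x := xR))
        exact this
      calc _ ≤ ∫ xQ, ((c + D xR + N1 xR) + N2 xQ) ∂(Measure.pi fun _ : Fin m => σ) :=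
            integral_mono (integrable_of_mem_Icc hmq fun _ => hM _)
              ((integrable_const _).add hN2int) hpt
        _ = (c + D xR + N1 xR) + ∫ xQ, N2 xQ ∂(Measure.pi fun _ : Fin m => σ) := by
            rw [integral_add (integrable_const _) hN2int, integral_const, probReal_univ, one_smul]
        _ ≤ _ := by linarith
    calc _ ≤ ∫ xR, (c + 2 * θ + D xR + N1 xR) ∂(Measure.pi fun _ : Fin m => σ) :=
          integral_mono hpi.integral_prod_left (((integrable_const _).add hDi).add hN1int) hstep
      _ = c + 2 * θ + (∫ xR, D xR ∂(Measure.pi fun _ : Fin m => σ)) +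
            ∫ xR, N1 xR ∂(Measure.pi fun _ : Fin m => σ) := by
          have hcD : Integrable (fun xR => c + 2 * θ + D xR) (Measure.pi fun _ : Fin m => σ) :=
            (integrable_const _).add hDi
          rw [integral_add hcD hN1int,
            integral_add (integrable_const _) hDi, integral_const, probReal_univ, one_smul]
      _ ≤ _ := by linarith
  have hFint : ∫ x, F x ∂(Measure.pi fun _ => σ) ≤ c + 4 * θ + 1 / √(m * sphereMu d γ) := by
    rw [integral_sum_pi σ hFm hM]
    have hpm : Measurable fun p : (Fin b → Sph d) × (Fin m ⊕ Fin m → Sph d) =>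
        F (Sum.elim p.1 p.2) := by
      refine hFm.comp (measurable_pi_lambda _ ?_)
      rintro (s | t)
      · exact (measurable_pi_apply s).comp measurable_fst
      · exact (measurable_pi_apply t).comp measurable_snd
    have hpi : Integrable (fun p : (Fin b → Sph d) × (Fin m ⊕ Fin m → Sph d) =>
        F (Sum.elim p.1 p.2))
        ((Measure.pi fun _ : Fin b => σ).prod (Measure.pi fun _ : Fin m ⊕ Fin m => σ)) :=
      integrable_of_mem_Icc hpm fun _ => hM _
    calc _ ≤ ∫ _ : Fin b → Sph d, (c + 4 * θ + 1 / √(m * sphereMu d γ))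
            ∂(Measure.pi fun _ : Fin b => σ) :=
          integral_mono hpi.integral_prod_left (integrable_const _) hinner
      _ = _ := by rw [integral_const, probReal_univ, one_smul]
  have hsub : ∫ x, F x ∂(Measure.pi fun _ => σ) =
      (∫ x : Fin b ⊕ Fin m ⊕ Fin m → Sph d, sdp3 (triW γ x) ∂(Measure.pi fun _ => σ)) -
      ∫ x : Fin b ⊕ Fin m ⊕ Fin m → Sph d, triNoise γ x ∂(Measure.pi fun _ => σ) :=
    integral_sub (integrable_sdp3_triW hμ) (integrable_triNoise hμ)
  have := integral_triNoise_le (d := d) hμ hb hm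
  linarith

lemma exists_perm_pair {V : Type} [DecidableEq V] {a c a' c' : V} (h : a ≠ c) (h' : a' ≠ c') :
    ∃ ρ : Equiv.Perm V, ρ a = a' ∧ ρ c = c' := by
  have h1 : Equiv.swap a a' c ≠ a' := fun e =>
    h ((Equiv.swap a a').injective (by rw [Equiv.swap_apply_left, e]))
  refine ⟨Equiv.swap (Equiv.swap a a' c) c' * Equiv.swap a a', ?_, ?_⟩
  · rw [Equiv.Perm.mul_apply, Equiv.swap_apply_left, Equiv.swap_apply_of_ne_of_ne h1.symm h']
  · rw [Equiv.Perm.mul_apply, Equiv.swap_apply_left]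

lemma sum_perm_pair {n : ℕ} (f : Fin n → Fin n → ℝ) {a c : Fin n} (h : a ≠ c) :
    (n * (n - 1) : ℝ) * ∑ π : Equiv.Perm (Fin n), f (π a) (π c) =
      (Fintype.card (Equiv.Perm (Fin n)) : ℝ) * ∑ i, ∑ j, if i ≠ j then f i j else 0 := by
  have hS : ∀ a' c' : Fin n, a' ≠ c' →
      ∑ π : Equiv.Perm (Fin n), f (π a') (π c') = ∑ π : Equiv.Perm (Fin n), f (π a) (π c) := by
    intro a' c' h'
    obtain ⟨ρ, rfl, rfl⟩ := exists_perm_pair h h'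
    exact Equiv.sum_comp (Equiv.mulRight ρ) fun π : Equiv.Perm (Fin n) => f (π a) (π c)
  have hT : ∀ π : Equiv.Perm (Fin n), (∑ i, ∑ j, if i ≠ j then f (π i) (π j) else 0) =
      ∑ i, ∑ j, if i ≠ j then f i j else 0 := by
    intro π
    rw [← Equiv.sum_comp π fun i => ∑ j, if i ≠ j then f i j else 0]
    refine sum_congr rfl fun i _ => ?_
    rw [← Equiv.sum_comp π fun j => if π i ≠ j then f (π i) j else 0]
    simp
  have e1 : ∑ π : Equiv.Perm (Fin n), (∑ i, ∑ j, if i ≠ j then f (π i) (π j) else 0) =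
      (Fintype.card (Equiv.Perm (Fin n)) : ℝ) * ∑ i, ∑ j, if i ≠ j then f i j else 0 := by
    simp only [hT, sum_const, card_univ, nsmul_eq_mul]
  rw [← e1, sum_comm]
  have e2 : ∀ i : Fin n, ∑ π : Equiv.Perm (Fin n), (∑ j, if i ≠ j then f (π i) (π j) else 0) =
      (n - 1 : ℝ) * ∑ π : Equiv.Perm (Fin n), f (π a) (π c) := by
    intro i
    rw [sum_comm]
    have : ∀ j, (∑ π : Equiv.Perm (Fin n), if i ≠ j then f (π i) (π j) else 0) =
        (1 - if i = j then 1 else 0) * ∑ π : Equiv.Perm (Fin n), f (π a) (π c) := by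
      intro j
      by_cases hij : i = j
      · simp [hij]
      · simp [hij, hS i j hij]
    simp only [this, ← sum_mul, sum_sub_distrib, sum_const, card_univ, Fintype.card_fin,
      nsmul_eq_mul, mul_one, sum_ite_eq, mem_univ, if_true]
  simp only [e2, sum_const, card_univ, Fintype.card_fin, nsmul_eq_mul]
  ring

section averaging
variable {d : ℕ} {B R Q : Type} [Fintype B] [Fintype R] [Fintype Q]

lemma partCoef_self (s : B ⊕ R ⊕ Q) : partCoef B R Q s s = 0 := by
  rcases s with _ | _ | _ <;> rfl

lemma sum_partCoef [Nonempty B] [Nonempty R] [Nonempty Q] :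
    ∑ s, ∑ t, partCoef B R Q s t = 3 := by
  have hB : (Fintype.card B : ℝ) ≠ 0 := by simp
  have hR : (Fintype.card R : ℝ) ≠ 0 := by simp
  have hQ : (Fintype.card Q : ℝ) ≠ 0 := by simp
  simp only [Fintype.sum_sum_type, partCoef, sum_const_zero, zero_add, add_zero, sum_const,
    card_univ, nsmul_eq_mul]
  field_simp
  norm_num

lemma sum_perm_cutVal_triW [Nonempty B] [Nonempty R] [Nonempty Q] {n : ℕ} (hn : 2 ≤ n) (γ : ℝ)
    {g : B ⊕ R ⊕ Q → Fin n} (hg : Function.Injective g) (x : Fin n → Sph d)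
    (X : Matrix (Fin n) (Fin n) ℝ) :
    ∑ π : Equiv.Perm (Fin n), cutVal (triW γ fun s => x (π (g s)))
      (X.submatrix (fun s => π (g s)) fun s => π (g s)) =
      3 * Fintype.card (Equiv.Perm (Fin n)) *
        cutVal (fun i j => vertAdj γ x i j / (n * (n - 1) * sphereMu d γ)) X := by
  set f : Fin n → Fin n → ℝ := fun i j => sphAdj γ (x i) (x j) / sphereMu d γ * ((1 - X i j) / 2)
    with hf
  have hn' : (n * (n - 1) : ℝ) ≠ 0 := by
    have : (2 : ℝ) ≤ n := by exact_mod_cast hn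
    exact ne_of_gt (mul_pos (by linarith) (by linarith))
  have e1 : cutVal (fun i j => vertAdj γ x i j / (n * (n - 1) * sphereMu d γ)) X =
      (∑ i, ∑ j, if i ≠ j then f i j else 0) / (n * (n - 1)) := by
    unfold cutVal
    rw [sum_div]
    refine sum_congr rfl fun i _ => ?_
    rw [sum_div]
    refine sum_congr rfl fun j _ => ?_
    simp only [vertAdj, hf]
    split_ifs
    · rw [div_mul_eq_div_div_swap]; ring
    · simp
  have e2 : ∀ s t, ∑ π : Equiv.Perm (Fin n), partCoef B R Q s t * f (π (g s)) (π (g t)) =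
      partCoef B R Q s t * (Fintype.card (Equiv.Perm (Fin n)) *
        ((∑ i, ∑ j, if i ≠ j then f i j else 0) / (n * (n - 1)))) := by
    intro s t
    rcases eq_or_ne s t with rfl | hst
    · simp [partCoef_self]
    · rw [← mul_sum, ← mul_div_assoc, ← sum_perm_pair f (hg.ne hst), mul_div_cancel_left₀ _ hn']
  have e3 : ∑ π : Equiv.Perm (Fin n), cutVal (triW γ fun s => x (π (g s)))
      (X.submatrix (fun s => π (g s)) fun s => π (g s)) =
      ∑ s, ∑ t, ∑ π : Equiv.Perm (Fin n), partCoef B R Q s t * f (π (g s)) (π (g t)) := by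
    unfold cutVal
    rw [sum_comm]
    refine sum_congr rfl fun s _ => ?_
    rw [sum_comm]
    refine sum_congr rfl fun t _ => sum_congr rfl fun π _ => ?_
    simp only [triW, hf, Matrix.submatrix_apply]
    ring
  rw [e3, e1]
  simp only [e2, ← sum_mul, sum_partCoef]
  ring

lemma sdp3_vertAdj_le [Nonempty B] [Nonempty R] [Nonempty Q] {n : ℕ} (hn : 2 ≤ n) (γ : ℝ)
    {g : B ⊕ R ⊕ Q → Fin n} (hg : Function.Injective g) (x : Fin n → Sph d) :
    sdp3 (fun i j => vertAdj γ x i j / (n * (n - 1) * sphereMu d γ)) ≤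
      (∑ π : Equiv.Perm (Fin n), sdp3 (triW γ fun s => x (π (g s)))) /
        (3 * Fintype.card (Equiv.Perm (Fin n))) := by
  refine sdp3_le fun X hX => ?_
  have hc : (0 : ℝ) < 3 * Fintype.card (Equiv.Perm (Fin n)) := by
    have : (0 : ℝ) < Fintype.card (Equiv.Perm (Fin n)) := by exact_mod_cast Fintype.card_pos
    linarith
  rw [le_div_iff₀ hc, mul_comm, ← sum_perm_cutVal_triW hn γ hg x X]
  exact sum_le_sum fun π _ => (hX.submatrix _).cutVal_le_sdp3 _

lemma integral_sdp3_vertAdj_le [Nonempty B] [Nonempty R] [Nonempty Q] [NeZero d] {n : ℕ}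
    (hn : 2 ≤ n) {γ : ℝ} (hμ : 0 < sphereMu d γ) {g : B ⊕ R ⊕ Q → Fin n}
    (hg : Function.Injective g) :
    ∫ x : Fin n → Sph d, sdp3 (fun i j => vertAdj γ x i j / (n * (n - 1) * sphereMu d γ))
      ∂(Measure.pi fun _ => sphereUniform d) ≤
    (∫ x : B ⊕ R ⊕ Q → Sph d, sdp3 (triW γ x) ∂(Measure.pi fun _ => sphereUniform d)) / 3 := by
  have hmp : ∀ π : Equiv.Perm (Fin n), MeasurePreserving
      (fun (x : Fin n → Sph d) s => x (π (g s))) (Measure.pi fun _ => sphereUniform d)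
      (Measure.pi fun _ => sphereUniform d) := fun π =>
    measurePreserving_pi_comp_injective (sphereUniform d) (π.injective.comp hg)
  have hmeas : Measurable fun x : B ⊕ R ⊕ Q → Sph d => sdp3 (triW γ x) := measurable_sdp3_triW
  have hInt : ∀ π : Equiv.Perm (Fin n), Integrable
      (fun x : Fin n → Sph d => sdp3 (triW γ fun s => x (π (g s))))
      (Measure.pi fun _ => sphereUniform d) := fun π => by
    have := (hmp π).integrable_comp_of_integrable (integrable_sdp3_triW (B := B) (R := R)
        (Q := Q) hμ)
    exact this
  have hc : (Fintype.card (Equiv.Perm (Fin n)) : ℝ) ≠ 0 := by simp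
  calc _ ≤ ∫ x : Fin n → Sph d, (∑ π : Equiv.Perm (Fin n), sdp3 (triW γ fun s => x (π (g s)))) /
        (3 * Fintype.card (Equiv.Perm (Fin n))) ∂(Measure.pi fun _ => sphereUniform d) := by
        refine integral_mono_of_nonneg (Filter.Eventually.of_forall fun x => sdp3_nonneg _)
          ((integrable_finsetSum _ fun π _ => hInt π).div_const _)
          (Filter.Eventually.of_forall fun x => sdp3_vertAdj_le hn γ hg x)
    _ = _ := by
        rw [integral_div, integral_finsetSum _ fun π _ => hInt π]
        have : ∀ π : Equiv.Perm (Fin n), ∫ x : Fin n → Sph d, sdp3 (triW γ fun s => x (π (g s)))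
            ∂(Measure.pi fun _ => sphereUniform d) =
            ∫ x : B ⊕ R ⊕ Q → Sph d, sdp3 (triW γ x) ∂(Measure.pi fun _ => sphereUniform d) :=
          fun π => integral_comp_measurePreserving (hmp π) hmeas
        simp only [this, sum_const, card_univ, nsmul_eq_mul]
        field_simp

lemma sdp3_geomEdgeDist_le_add {n : ℕ} {γ c : ℝ} (hc : 0 < c) (x : Fin n → Sph d) :
    sdp3 (geomEdgeDist d n γ x) ≤ sdp3 (fun i j => vertAdj γ x i j / c) +
      |edgeCount γ x / c - 1| := by
  refine sdp3_le fun X hX => ?_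
  set N := edgeCount γ x with hN
  set v := cutVal (geomEdgeDist d n γ x) X with hv
  have h1 : v ≤ 1 := (hX.cutVal_le_sdp3 _).trans (sdp3_geomEdgeDist_le_one γ x)
  have h2 := hX.cutVal_le_sdp3 fun i j => vertAdj γ x i j / c
  have h3 := sdp3_nonneg fun i j => vertAdj γ x i j / c
  have h4 : N / c * v = if N = 0 then 0 else cutVal (fun i j => vertAdj γ x i j / c) X := by
    split_ifs with h
    · simp [h]
    · simp only [hv, cutVal, mul_sum, geomEdgeDist_eq, ← hN]
      refine sum_congr rfl fun i _ => sum_congr rfl fun j _ => ?_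
      field_simp
  have h5 : N / c * v ≤ sdp3 (fun i j => vertAdj γ x i j / c) := by
    rw [h4]; split_ifs; exacts [h3, h2]
  have h6 := abs_nonneg (N / c - 1)
  have h7 := neg_abs_le (N / c - 1)
  rcases le_total v 0 with hv0 | hv0
  · linarith
  · nlinarith
end averaging

lemma integral_sdp3_geomEdgeDist_le {d b m K : ℕ} {γ : ℝ} (hd : 3 ≤ d) (h0 : 0 < γ) (h1 : γ ≤ 1 / 2)
    (hμ : 0 < sphereMu d γ) {k : ℕ} (hk : 1 ≤ k)
    (hcos : 1 - 2 * γ / 9 ≤ Real.cos (Real.pi / (2 * k + 1 : ℕ)))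
    {θ : ℝ} (hθ : 0 < θ) (hθ1 : θ ≤ 1) (hbm : 10 ^ 5 * (b : ℝ) ≤ m * θ ^ 3)
    (hb : 0 < b) (hm : 0 < m) (hK : b + (m + m) ≤ K + 1) :
    ∫ x : Fin (K + 1) → Sph d, sdp3 (geomEdgeDist d (K + 1) γ x)
      ∂(Measure.pi fun _ => sphereUniform d) ≤
      1 - (1 / (2 * (2 * k + 1 : ℕ) : ℝ) - 4 * θ - 5 * (1 / √(m * sphereMu d γ)) -
        4 * (1 / √(b * sphereMu d γ))) / 3 + 1 / √(K * sphereMu d γ) := by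
  have : NeZero d := ⟨by omega⟩
  have : Nonempty (Fin b) := ⟨⟨0, hb⟩⟩
  have : Nonempty (Fin m) := ⟨⟨0, hm⟩⟩
  have hK0 : 0 < K := by omega
  have hcard : Fintype.card (Fin b ⊕ Fin m ⊕ Fin m) ≤ Fintype.card (Fin
      (K + 1)) := by simpa using hK
  obtain ⟨g⟩ := Function.Embedding.nonempty_of_card_le hcard
  have hc : (0 : ℝ) < (K + 1 : ℕ) * K * sphereMu d γ := by positivity
  have hin := integrable_edgeCount_noise (d := d) (k := K + 1) γ _ hc
  have hle := integral_edgeCount_noise_le (d := d) hK0 γ hμ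
  have hT := integral_sdp3_triW_le hd h0 h1 hμ hk hcos hθ hθ1 hbm hb hm
  have hV := integral_sdp3_vertAdj_le (d := d) (n := K + 1) (by omega) hμ g.injective
  have ecast : ((K + 1 : ℕ) : ℝ) - 1 = K := by push_cast; ring
  rw [ecast] at hV
  have hw : Integrable (fun x : Fin (K + 1) → Sph d =>
      sdp3 (fun i j => vertAdj γ x i j / ((K + 1 : ℕ) * K * sphereMu d γ)))
      (Measure.pi fun _ => sphereUniform d) := by
    refine integrable_of_mem_Icc (A := 0) (B := ∑ _i : Fin (K + 1), ∑ _j : Fin (K + 1),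
      1 / ((K + 1 : ℕ) * K * sphereMu d γ))
      (measurable_sdp3_comp _ fun i j => (measurable_vertAdj γ i j).div_const _)
      fun x => ⟨sdp3_nonneg _, ?_⟩
    refine (sdp3_le_sum fun i j => div_nonneg (vertAdj_nonneg γ x i j) hc.le).trans
      (sum_le_sum fun i _ => sum_le_sum fun j _ => div_le_div_of_nonneg_right ?_ hc.le)
    unfold vertAdj; split_ifs; exacts [sphAdj_le_one _ _ _, zero_le_one]
  calc _ ≤ ∫ x : Fin (K + 1) → Sph d,
        (sdp3 (fun i j => vertAdj γ x i j / ((K + 1 : ℕ) * K * sphereMu d γ)) +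
        |edgeCount γ x / ((K + 1 : ℕ) * K * sphereMu d γ) - 1|)
          ∂(Measure.pi fun _ => sphereUniform d) :=
        integral_mono (integrable_sdp3_geomEdgeDist γ) (hw.add hin)
          fun x => sdp3_geomEdgeDist_le_add hc x
    _ ≤ _ := by
        rw [integral_add hw hin]
        linarith

lemma integral_inner_sq {d : ℕ} [NeZero d] (y : Sph d) :
    ∫ z : Sph d, ⟪(y : EuclideanSpace ℝ (Fin d)), z⟫ ^ 2 ∂(sphereUniform d) = 1 / d := by
  have hcont : ∀ i : Fin d, Measurable fun z : Sph d =>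
      ⟪(EuclideanSpace.basisFun (Fin d) ℝ i : EuclideanSpace ℝ (Fin d)), z⟫ ^ 2 := fun i =>
    (Continuous.pow (continuous_const.inner continuous_subtype_val) 2).measurable
  have hInt : ∀ i : Fin d, Integrable (fun z : Sph d =>
      ⟪(EuclideanSpace.basisFun (Fin d) ℝ i : EuclideanSpace ℝ (Fin d)), z⟫ ^ 2)
          (sphereUniform d) := by
    intro i
    refine integrable_of_mem_Icc (A := 0) (B := 1) (hcont i) fun z => ⟨sq_nonneg _, ?_⟩
    have := abs_real_inner_le_norm (EuclideanSpace.basisFun (Fin d) ℝ i) (z : EuclideanSpace ℝ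
        (Fin d))
    rw [OrthonormalBasis.norm_eq_one, norm_eq_of_mem_sphere, one_mul] at this
    exact (sq_le_one_iff_abs_le_one _).2 this
  have h1 : ∀ i : Fin d, ∫ z : Sph d,
      ⟪(EuclideanSpace.basisFun (Fin d) ℝ i : EuclideanSpace ℝ (Fin d)), z⟫ ^ 2 ∂(sphereUniform d) =
      ∫ z : Sph d, ⟪(y : EuclideanSpace ℝ (Fin d)), z⟫ ^ 2 ∂(sphereUniform d) := fun i =>
    integral_zonal (fun t => t ^ 2) ⟨EuclideanSpace.basisFun (Fin d) ℝ i, by simp⟩ y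
  have h2 : ∑ i : Fin d, ∫ z : Sph d,
      ⟪(EuclideanSpace.basisFun (Fin d) ℝ i : EuclideanSpace ℝ (Fin d)), z⟫ ^ 2 ∂(sphereUniform d) =
      1 := by
    rw [← integral_finsetSum _ fun i _ => hInt i]
    have : ∀ z : Sph d, ∑ i : Fin d,
        ⟪(EuclideanSpace.basisFun (Fin d) ℝ i : EuclideanSpace ℝ (Fin d)), z⟫ ^ 2 = 1 := by
      intro z
      have := (EuclideanSpace.basisFun (Fin d) ℝ).sum_sq_norm_inner_right (z : EuclideanSpace ℝ
          (Fin d))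
      simp only [Real.norm_eq_abs, sq_abs, norm_eq_of_mem_sphere, one_pow] at this
      exact this
    simp only [this, integral_const, probReal_univ, one_smul]
  simp only [h1, sum_const, card_univ, Fintype.card_fin, nsmul_eq_mul] at h2
  have : (d : ℝ) ≠ 0 := by exact_mod_cast NeZero.ne d
  field_simp
  linarith

lemma one_sub_sphereMu_le {d : ℕ} [NeZero d] {γ : ℝ} (h : 1 / 2 < γ) :
    1 - sphereMu d γ ≤ 1 / (d * (2 * γ - 1) ^ 2) := by
  have ht : 0 < 2 * γ - 1 := by linarith
  let y : Sph d := ⟨EuclideanSpace.basisFun (Fin d) ℝ 0, by simp⟩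
  have hA : Integrable (fun z => sphAdj γ y z) (sphereUniform d) :=
    integrable_of_mem_Icc (measurable_sphAdj_comp γ _ _ measurable_const measurable_id)
      fun z => ⟨sphAdj_nonneg _ _ _, sphAdj_le_one _ _ _⟩
  have hS : Integrable (fun z : Sph d => ⟪(y : EuclideanSpace ℝ (Fin d)), z⟫ ^ 2)
      (sphereUniform d) := by
    refine integrable_of_mem_Icc (A := 0) (B := 1)
      (Continuous.pow (continuous_const.inner continuous_subtype_val) 2).measurable
      fun z => ⟨sq_nonneg _, ?_⟩
    have := abs_real_inner_le_norm (y : EuclideanSpace ℝ (Fin d)) z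
    rw [norm_eq_of_mem_sphere, norm_eq_of_mem_sphere, one_mul] at this
    exact (sq_le_one_iff_abs_le_one _).2 this
  calc 1 - sphereMu d γ = ∫ z, (1 - sphAdj γ y z) ∂(sphereUniform d) := by
        rw [integral_sub (integrable_const _) hA, integral_sphAdj, integral_const, probReal_univ,
          one_smul]
    _ ≤ ∫ z : Sph d, ⟪(y : EuclideanSpace ℝ (Fin d)), z⟫ ^ 2 / (2 * γ - 1) ^ 2
          ∂(sphereUniform d) := by
        refine integral_mono ((integrable_const _).sub hA) (hS.div_const _) fun z => ?_
        simp only [sphAdj_eq_inner]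
        split_ifs with hz
        · rw [sub_self]; positivity
        · rw [sub_zero, one_le_div (by positivity)]
          exact pow_le_pow_left₀ ht.le (not_le.1 hz).le 2
    _ = _ := by rw [integral_div, integral_inner_sq, div_div]

lemma sphereMu_le_one {d : ℕ} [NeZero d] (γ : ℝ) : sphereMu d γ ≤ 1 := by
  unfold sphereMu
  exact ENNReal.toReal_le_of_le_ofReal zero_le_one (by simpa using prob_le_one)

lemma sphereMu_lt_one {d : ℕ} [NeZero d] {γ : ℝ} (h : γ < 1) : sphereMu d γ < 1 := by
  refine lt_of_le_of_ne (sphereMu_le_one γ) fun he => ?_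
  let y : Sph d := ⟨EuclideanSpace.basisFun (Fin d) ℝ 0, by simp⟩
  have hA : Integrable (fun z => sphAdj γ y z) (sphereUniform d) :=
    integrable_of_mem_Icc (measurable_sphAdj_comp γ _ _ measurable_const measurable_id)
      fun z => ⟨sphAdj_nonneg _ _ _, sphAdj_le_one _ _ _⟩
  have h0 : ∫ z, (1 - sphAdj γ y z) ∂(sphereUniform d) = 0 := by
    rw [integral_sub (integrable_const _) hA, integral_sphAdj, integral_const, probReal_univ,
      one_smul, he, sub_self]
  rw [integral_eq_zero_iff_of_nonneg (fun z => sub_nonneg.2 (sphAdj_le_one _ _ _))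
    ((integrable_const _).sub hA)] at h0
  have hopen : IsOpen {z : Sph d | 2 * γ - 1 < ⟪(y : EuclideanSpace ℝ (Fin d)), z⟫} :=
    isOpen_lt continuous_const (continuous_const.inner continuous_subtype_val)
  have hne : {z : Sph d | 2 * γ - 1 < ⟪(y : EuclideanSpace ℝ (Fin d)), z⟫}.Nonempty := by
    refine ⟨y, ?_⟩
    rw [Set.mem_ofPred_eq, real_inner_self_eq_norm_sq, norm_eq_of_mem_sphere]
    linarith
  have hpos : (sphereUniform d) {z : Sph d | 2 * γ - 1 < ⟪(y : EuclideanSpace ℝ (Fin d)),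
      z⟫} ≠ 0 := by
    rw [sphereUniform, Measure.smul_apply, smul_eq_mul]
    exact mul_ne_zero (ENNReal.inv_ne_zero.2 (measure_ne_top _ _)) (hopen.measure_pos _ hne).ne'
  refine hpos (measure_mono_null (fun z hz => ?_) (ae_iff.1 h0))
  have hz' : ¬ ⟪(y : EuclideanSpace ℝ (Fin d)), z⟫ ≤ 2 * γ - 1 := not_le.2 hz
  simp [sphAdj_eq_inner, hz']

lemma exists_dim_mul_sphereMu_ne {γ Δ : ℝ} (h : 1 / 2 < γ) (h1 : γ < 1) (hΔ : 0 < Δ) :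
    ∃ d₀ : ℕ, ∀ d, d₀ ≤ d → ∀ n : ℕ, (n : ℝ) * sphereMu d γ ≠ Δ := by
  set M : ℕ := ⌊Δ⌋₊ + 1 with hM
  have hΔM : Δ < M := by rw [hM]; push_cast; exact Nat.lt_floor_add_one Δ
  have hMpos : (0 : ℝ) < M := hΔ.trans hΔM
  have ht : 0 < (2 * γ - 1) ^ 2 := by have : 0 < 2 * γ - 1 := by linarith
                                      positivity
  have hgap : 0 < 1 - Δ / M := by rw [sub_pos, div_lt_one hMpos]; exact hΔM
  refine ⟨⌊1 / ((2 * γ - 1) ^ 2 * (1 - Δ / M))⌋₊ + 1, fun d hd n hn => ?_⟩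
  have : NeZero d := ⟨by omega⟩
  have hd' : 1 / ((2 * γ - 1) ^ 2 * (1 - Δ / M)) < d :=
    (Nat.lt_floor_add_one _).trans_le (by exact_mod_cast hd)
  have hdpos : (0 : ℝ) < d := lt_trans (by positivity) hd'
  have hμ1 := sphereMu_lt_one (d := d) h1
  have hle := one_sub_sphereMu_le (d := d) h
  have hlt : 1 / (d * (2 * γ - 1) ^ 2) < 1 - Δ / M := by
    rw [div_lt_iff₀ (by positivity)] at hd' ⊢
    linarith
  have hμM : Δ < M * sphereMu d γ := by
    have : Δ / M < sphereMu d γ := by linarith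
    rw [div_lt_iff₀ hMpos] at this
    linarith
  have hμ0 : 0 < sphereMu d γ := pos_of_mul_pos_right (hΔ.trans hμM) hMpos.le
  have hnΔ : Δ < n := by
    have hn0 : (0 : ℝ) < n := pos_of_mul_pos_left (hn ▸ hΔ) hμ0.le
    rw [← hn]; exact mul_lt_of_lt_one_right hn0 hμ1
  have hMn : (M : ℝ) ≤ n := by
    have : ⌊Δ⌋₊ < n := (Nat.floor_lt hΔ.le).2 hnΔ
    exact_mod_cast this
  have := mul_le_mul_of_nonneg_right hMn hμ0.le
  linarith

lemma exists_odd_cos_bound {γ : ℝ} (h0 : 0 < γ) (h1 : γ ≤ 1 / 2) :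
    ∃ k : ℕ, 1 ≤ k ∧ 1 - 2 * γ / 9 ≤ Real.cos (Real.pi / (2 * k + 1 : ℕ)) ∧
      √γ / 18 ≤ 1 / (2 * (2 * k + 1 : ℕ) : ℝ) := by
  set s := √γ with hs
  have hs0 : 0 < s := Real.sqrt_pos.2 h0
  have hss : s ^ 2 = γ := Real.sq_sqrt h0.le
  have hs1 : s ≤ 1 := by nlinarith
  have hk0 : 0 < ⌈3 / s⌉₊ := Nat.ceil_pos.2 (by positivity)
  have hk1 := Nat.le_ceil (3 / s)
  have hk2 := Nat.ceil_lt_add_one (a := 3 / s) (by positivity)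
  rw [div_le_iff₀ hs0] at hk1
  have hk2' : (⌈3 / s⌉₊ : ℝ) * s < 3 + s := by
    have := mul_lt_mul_of_pos_right hk2 hs0
    rwa [add_mul, div_mul_cancel₀ _ hs0.ne', one_mul] at this
  refine ⟨⌈3 / s⌉₊, hk0, ?_, ?_⟩
  · set L : ℝ := ((2 * ⌈3 / s⌉₊ + 1 : ℕ) : ℝ) with hL
    have hLpos : 0 < L := by positivity
    have hLs : 6 ≤ L * s := by rw [hL]; push_cast; nlinarith
    refine le_trans ?_ (Real.one_sub_sq_div_two_le_cos)
    have hpi : Real.pi / L ≤ 2 * s / 3 := by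
      rw [div_le_iff₀ hLpos]
      have := Real.pi_le_four
      nlinarith
    have := pow_le_pow_left₀ (by positivity) hpi 2
    rw [← hss]
    nlinarith
  · rw [le_div_iff₀ (by positivity)]
    push_cast
    nlinarith

/-- Sizes of the parts of the tripartite subgraph used for the upper bound. -/
lemma exists_part_sizes {n : ℕ} {θ Δ μ : ℝ} (hθ : 0 < θ) (hθ1 : θ ≤ 1) (hμ : 0 < μ) (hμ1 : μ ≤ 1)
    (hn : n * μ = Δ) (hΔ : 16 * 10 ^ 5 ≤ Δ * θ ^ 5) :
    ∃ b m : ℕ, 0 < b ∧ b ≤ m ∧ b + (m + m) + 1 ≤ n ∧ 10 ^ 5 * (b : ℝ) ≤ m * θ ^ 3 ∧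
      1 / √(b * μ) ≤ θ := by
  set κ : ℝ := θ ^ 3 / (8 * 10 ^ 5) with hκ
  have hκ0 : 0 < κ := by positivity
  have hθ3 : θ ^ 3 ≤ 1 := pow_le_one₀ hθ.le hθ1
  have hθ2 : θ ^ 2 ≤ 1 := pow_le_one₀ hθ.le hθ1
  have hΔκ : 2 ≤ Δ * κ * θ ^ 2 := by
    have : Δ * κ * θ ^ 2 = Δ * θ ^ 5 / (8 * 10 ^ 5) := by rw [hκ]; ring
    rw [this, le_div_iff₀ (by positivity)]; linarith
  have hΔ0 : 0 < Δ := pos_of_mul_pos_left (by linarith : 0 < Δ * θ ^ 5) (by positivity)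
  have hΔκ1 : 2 ≤ Δ * κ := by
    have : 0 ≤ Δ * κ := by positivity
    nlinarith
  have hn0 : (0 : ℝ) ≤ n := by positivity
  have hnΔ : Δ ≤ n := by rw [← hn]; exact mul_le_of_le_one_right hn0 hμ1
  have hnκ : 2 ≤ n * κ := hΔκ1.trans (mul_le_mul_of_nonneg_right hnΔ hκ0.le)
  have hκ1 : κ ≤ 1 / (8 * 10 ^ 5) := by rw [hκ]; gcongr
  have hn16 : (16 : ℝ) ≤ n := by nlinarith
  set b := ⌊n * κ⌋₊ with hb
  set m := ⌊(n : ℝ) / 4⌋₊ with hm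
  have hb1 : (b : ℝ) ≤ n * κ := Nat.floor_le (by positivity)
  have hb2 : n * κ < b + 1 := Nat.lt_floor_add_one _
  have hm1 : (m : ℝ) ≤ n / 4 := Nat.floor_le (by positivity)
  have hm2 : (n : ℝ) / 4 < m + 1 := Nat.lt_floor_add_one _
  have hbn : (b : ℝ) ≤ n / 8 := by nlinarith
  have hb3 : n * κ / 2 ≤ b := by linarith
  refine ⟨b, m, ?_, ?_, ?_, ?_, ?_⟩
  · have : (0 : ℝ) < b := by linarith
    exact_mod_cast this
  · have : (b : ℝ) ≤ m := by linarith
    exact_mod_cast this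
  · have : (b : ℝ) + (m + m) + 1 ≤ n := by linarith
    exact_mod_cast this
  · have h8 : 10 ^ 5 * (b : ℝ) ≤ n / 8 * θ ^ 3 := by
      calc 10 ^ 5 * (b : ℝ) ≤ 10 ^ 5 * (n * κ) := by linarith
        _ = n / 8 * θ ^ 3 := by rw [hκ]; ring
    exact h8.trans (mul_le_mul_of_nonneg_right (by linarith) (by positivity))
  · have hbμ : 1 ≤ b * μ * θ ^ 2 := by
      have : n * κ / 2 * (μ * θ ^ 2) ≤ b * (μ * θ ^ 2) := mul_le_mul_of_nonneg_right hb3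
          (by positivity)
      have e : n * κ / 2 * (μ * θ ^ 2) = Δ * κ * θ ^ 2 / 2 := by rw [← hn]; ring
      nlinarith
    have hbμ0 : 0 < b * μ := pos_of_mul_pos_left (by linarith : 0 < b * μ * θ ^ 2) (by positivity)
    rw [div_le_iff₀ (Real.sqrt_pos.2 hbμ0)]
    have e : θ * √(b * μ) = √(b * μ * θ ^ 2) := by
      rw [Real.sqrt_mul hbμ0.le, Real.sqrt_sq hθ.le, mul_comm]
    rw [e]
    exact Real.one_le_sqrt.2 hbμ

lemma mul_pow_bound_of_rpow_le {γ Δ : ℝ} (h0 : 0 < γ) (h1 : γ ≤ 1 / 2)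
    (hΔ : γ ^ (-80 : ℝ) ≤ Δ) : 16 * 10 ^ 5 ≤ Δ * (√γ / 576) ^ 5 := by
  set s := √γ with hs
  have hs0 : 0 < s := Real.sqrt_pos.2 h0
  have hss : s ^ 2 = γ := Real.sq_sqrt h0.le
  have hs1 : s ≤ 1 := by nlinarith
  have e : γ ^ (-80 : ℝ) = (γ ^ 80)⁻¹ := by
    rw [Real.rpow_neg h0.le]; norm_cast
  rw [e] at hΔ
  have h2 : (16 * 10 ^ 5 : ℝ) * γ ^ 80 ≤ (s / 576) ^ 5 := by
    have h3 : γ ^ 77 ≤ (1 / 2) ^ 77 := pow_le_pow_left₀ h0.le h1 77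
    have h4 : γ ^ 3 = s ^ 5 * s := by rw [← hss]; ring
    have h5 : γ ^ 80 ≤ (1 / 2) ^ 77 * s ^ 5 := by
      calc γ ^ 80 = γ ^ 77 * (s ^ 5 * s) := by rw [← h4]; ring
        _ ≤ (1 / 2) ^ 77 * (s ^ 5 * 1) := by gcongr
        _ = _ := by ring
    have h6 : 0 < s ^ 5 := by positivity
    rw [div_pow]
    norm_num at h5 ⊢
    linarith
  calc (16 * 10 ^ 5 : ℝ) = (γ ^ 80)⁻¹ * (16 * 10 ^ 5 * γ ^ 80) := by field_simp
    _ ≤ (γ ^ 80)⁻¹ * (s / 576) ^ 5 := by gcongr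
    _ ≤ _ := by gcongr

/-- **`sdp₃` certifies the Max-Cut value of random geometric graphs.** There are constants
`c₁, c₂, C > 0` such that for every `γ ∈ (0,1)` and every `Δ ≥ γ^{-C}`, for all
sufficiently large dimension `d` (depending on `γ`), if `n` satisfies `n·μ(γ,d) = Δ` and
`V` consists of `n` independent uniform random points of `S^{d-1}`, then
`1 − c₂·√γ ≤ E[sdp₃(G_γ[V])] ≤ 1 − c₁·√γ`. -/
theorem random_geometric_graph_sdp3 :
    ∃ c₁ c₂ C : ℝ, 0 < c₁ ∧ 0 < c₂ ∧ 0 < C ∧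
      ∀ γ : ℝ, 0 < γ → γ < 1 →
        ∀ Δ : ℝ, γ ^ (-C) ≤ Δ →
          ∃ d₀ : ℕ, ∀ d : ℕ, d₀ ≤ d →
            ∀ n : ℕ, (n : ℝ) * sphereMu d γ = Δ →
              1 - c₂ * Real.sqrt γ ≤
                  (∫ x : Fin n → Sph d, sdp3 (geomEdgeDist d n γ x)
                    ∂(Measure.pi fun _ : Fin n => sphereUniform d)) ∧
                (∫ x : Fin n → Sph d, sdp3 (geomEdgeDist d n γ x)
                    ∂(Measure.pi fun _ : Fin n => sphereUniform d)) ≤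
                  1 - c₁ * Real.sqrt γ := by
  refine ⟨1 / 108, 5, 80, by norm_num, by norm_num, by norm_num, fun γ h0 h1 Δ hΔ => ?_⟩
  have hΔ0 : 0 < Δ := (Real.rpow_pos_of_pos h0 _).trans_le hΔ
  rcases lt_or_ge (1 / 2) γ with hγ | hγ
  · obtain ⟨d₀, hd₀⟩ := exists_dim_mul_sphereMu_ne hγ h1 hΔ0
    exact ⟨d₀, fun d hd n hn => absurd hn (hd₀ d hd n)⟩
  refine ⟨3, fun d hd n hn => ?_⟩
  have : NeZero d := ⟨by omega⟩
  have hμ : 0 < sphereMu d γ := pos_of_mul_pos_right (hn ▸ hΔ0) (Nat.cast_nonneg n)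
  have hs0 : 0 < √γ := Real.sqrt_pos.2 h0
  have hss : √γ ^ 2 = γ := Real.sq_sqrt h0.le
  have hs1 : √γ ≤ 1 := by nlinarith
  obtain ⟨b, m, hb, hbm, hbmn, hθbm, hη⟩ := exists_part_sizes (θ := √γ / 576) (by positivity)
    (by linarith) hμ (sphereMu_le_one γ) hn (mul_pow_bound_of_rpow_le h0 hγ hΔ)
  obtain ⟨k, hk, hcos, hkγ⟩ := exists_odd_cos_bound h0 hγ
  obtain ⟨K, rfl⟩ : ∃ K, n = K + 1 := ⟨n - 1, by omega⟩
  have hηmono : ∀ j : ℕ, b ≤ j → 1 / √(j * sphereMu d γ) ≤ √γ / 576 := by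
    intro j hj
    have hb' : (0 : ℝ) < b := by exact_mod_cast hb
    have hj' : (b : ℝ) ≤ j := by exact_mod_cast hj
    refine le_trans ?_ hη
    gcongr
  have hηm := hηmono m hbm
  have hηK := hηmono K (by omega)
  constructor
  · rcases le_or_gt γ (1 / 4) with h4 | h4
    · have := le_integral_sdp3_geomEdgeDist hd (by omega : 0 < K) h0 h4 hμ
      linarith
    · have h5 : 1 / 2 < √γ := Real.lt_sqrt_of_sq_lt (by linarith)
      have : 0 ≤ ∫ x : Fin (K + 1) → Sph d, sdp3 (geomEdgeDist d (K + 1) γ x)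
          ∂(Measure.pi fun _ : Fin (K + 1) => sphereUniform d) :=
        integral_nonneg fun x => sdp3_nonneg _
      linarith
  · have := integral_sdp3_geomEdgeDist_le (K := K) hd h0 hγ hμ hk hcos (by positivity) (by linarith)
      hθbm hb (by omega) (by omega)
    linarith
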